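/- arXiv:2506.16804 — 9 statements merged into one kernel-verified Lean document; each statement's English description precedes it below -/
import Mathlib

section
/- There exist constants c > 0 and m₀ such that the following holds for every prime m ≥ m₀. Set n = 2m. There exists a gadget g : {0,1}ⁿ × {0,1}ⁿ → {0,…,m−1} such that for all natural numbers R, C_A, C_B ≥ 1 and all functions Π_A : {0,1}ⁿ × {0,1}ⁿ × Fin R → Fin C_A, Π_B : {0,1}ⁿ × {0,1}ⁿ × Fin R → Fin C_B, and Π_C : {0,1}ⁿ × {0,1}ⁿ × Fin C_A × Fin C_B × Fin R → ({0,…,n−1} × {0,…,n−1} × {0,1}), if for every triple (x, y, z) ∈ ({0,1}ⁿ)³ the probability, over r uniform in Fin R, that the output (ℓ, r', b) = Π_C(x, y, Π_A(y, z, r), Π_B(x, z, r), r) satisfies r' = m + ((g(x,y) + ℓ) mod m) with ℓ < m and b = z_ℓ XOR z_{r'}, is at least 7/8, then log₂ C_A + log₂ C_B ≥ c · n^{1/16}. -/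
open scoped Classical

lemma nof_bias {P Q W : Type} [Fintype P] [DecidableEq P] [Fintype Q] [Fintype W]
    (e : W ≃ (P → Bool) × Q) (S : Finset W) (D : Finset P) (φ : P → Q → Bool)
    (h : ∀ p ∈ D, (3 / 4 : ℝ) * S.card ≤ ((S.filter (fun w => (e w).1 p = φ p (e w).2)).card : ℝ)) :
    (S.card : ℝ) * Real.exp (D.card / 8) ≤ Fintype.card W := by
  set f : W → P → ℝ := fun w p => if (e w).1 p = φ p (e w).2 then 1/2 else -(1/2) with hf
  set Y : W → ℝ := fun w => ∑ p ∈ D, f w p with hY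
  have h1 : (D.card : ℝ) / 4 * S.card ≤ ∑ w ∈ S, Y w := by
    simp only [hY]
    rw [Finset.sum_comm]
    have : ∀ p ∈ D, (S.card : ℝ) / 4 ≤ ∑ w ∈ S, f w p := by
      intro p hp
      have h2 := h p hp
      have h3 : ∑ w ∈ S, f w p
          = ((S.filter (fun w => (e w).1 p = φ p (e w).2)).card : ℝ) - S.card / 2 := by
        have : ∀ w ∈ S, f w p = (if (e w).1 p = φ p (e w).2 then (1:ℝ) else 0) - 1/2 := by
          intro w _
          simp only [hf]
          split_ifs <;> norm_num
        rw [Finset.sum_congr rfl this, Finset.sum_sub_distrib, Finset.sum_boole]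
        simp
        ring
      rw [h3]; linarith
    calc (D.card : ℝ) / 4 * S.card = ∑ p ∈ D, (S.card : ℝ) / 4 := by simp; ring
      _ ≤ _ := Finset.sum_le_sum this
  have h2 : (S.card : ℝ) * Real.exp (D.card / 4) ≤ ∑ w ∈ S, Real.exp (Y w) := by
    have : ∀ w ∈ S, Real.exp (D.card / 4) * (1 + (Y w - D.card / 4)) ≤ Real.exp (Y w) := by
      intro w _
      have h4 := Real.add_one_le_exp (Y w - D.card / 4)
      have h5 : Real.exp (Y w) = Real.exp (D.card / 4) * Real.exp (Y w - D.card / 4) := by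
        rw [← Real.exp_add]; congr 1; ring
      rw [h5]
      apply mul_le_mul_of_nonneg_left _ (Real.exp_pos _).le
      linarith
    refine le_trans ?_ (Finset.sum_le_sum this)
    rw [← Finset.mul_sum, mul_comm]
    apply mul_le_mul_of_nonneg_left _ (Real.exp_pos _).le
    rw [Finset.sum_add_distrib, Finset.sum_sub_distrib]
    simp only [Finset.sum_const, nsmul_eq_mul, mul_one]
    linarith
  have h3 : ∑ w ∈ S, Real.exp (Y w) ≤ ∑ w, Real.exp (Y w) :=
    Finset.sum_le_sum_of_subset_of_nonneg (Finset.subset_univ _) (fun _ _ _ => (Real.exp_pos _).le)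
  have h4 : ∑ w, Real.exp (Y w) ≤ Fintype.card W * Real.exp (D.card / 8) := by
    have e1 : ∑ w, Real.exp (Y w) = ∑ x : (P → Bool) × Q,
        Real.exp (∑ p ∈ D, if x.1 p = φ p x.2 then (1/2:ℝ) else -(1/2)) := by
      rw [← Equiv.sum_comp e]
    have hc : (Fintype.card W : ℝ) = 2 ^ Fintype.card P * Fintype.card Q := by
      rw [Fintype.card_congr e]; simp
    rw [e1, Fintype.sum_prod_type_right, hc]
    have : ∀ q : Q, ∑ u : P → Bool,
        Real.exp (∑ p ∈ D, if u p = φ p q then (1/2:ℝ) else -(1/2))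
        ≤ 2 ^ Fintype.card P * Real.exp (D.card / 8) := by
      intro q
      have e2 : ∀ u : P → Bool, Real.exp (∑ p ∈ D, if u p = φ p q then (1/2:ℝ) else -(1/2))
          = ∏ p, (if p ∈ D then Real.exp (if u p = φ p q then (1/2:ℝ) else -(1/2)) else 1) := by
        intro u
        rw [Real.exp_sum, Finset.prod_ite_mem, Finset.univ_inter]
      simp_rw [e2]
      have e3 := Finset.prod_univ_sum (fun _ : P => (Finset.univ : Finset Bool))
        (fun p b => if p ∈ D then Real.exp (if b = φ p q then (1/2:ℝ) else -(1/2)) else 1)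
      rw [Fintype.piFinset_univ] at e3
      rw [← e3]
      have e4 : ∀ p ∈ (Finset.univ : Finset P), (∑ b : Bool, if p ∈ D then
          Real.exp (if b = φ p q then (1/2:ℝ) else -(1/2)) else 1)
          ≤ 2 * (if p ∈ D then Real.exp (1/8) else 1) := by
        intro p _
        have := Real.cosh_le_exp_half_sq (1/2)
        rw [Real.cosh_eq] at this
        norm_num at this
        by_cases hp : p ∈ D
        · cases hq : φ p q <;> simp [hp] <;> norm_num <;> linarith
        · simp [hp]
      refine (Finset.prod_le_prod ?_ e4).trans ?_
      · intro p _
        apply Finset.sum_nonneg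
        intro b _
        split_ifs <;> positivity
      · rw [Finset.prod_mul_distrib, Finset.prod_ite_mem, Finset.univ_inter]
        simp only [Finset.prod_const, Finset.card_univ]
        rw [← Real.exp_nat_mul]
        apply le_of_eq; congr 2; ring
    refine (Finset.sum_le_sum (fun q _ => this q)).trans ?_
    simp
    apply le_of_eq; ring
  have h5 := h2.trans (h3.trans h4)
  have h6 : Real.exp ((D.card : ℝ) / 4) = Real.exp (D.card / 8) * Real.exp (D.card / 8) := by
    rw [← Real.exp_add]; congr 1; ring
  rw [h6, ← mul_assoc] at h5
  exact le_of_mul_le_mul_right h5 (Real.exp_pos _)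

lemma nof_bias' {P Q W : Type} [Fintype P] [DecidableEq P] [Fintype Q] [Fintype W] [Nonempty W]
    (e : W ≃ (P → Bool) × Q) (S : Finset W) (D : Finset P) (φ : P → Q → Bool) (s : ℕ)
    (hs : Fintype.card W ≤ S.card * 2 ^ s)
    (h : ∀ p ∈ D, (3 / 4 : ℝ) * S.card ≤ ((S.filter (fun w => (e w).1 p = φ p (e w).2)).card : ℝ)) :
    D.card ≤ 8 * s := by
  have h1 := nof_bias e S D φ h
  have hS : 0 < S.card := by
    rcases Nat.eq_zero_or_pos S.card with h0 | h0
    · rw [h0] at hs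
      have := Fintype.card_pos (α := W)
      omega
    · exact h0
  have hS' : (0:ℝ) < S.card := by exact_mod_cast hS
  have hs' : (Fintype.card W : ℝ) ≤ S.card * 2 ^ s := by exact_mod_cast hs
  have h2 : Real.exp (D.card / 8) ≤ 2 ^ s := le_of_mul_le_mul_left (h1.trans hs') hS'
  have h3 : (2:ℝ) ^ s ≤ Real.exp s := by
    have : (2:ℝ) ≤ Real.exp 1 := by
      have := Real.add_one_le_exp (1:ℝ); linarith
    calc (2:ℝ) ^ s ≤ (Real.exp 1) ^ s := by gcongr
      _ = Real.exp s := by rw [← Real.exp_nat_mul]; simp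
  have h4 := Real.exp_le_exp.mp (h2.trans h3)
  have : (D.card : ℝ) ≤ 8 * s := by linarith
  exact_mod_cast this

def nofHalf {m : ℕ} (l : Fin m) : Fin (m / 2 + 1) := ⟨l / 2, by omega⟩

def nofRt {m : ℕ} (i l : Fin m) : Fin m :=
  ⟨(i + l) % m, Nat.mod_lt _ (Nat.zero_lt_of_lt i.2)⟩

abbrev NofW (m : ℕ) : Type := (Fin (m / 2 + 1) → Bool) × (Fin m → Bool)

def nofChi {m : ℕ} (w : NofW m) (i l : Fin m) : Bool :=
  xor (w.1 (nofHalf l)) (w.2 (nofRt i l))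

lemma nof_part {m : ℕ} (S : Finset (NofW m)) (I : Finset (Fin m)) (l : Fin m → Fin m)
    (b : Fin m → Bool) (s : ℕ) (hs : Fintype.card (NofW m) ≤ S.card * 2 ^ s)
    (h : ∀ i ∈ I, (3 / 4 : ℝ) * S.card ≤ ((S.filter (fun w => b i = nofChi w i (l i))).card : ℝ)) :
    I.card ≤ 128 * s ^ 2 := by
  have hL : (I.image (fun i => nofHalf (l i))).card ≤ 8 * s := by
    have hch : ∀ p : Fin (m / 2 + 1), ∃ i : Fin m → Fin m, ∀ j, p ∈ I.image (fun i => nofHalf (l i)) →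
        i j ∈ I ∧ nofHalf (l (i j)) = p := by
      intro p
      by_cases hp : p ∈ I.image (fun i => nofHalf (l i))
      · obtain ⟨i, hi, hip⟩ := Finset.mem_image.mp hp
        exact ⟨fun _ => i, fun _ _ => ⟨hi, hip⟩⟩
      · exact ⟨id, fun _ h => absurd h hp⟩
    choose c hc using hch
    rcases I.eq_empty_or_nonempty with rfl | ⟨i0, _⟩
    · simp
    refine nof_bias' (Equiv.refl _) S _ (fun p v => xor (b (c p i0)) (v (nofRt (c p i0) (l (c p i0))))) s hs ?_
    intro p hp
    obtain ⟨h1, h2⟩ := hc p i0 hp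
    refine (h _ h1).trans ?_
    norm_cast
    apply Finset.card_le_card
    apply Finset.monotone_filter_right
    intro w _ hw
    simp only [nofChi, h2] at hw
    simp only [Equiv.refl_apply, hw]
    simp
  have hR : (I.image (fun i => nofRt i (l i))).card ≤ 8 * s := by
    have hch : ∀ p : Fin m, ∃ i : Fin m, p ∈ I.image (fun i => nofRt i (l i)) →
        i ∈ I ∧ nofRt i (l i) = p := by
      intro p
      by_cases hp : p ∈ I.image (fun i => nofRt i (l i))
      · obtain ⟨i, hi, hip⟩ := Finset.mem_image.mp hp
        exact ⟨i, fun _ => ⟨hi, hip⟩⟩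
      · exact ⟨p, fun h => absurd h hp⟩
    choose c hc using hch
    refine nof_bias' (Equiv.prodComm _ _) S _ (fun p v => xor (b (c p)) (v (nofHalf (l (c p))))) s hs ?_
    intro p hp
    obtain ⟨h1, h2⟩ := hc p hp
    refine (h _ h1).trans ?_
    norm_cast
    apply Finset.card_le_card
    apply Finset.monotone_filter_right
    intro w _ hw
    simp only [nofChi, h2] at hw
    simp only [Equiv.prodComm_apply, Prod.fst_swap, Prod.snd_swap, hw]
    cases w.1 (nofHalf (l (c p))) <;> simp
  have hI : I.card ≤ ((I.image (fun i => nofHalf (l i))) ×ˢ ((Finset.univ : Finset (Fin 2)) ×ˢ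
      (I.image (fun i => nofRt i (l i))))).card := by
    apply Finset.card_le_card_of_injOn
      (fun i => (nofHalf (l i), (⟨(l i : ℕ) % 2, Nat.mod_lt _ (by norm_num)⟩ : Fin 2), nofRt i (l i)))
    · intro i hi
      simp only [Finset.coe_product, Set.mem_prod, Finset.mem_coe, Finset.mem_univ, true_and]
      exact ⟨Finset.mem_image_of_mem _ hi, Finset.mem_image_of_mem (fun i => nofRt i (l i)) hi⟩
    · intro i _ j _ hij
      simp only [Prod.mk.injEq, nofHalf, nofRt, Fin.mk.injEq] at hij
      obtain ⟨h1, h2, h3⟩ := hij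
      have h4 : (l i : ℕ) = l j := by omega
      rw [h4] at h3
      have h5 : (i : ℕ) ≡ j [MOD m] := Nat.ModEq.add_right_cancel' _ h3
      have h6 := Nat.ModEq.eq_of_lt_of_lt h5 i.2 j.2
      exact Fin.ext h6
  rw [Finset.card_product, Finset.card_product, Finset.card_univ, Fintype.card_fin] at hI
  calc I.card ≤ _ := hI
    _ ≤ (8 * s) * (2 * (8 * s)) := by gcongr
    _ = 128 * s ^ 2 := by ring

lemma nof_bad {m : ℕ} {T : Type} [Fintype T] (t : NofW m → T) (s : ℕ)
    (hs : 32 * Fintype.card T ≤ 2 ^ s) (B : Finset (Fin m))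
    (hB : ∀ i ∈ B, ∃ (l : T → Fin m) (b : T → Bool), (13 / 16 : ℝ) * Fintype.card (NofW m) ≤
      ((Finset.univ.filter (fun w => b (t w) = nofChi w i (l (t w)))).card : ℝ)) :
    B.card ≤ 4096 * s ^ 2 := by
  rcases B.eq_empty_or_nonempty with rfl | ⟨i0, hi0⟩
  · simp
  have hB' : ∀ i, ∃ (l : T → Fin m) (b : T → Bool), i ∈ B → (13 / 16 : ℝ) * Fintype.card (NofW m) ≤
      ((Finset.univ.filter (fun w => b (t w) = nofChi w i (l (t w)))).card : ℝ) := by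
    intro i
    by_cases hi : i ∈ B
    · obtain ⟨l, b, h⟩ := hB i hi
      exact ⟨l, b, fun _ => h⟩
    · exact ⟨fun _ => i, fun _ => true, fun h => absurd h hi⟩
  choose l b hlb using hB'
  set S : T → Finset (NofW m) := fun τ => Finset.univ.filter (fun w => t w = τ) with hS
  set G : Fin m → T → Prop := fun i τ => Fintype.card (NofW m) ≤ (S τ).card * 2 ^ s ∧
    (3 / 4 : ℝ) * (S τ).card ≤ (((S τ).filter (fun w => b i τ = nofChi w i (l i τ))).card : ℝ) with hG
  set W : ℝ := (Fintype.card (NofW m) : ℝ) with hW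
  have hWpos : 0 < W := by
    have : 0 < Fintype.card (NofW m) := Fintype.card_pos
    rw [hW]; exact_mod_cast this
  have hsum : ∑ τ, ((S τ).card : ℝ) = W := by
    have := Finset.card_eq_sum_card_fiberwise (f := t) (s := (Finset.univ : Finset (NofW m)))
      (t := Finset.univ) (fun _ _ => Finset.mem_coe.mpr (Finset.mem_univ _))
    rw [hW, ← Finset.card_univ, this]
    push_cast
    rfl
  have key : ∀ i ∈ B, W / 32 ≤ ∑ τ, if G i τ then ((S τ).card : ℝ) else 0 := by
    intro i hi
    have h1 := hlb i hi
    have h2 : ((Finset.univ.filter (fun w => b i (t w) = nofChi w i (l i (t w)))).card : ℝ)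
        = ∑ τ, (((S τ).filter (fun w => b i τ = nofChi w i (l i τ))).card : ℝ) := by
      have := Finset.card_eq_sum_card_fiberwise (f := t)
        (s := (Finset.univ.filter (fun w => b i (t w) = nofChi w i (l i (t w)))))
        (t := Finset.univ) (fun _ _ => Finset.mem_coe.mpr (Finset.mem_univ _))
      rw [this]
      push_cast
      apply Finset.sum_congr rfl
      intro τ _
      congr 2
      ext w
      simp only [hS, Finset.mem_filter, Finset.mem_univ, true_and]
      constructor
      · rintro ⟨h, rfl⟩; exact ⟨rfl, h⟩
      · rintro ⟨rfl, h⟩; exact ⟨h, rfl⟩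
    have h3 : ∀ τ ∈ (Finset.univ : Finset T),
        (((S τ).filter (fun w => b i τ = nofChi w i (l i τ))).card : ℝ)
        ≤ (if G i τ then ((S τ).card : ℝ) else 0) + 3/4 * (S τ).card + W / 2 ^ s := by
      intro τ _
      have hle : (((S τ).filter (fun w => b i τ = nofChi w i (l i τ))).card : ℝ) ≤ (S τ).card := by
        exact_mod_cast Finset.card_filter_le _ _
      have hn : (0:ℝ) ≤ (S τ).card := Nat.cast_nonneg _
      have hp : 0 ≤ W / 2 ^ s := by positivity
      by_cases hg : G i τ
      · rw [if_pos hg]; linarith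
      · rw [if_neg hg]
        by_cases h5 : Fintype.card (NofW m) ≤ (S τ).card * 2 ^ s
        · have h6 : ¬ (3 / 4 : ℝ) * (S τ).card ≤ (((S τ).filter (fun w => b i τ = nofChi w i (l i τ))).card : ℝ) :=
            fun h => hg ⟨h5, h⟩
          push Not at h6
          linarith
        · push Not at h5
          have h6 : ((S τ).card : ℝ) * 2 ^ s < W := by rw [hW]; exact_mod_cast h5
          have h7 : ((S τ).card : ℝ) ≤ W / 2 ^ s := by
            rw [le_div_iff₀ (by positivity)]; exact h6.le
          linarith
    have h4 := Finset.sum_le_sum h3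
    rw [← h2, Finset.sum_add_distrib, Finset.sum_add_distrib, ← Finset.mul_sum, hsum] at h4
    have h5 : ∑ τ : T, W / 2 ^ s ≤ W / 32 := by
      simp only [Finset.sum_const, Finset.card_univ, nsmul_eq_mul]
      rw [← mul_div_assoc, div_le_div_iff₀ (by positivity) (by norm_num)]
      have : (32 : ℝ) * Fintype.card T ≤ 2 ^ s := by exact_mod_cast hs
      nlinarith
    linarith
  have h1 := Finset.sum_le_sum key
  rw [Finset.sum_comm] at h1
  have h2 : ∀ τ ∈ (Finset.univ : Finset T), (∑ i ∈ B, if G i τ then ((S τ).card : ℝ) else 0)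
      ≤ 128 * s ^ 2 * (S τ).card := by
    intro τ _
    rw [← Finset.sum_filter, Finset.sum_const, nsmul_eq_mul]
    apply mul_le_mul_of_nonneg_right _ (Nat.cast_nonneg _)
    rcases (B.filter (fun i => G i τ)).eq_empty_or_nonempty with h0 | ⟨i1, hi1⟩
    · rw [h0]; simp
    · have := nof_part (S τ) (B.filter (fun i => G i τ)) (fun i => l i τ) (fun i => b i τ) s
        (Finset.mem_filter.mp hi1).2.1 (fun i hi => (Finset.mem_filter.mp hi).2.2)
      exact_mod_cast this
  have h3 := h1.trans (Finset.sum_le_sum h2)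
  rw [← Finset.mul_sum, hsum, Finset.sum_const, nsmul_eq_mul] at h3
  have h4 : (B.card : ℝ) ≤ 4096 * s ^ 2 := by
    by_contra hcon
    push Not at hcon
    nlinarith
  exact_mod_cast h4

lemma nof_count {E J : Type} [Fintype E] [Fintype J] [Nonempty E] (m K : ℕ) (hm : 0 < m)
    (Bad : J → E → Finset (Fin m)) (hK : ∀ j e, (Bad j e).card ≤ K) (hKm : 2 ^ 64 * K ≤ m)
    (hJ : Fintype.card J ≤ 2 ^ Fintype.card E) :
    ∃ g : E → Fin m, ∀ j, 16 * (Finset.univ.filter (fun e => g e ∈ Bad j e)).card < Fintype.card E := by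
  by_contra hcon
  push Not at hcon
  have h1 : ∀ g : E → Fin m, (16:ℕ) ^ Fintype.card E ≤
      ∑ j, ∏ e, (if g e ∈ Bad j e then 2 ^ 64 else 1) := by
    intro g
    obtain ⟨j, hj⟩ := hcon g
    refine le_trans ?_ (Finset.single_le_sum (fun _ _ => Nat.zero_le _) (Finset.mem_univ j))
    rw [← Finset.prod_filter, Finset.prod_const, ← pow_mul, show (16:ℕ) = 2 ^ 4 by norm_num, ← pow_mul]
    apply Nat.pow_le_pow_right (by norm_num)
    omega
  have h2 : ∀ j, ∑ g : E → Fin m, ∏ e, (if g e ∈ Bad j e then 2 ^ 64 else 1)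
      ≤ (2 * m) ^ Fintype.card E := by
    intro j
    have e3 := Finset.prod_univ_sum (fun _ : E => (Finset.univ : Finset (Fin m)))
        (fun e b => if b ∈ Bad j e then (2:ℕ) ^ 64 else 1)
    rw [Fintype.piFinset_univ] at e3
    rw [← e3, ← Finset.card_univ, ← Finset.prod_const]
    apply Finset.prod_le_prod' 
    intro e _
    calc ∑ b : Fin m, (if b ∈ Bad j e then (2:ℕ) ^ 64 else 1)
        ≤ ∑ b : Fin m, ((if b ∈ Bad j e then (2:ℕ) ^ 64 else 0) + 1) := by
          apply Finset.sum_le_sum; intro b _; split_ifs <;> omega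
      _ = (Bad j e).card * 2 ^ 64 + m := by
          rw [Finset.sum_add_distrib, Finset.sum_ite_mem]; simp
      _ ≤ 2 * m := by have := hK j e; omega
  have h3 := Finset.sum_le_sum (fun g (_ : g ∈ (Finset.univ : Finset (E → Fin m))) => h1 g)
  rw [Finset.sum_comm] at h3
  have h4 := h3.trans (Finset.sum_le_sum (fun j _ => h2 j))
  simp only [Finset.sum_const, Finset.card_univ, Fintype.card_fun, Fintype.card_fin, smul_eq_mul] at h4
  have h5 : m ^ Fintype.card E * 16 ^ Fintype.card E ≤ m ^ Fintype.card E * 4 ^ Fintype.card E := by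
    refine h4.trans ((Nat.mul_le_mul_right _ hJ).trans (le_of_eq ?_))
    rw [← mul_pow, ← mul_pow]; congr 1; ring
  have h6 := Nat.le_of_mul_le_mul_left h5 (by positivity)
  have h7 : (4:ℕ) ^ Fintype.card E < 16 ^ Fintype.card E :=
    Nat.pow_lt_pow_left (by norm_num) Fintype.card_ne_zero
  omega

def nofZ {m : ℕ} (w : NofW m) : Fin (2 * m) → Bool := fun j =>
  if h : (j : ℕ) < m then w.1 (nofHalf ⟨j, h⟩) else w.2 ⟨j - m, by omega⟩

lemma nof_chi_eq {m : ℕ} (w : NofW m) (i : Fin m) (o : Fin (2 * m) × Fin (2 * m) × Bool)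
    (h1 : (o.1 : ℕ) < m) (h2 : (o.2.1 : ℕ) = m + (((i : ℕ) + (o.1 : ℕ)) % m))
    (h3 : o.2.2 = xor (nofZ w o.1) (nofZ w o.2.1)) :
    o.2.2 = nofChi w i ⟨o.1, h1⟩ := by
  rw [h3, nofChi]
  have e1 : nofZ w o.1 = w.1 (nofHalf ⟨o.1, h1⟩) := by
    simp only [nofZ, h1, dif_pos]
  have e2 : nofZ w o.2.1 = w.2 (nofRt i ⟨o.1, h1⟩) := by
    have : ¬ (o.2.1 : ℕ) < m := by omega
    simp only [nofZ, this, dif_neg, not_false_eq_true]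
    have h4 : (⟨(o.2.1 : ℕ) - m, by omega⟩ : Fin m) = nofRt i ⟨o.1, h1⟩ := by
      apply Fin.ext
      simp only [nofRt]
      omega
    exact congrArg w.2 h4
  rw [e1, e2]

lemma nof_arith (m k : ℕ) (hm : 2 ^ 120 ≤ m) (hk : k ^ 16 ≤ 2 * m) :
    2 ^ 64 * (4096 * (2 * k + 7) ^ 2) ≤ m := by
  rcases Nat.lt_or_ge k 128 with h | h
  · have : (2 * k + 7) ^ 2 ≤ 512 ^ 2 := Nat.pow_le_pow_left (by omega) 2
    norm_num at *
    omega
  · have h1 : (2 * k + 7) ^ 2 ≤ (4 * k) ^ 2 := Nat.pow_le_pow_left (by omega) 2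
    have h2 : 128 ^ 14 ≤ k ^ 14 := Nat.pow_le_pow_left h 14
    have h3 : 128 ^ 14 * k ^ 2 ≤ k ^ 16 := by
      rw [show k ^ 16 = k ^ 14 * k ^ 2 by ring]
      exact Nat.mul_le_mul_right _ h2
    have h4 : (4 * k) ^ 2 = 16 * k ^ 2 := by ring
    rw [h4] at h1
    norm_num at *
    omega

lemma nof_arith2 (m k : ℕ) (hm : 2 ^ 120 ≤ m) (hk : k ^ 16 ≤ 2 * m) :
    2 * (k + 1) * Fintype.card (NofW m) ≤ 2 ^ (2 * m) := by
  have hW : Fintype.card (NofW m) = 2 ^ (m / 2 + 1 + m) := by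
    simp [pow_add]
  have h0 : k ≤ 2 * m := by
    refine le_trans ?_ hk
    exact Nat.le_self_pow (by norm_num) k
  have hm100 : 100 ≤ m := le_trans (by norm_num) hm
  have h1 : ∀ q : ℕ, 40 ≤ q → 100 * q ≤ 2 ^ q := by
    intro q hq
    induction q, hq using Nat.le_induction with
    | base => norm_num
    | succ q hq ih => rw [pow_succ]; omega
  have h2 := h1 (m / 2 - 1) (by omega)
  have h3 : 2 * (k + 1) ≤ 2 ^ (m / 2 - 1) := by omega
  rw [hW]
  calc 2 * (k + 1) * 2 ^ (m / 2 + 1 + m) ≤ 2 ^ (m / 2 - 1) * 2 ^ (m / 2 + 1 + m) :=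
        Nat.mul_le_mul_right _ h3
    _ = 2 ^ ((m / 2 - 1) + (m / 2 + 1 + m)) := by rw [← pow_add]
    _ ≤ 2 ^ (2 * m) := Nat.pow_le_pow_right (by norm_num) (by omega)

abbrev NofX (m : ℕ) : Type := Fin (2 * m) → Bool

abbrev NofJ (m M : ℕ) : Type := (NofX m → NofW m → Fin M) × (NofX m → NofW m → Fin M)

noncomputable instance nofJFintype (m M : ℕ) : Fintype (NofJ m M) := by
  haveI : Fintype (NofW m → Fin M) := inferInstance
  haveI : Fintype (NofX m → NofW m → Fin M) := inferInstance
  exact inferInstanceAs (Fintype (_ × _))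

lemma nof_main (m k : ℕ) (hm : 2 ^ 120 ≤ m) (hk : k ^ 16 ≤ 2 * m) :
    ∃ g : (Fin (2 * m) → Bool) → (Fin (2 * m) → Bool) → Fin m,
      ∀ (A B : (Fin (2 * m) → Bool) → NofW m → Fin (2 ^ (k + 1)))
        (C : (Fin (2 * m) → Bool) → (Fin (2 * m) → Bool) → Fin (2 ^ (k + 1)) → Fin (2 ^ (k + 1)) →
              Fin (2 * m) × Fin (2 * m) × Bool)
        (ok : (Fin (2 * m) → Bool) → (Fin (2 * m) → Bool) → NofW m → Prop),
        (∀ x y w, ok x y w → ((C x y (A y w) (B x w)).1 : ℕ) < m ∧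
          ((C x y (A y w) (B x w)).2.1 : ℕ)
              = m + (((g x y : ℕ) + ((C x y (A y w) (B x w)).1 : ℕ)) % m) ∧
          (C x y (A y w) (B x w)).2.2 = xor (nofZ w (C x y (A y w) (B x w)).1)
            (nofZ w (C x y (A y w) (B x w)).2.1)) →
        (∑ x, ∑ y, ((Finset.univ.filter (fun w => ok x y w)).card : ℝ))
          < 7 / 8 * (2 ^ (2 * m) * 2 ^ (2 * m) * Fintype.card (NofW m)) := by
  have hm0 : 0 < m := lt_of_lt_of_le (by norm_num) hm
  set M := 2 ^ (k + 1) with hM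
  let Bad : NofJ m M → (NofX m × NofX m) → Finset (Fin m) := fun j e => Finset.univ.filter (fun i =>
    ∃ (l : Fin M × Fin M → Fin m) (b : Fin M × Fin M → Bool),
      (13 / 16 : ℝ) * Fintype.card (NofW m) ≤
      ((Finset.univ.filter (fun w => b (j.1 e.2 w, j.2 e.1 w) =
        nofChi w i (l (j.1 e.2 w, j.2 e.1 w)))).card : ℝ))
  have hXc : Fintype.card (NofX m) = 2 ^ (2 * m) := by simp
  obtain ⟨g, hg⟩ := nof_count (E := (NofX m × NofX m)) (J := NofJ m M) m (4096 * (2 * k + 7) ^ 2) hm0 Bad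
    (by
      intro j e
      refine nof_bad (fun w => (j.1 e.2 w, j.2 e.1 w)) (2 * k + 7) ?_ _ ?_
      · simp only [Fintype.card_prod, Fintype.card_fin, hM]
        apply le_of_eq; ring
      · intro i hi
        exact (Finset.mem_filter.mp hi).2)
    (nof_arith m k hm hk)
    (by
      have h1 := nof_arith2 m k hm hk
      have h2 : Fintype.card (NofJ m M) = 2 ^ (2 ^ (2 * m) * (2 * (k + 1) * Fintype.card (NofW m))) := by
        simp only [Fintype.card_prod, Fintype.card_fun, Fintype.card_fin, hM, Fintype.card_bool]
        rw [← pow_mul, ← pow_mul, ← pow_add]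
        congr 1; ring
      have h3 : Fintype.card (NofX m × NofX m) = 2 ^ (2 * m) * 2 ^ (2 * m) := by
        rw [Fintype.card_prod, hXc]
      rw [h2, h3]
      exact Nat.pow_le_pow_right (by norm_num) (Nat.mul_le_mul_left _ h1))
  refine ⟨fun x y => g (x, y), ?_⟩
  intro A B C ok hok
  have hb := hg (A, B)
  set W : ℝ := (Fintype.card (NofW m) : ℝ) with hW
  have hWpos : 0 < W := by
    have : 0 < Fintype.card (NofW m) := Fintype.card_pos
    rw [hW]; exact_mod_cast this
  have h1 : ∀ e ∈ (Finset.univ : Finset ((NofX m × NofX m))),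
      ((Finset.univ.filter (fun w => ok e.1 e.2 w)).card : ℝ)
      ≤ 13 / 16 * W + (if g e ∈ Bad (A, B) e then 1 else 0) * W := by
    intro e _
    by_cases h : g e ∈ Bad (A, B) e
    · rw [if_pos h]
      have : ((Finset.univ.filter (fun w => ok e.1 e.2 w)).card : ℝ) ≤ W := by
        rw [hW, ← Finset.card_univ]
        exact_mod_cast Finset.card_filter_le _ _
      linarith
    · rw [if_neg h]
      by_contra hcon
      push Not at hcon
      apply h
      refine Finset.mem_filter.mpr ⟨Finset.mem_univ _, ?_⟩
      refine ⟨fun τ => if h : ((C e.1 e.2 τ.1 τ.2).1 : ℕ) < m then ⟨_, h⟩ else ⟨0, hm0⟩,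
        fun τ => (C e.1 e.2 τ.1 τ.2).2.2, ?_⟩
      refine le_trans (b := ((Finset.univ.filter (fun w => ok e.1 e.2 w)).card : ℝ)) (by linarith) ?_
      norm_cast
      apply Finset.card_le_card
      intro w hw
      obtain ⟨h1, h2, h3⟩ := hok e.1 e.2 w (Finset.mem_filter.mp hw).2
      refine Finset.mem_filter.mpr ⟨Finset.mem_univ _, ?_⟩
      simp only [h1, dif_pos]
      exact nof_chi_eq w (g e) _ h1 h2 h3
  have h2 := Finset.sum_le_sum h1
  rw [Finset.sum_add_distrib, ← Finset.sum_mul, ← Finset.sum_mul, Finset.sum_boole, Finset.sum_const,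
    Finset.card_univ, nsmul_eq_mul, Fintype.card_prod, hXc, Fintype.sum_prod_type] at h2
  have h3 : (16 : ℝ) * (Finset.univ.filter (fun e => g e ∈ Bad (A, B) e)).card
      < 2 ^ (2 * m) * 2 ^ (2 * m) := by
    rw [Fintype.card_prod, hXc] at hb
    exact_mod_cast hb
  push_cast at h2
  refine lt_of_le_of_lt h2 ?_
  nlinarith

/-- Randomized simultaneous NOF lower bound for the Gadgeted Hidden
Matching problem: there are `c > 0` and `m₀` such that for every prime `m ≥ m₀`
(with `n = 2m`) there is a gadget `g` such that any public-coin simultaneous NOF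
protocol solving `GHM ∘ g` with success probability at least `7/8` on every input
has communication cost `log₂ C_A + log₂ C_B ≥ c · n^(1/16)`. -/
theorem randomized_simultaneous_NOF_lower_bound :
    ∃ c : ℝ, c > 0 ∧ ∃ m₀ : ℕ, ∀ m : ℕ, m.Prime → m ≥ m₀ →
    ∃ g : (Fin (2 * m) → Bool) → (Fin (2 * m) → Bool) → Fin m,
      ∀ (R CA CB : ℕ), 1 ≤ R → 1 ≤ CA → 1 ≤ CB →
      ∀ (PA : (Fin (2 * m) → Bool) → (Fin (2 * m) → Bool) → Fin R → Fin CA)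
        (PB : (Fin (2 * m) → Bool) → (Fin (2 * m) → Bool) → Fin R → Fin CB)
        (PC : (Fin (2 * m) → Bool) → (Fin (2 * m) → Bool) → Fin CA → Fin CB → Fin R →
              Fin (2 * m) × Fin (2 * m) × Bool),
      (∀ x y z : Fin (2 * m) → Bool,
        ((Finset.univ.filter (fun r : Fin R =>
            ((PC x y (PA y z r) (PB x z r) r).1 : ℕ) < m ∧
            ((PC x y (PA y z r) (PB x z r) r).2.1 : ℕ)
              = m + (((g x y : ℕ) + ((PC x y (PA y z r) (PB x z r) r).1 : ℕ)) % m) ∧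
            (PC x y (PA y z r) (PB x z r) r).2.2
              = xor (z (PC x y (PA y z r) (PB x z r) r).1)
                    (z (PC x y (PA y z r) (PB x z r) r).2.1))).card : ℝ)
          ≥ (7 / 8 : ℝ) * R) →
      Real.logb 2 CA + Real.logb 2 CB ≥ c * ((2 * m : ℕ) : ℝ) ^ ((1 : ℝ) / 16) := by
  refine ⟨1, one_pos, 2 ^ 120, ?_⟩
  intro m _ hm
  set k : ℕ := ⌊((2 * m : ℕ) : ℝ) ^ ((1 : ℝ) / 16)⌋₊ with hk
  have hk16 : k ^ 16 ≤ 2 * m := by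
    have h1 : (k : ℝ) ≤ ((2 * m : ℕ) : ℝ) ^ ((1 : ℝ) / 16) := Nat.floor_le (by positivity)
    have h2 : (k : ℝ) ^ 16 ≤ ((2 * m : ℕ) : ℝ) := by
      calc (k : ℝ) ^ 16 ≤ (((2 * m : ℕ) : ℝ) ^ ((1 : ℝ) / 16)) ^ 16 := by gcongr
        _ = ((2 * m : ℕ) : ℝ) := by
          rw [← Real.rpow_natCast, ← Real.rpow_mul (Nat.cast_nonneg _)]
          norm_num
    exact_mod_cast h2
  obtain ⟨g, hg⟩ := nof_main m k hm hk16
  refine ⟨g, ?_⟩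
  intro R CA CB hR hCA hCB PA PB PC hP
  by_contra hcon
  push Not at hcon
  rw [one_mul] at hcon
  have hlt := hcon.trans (Nat.lt_floor_add_one _)
  rw [← hk] at hlt
  have hA0 : 0 ≤ Real.logb 2 CA := Real.logb_nonneg (by norm_num) (by exact_mod_cast hCA)
  have hB0 : 0 ≤ Real.logb 2 CB := Real.logb_nonneg (by norm_num) (by exact_mod_cast hCB)
  have hle : ∀ c : ℕ, 1 ≤ c → Real.logb 2 c < k + 1 → c ≤ 2 ^ (k + 1) := by
    intro c hc h
    rw [Real.logb_lt_iff_lt_rpow (by norm_num) (by exact_mod_cast hc)] at h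
    have h' : (c : ℝ) < 2 ^ (k + 1) := by
      have e : (2:ℝ) ^ ((k:ℝ) + 1) = 2 ^ (k + 1) := by
        rw [← Real.rpow_natCast]; push_cast; rfl
      rwa [e] at h
    exact_mod_cast h'.le
  have hAM := hle CA hCA (by linarith)
  have hBM := hle CB hCB (by linarith)
  obtain ⟨ok, hok⟩ : ∃ ok : Fin R → (Fin (2 * m) → Bool) → (Fin (2 * m) → Bool) → (Fin (2 * m) → Bool) → Prop,
    ok = fun r x y z => ((PC x y (PA y z r) (PB x z r) r).1 : ℕ) < m ∧
            ((PC x y (PA y z r) (PB x z r) r).2.1 : ℕ)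
              = m + (((g x y : ℕ) + ((PC x y (PA y z r) (PB x z r) r).1 : ℕ)) % m) ∧
            (PC x y (PA y z r) (PB x z r) r).2.2
              = xor (z (PC x y (PA y z r) (PB x z r) r).1)
                    (z (PC x y (PA y z r) (PB x z r) r).2.1) := ⟨_, rfl⟩
  have h1 : ∀ r, (∑ x, ∑ y, ((Finset.univ.filter (fun w : NofW m => ok r x y (nofZ w))).card : ℝ))
          < 7 / 8 * (2 ^ (2 * m) * 2 ^ (2 * m) * Fintype.card (NofW m)) := by
    intro r
    refine hg (fun y w => Fin.castLE hAM (PA y (nofZ w) r)) (fun x w => Fin.castLE hBM (PB x (nofZ w) r))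
      (fun x y a b => PC x y (if h : (a : ℕ) < CA then ⟨a, h⟩ else ⟨0, hCA⟩)
        (if h : (b : ℕ) < CB then ⟨b, h⟩ else ⟨0, hCB⟩) r) (fun x y w => ok r x y (nofZ w)) ?_
    intro x y w h
    rw [hok] at h
    simpa using h
  have h2 : ∀ x y z, (7 / 8 : ℝ) * R ≤ ((Finset.univ.filter (fun r => ok r x y z)).card : ℝ) := by
    intro x y z
    have := hP x y z
    rw [hok]
    convert this
  have h3 : ∑ x : Fin (2 * m) → Bool, ∑ y : Fin (2 * m) → Bool, ∑ w : NofW m, (7 / 8 : ℝ) * R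
      ≤ ∑ x, ∑ y, ∑ w : NofW m, ((Finset.univ.filter (fun r => ok r x y (nofZ w))).card : ℝ) :=
    Finset.sum_le_sum fun x _ => Finset.sum_le_sum fun y _ => Finset.sum_le_sum fun w _ => h2 x y (nofZ w)
  have h4 : ∑ x, ∑ y, ∑ w : NofW m, ((Finset.univ.filter (fun r => ok r x y (nofZ w))).card : ℝ)
      = ∑ r, ∑ x, ∑ y, ((Finset.univ.filter (fun w : NofW m => ok r x y (nofZ w))).card : ℝ) := by
    simp_rw [← Finset.sum_boole]
    rw [Finset.sum_comm (s := (Finset.univ : Finset (Fin R)))]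
    refine Finset.sum_congr rfl fun x _ => ?_
    rw [Finset.sum_comm (s := (Finset.univ : Finset (Fin R)))]
    refine Finset.sum_congr rfl fun y _ => ?_
    rw [Finset.sum_comm]
  rw [h4] at h3
  have h5 := Finset.sum_lt_sum_of_nonempty (s := (Finset.univ : Finset (Fin R)))
    ⟨⟨0, hR⟩, Finset.mem_univ _⟩ (fun r _ => h1 r)
  have h6 := h3.trans_lt h5
  simp only [Finset.sum_const, Finset.card_univ, nsmul_eq_mul, Fintype.card_fin] at h6
  have hXc : Fintype.card (Fin (2 * m) → Bool) = 2 ^ (2 * m) := by simp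
  rw [hXc] at h6
  rw [Nat.cast_pow, Nat.cast_ofNat] at h6
  clear_value k
  generalize (2:ℝ) ^ (2 * m) = N at h6
  generalize (Fintype.card (NofW m) : ℝ) = V at h6
  have h7 : N * (N * (V * (7 / 8 * (R:ℝ)))) = R * (7 / 8 * (N * N * V)) := by ring
  linarith
end

section
/- There exist constants c > 0 and m₀ such that the following holds for every prime m ≥ m₀. Set n = 2m. There exist a gadget g : {0,1}ⁿ × {0,1}ⁿ → {0,…,m−1} and finite sets S, T ⊆ {0,1}ⁿ with |S| = |T| = ⌈α^{1/2}⌉ where α = ⌊√m⌋, such that for all C_A, C_B ≥ 1 and all functions Π_A : T × {0,1}ⁿ → Fin C_A, Π_B : S × {0,1}ⁿ → Fin C_B, and Π_C : S × T × Fin C_A × Fin C_B → ({0,…,n−1} × {0,…,n−1} × {0,1}), if the probability, over x uniform in S, y uniform in T, and z uniform in {0,1}ⁿ, that the output (ℓ, r, b) = Π_C(x, y, Π_A(y, z), Π_B(x, z)) satisfies ℓ < m, r = m + ((g(x,y)+ℓ) mod m), and b = z_ℓ XOR z_r, is at least 15/16, then log₂ C_A + log₂ C_B ≥ c · n^{1/16}.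 -/
open scoped Classical

def eps (b : Bool) : ℝ := if b then -1 else 1

lemma eps_not (b : Bool) : eps (!b) = - eps b := by cases b <;> simp [eps]
lemma eps_cases (b : Bool) : eps b = 1 ∨ eps b = -1 := by cases b <;> simp [eps]

noncomputable def flipAt {V : Type*} (v : V) (z : V → Bool) : V → Bool :=
  Function.update z v (!(z v))

lemma flipAt_invol {V : Type*} (v : V) : Function.Involutive (flipAt v) := by
  intro z
  simp [flipAt]

lemma mgf_bound {V : Type*} [Fintype V] (X : V → (V → Bool) → ℝ) (d : V → ℝ)
    (hd : ∀ v z, |X v z| ≤ d v) (A : Finset V)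
    (hX : ∀ v ∈ A, ∀ u ∈ A, ∀ z, X u (flipAt v z) = X u z) :
    ∑ z : V → Bool, Real.exp (∑ v ∈ A, eps (z v) * X v z)
      ≤ Real.exp (∑ v ∈ A, d v ^ 2 / 2) * 2 ^ (Fintype.card V) := by
  induction A using Finset.induction_on with
  | empty => simp
  | insert v A hv ih =>
    have ih' := ih (fun w hw u hu z => hX w (Finset.mem_insert_of_mem hw) u
      (Finset.mem_insert_of_mem hu) z)
    set f : (V → Bool) → ℝ := fun z => Real.exp (∑ v ∈ insert v A, eps (z v) * X v z) with hf
    set r : (V → Bool) → ℝ := fun z => Real.exp (∑ v ∈ A, eps (z v) * X v z) with hr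
    have h1 : ∀ z, f z = Real.exp (eps (z v) * X v z) * r z := by
      intro z
      simp only [hf, hr, Finset.sum_insert hv, Real.exp_add]
    have h2 : ∀ z, r (flipAt v z) = r z := by
      intro z
      simp only [hr]
      congr 1
      apply Finset.sum_congr rfl
      intro u hu
      rw [hX v (Finset.mem_insert_self _ _) u (Finset.mem_insert_of_mem hu)]
      have : u ≠ v := fun h => hv (h ▸ hu)
      simp [flipAt, this]
    have h3 : ∑ z, f (flipAt v z) = ∑ z, f z :=
      Equiv.sum_comp (flipAt_invol v).toPerm f
    have h4 : ∀ z, f z + f (flipAt v z) ≤ 2 * (Real.exp (d v ^ 2 / 2) * r z) := by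
      intro z
      rw [h1, h1, h2, hX v (Finset.mem_insert_self _ _) v (Finset.mem_insert_self _ _)]
      have e1 : flipAt v z v = !(z v) := by simp [flipAt]
      rw [e1, eps_not]
      have e2 : Real.exp (eps (z v) * X v z) + Real.exp (- eps (z v) * X v z)
          = 2 * Real.cosh (X v z) := by
        rw [Real.cosh_eq]
        rcases eps_cases (z v) with h | h <;> rw [h] <;> simp <;> ring
      have e3 : Real.cosh (X v z) ≤ Real.exp (d v ^ 2 / 2) := by
        refine (Real.cosh_le_exp_half_sq _).trans (Real.exp_le_exp.2 ?_)
        have := sq_le_sq' (abs_le.1 (hd v z)).1 (abs_le.1 (hd v z)).2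
        linarith
      have hp : 0 < r z := Real.exp_pos _
      nlinarith
    have h5 : 2 * ∑ z, f z ≤ 2 * (Real.exp (d v ^ 2 / 2) * ∑ z, r z) := by
      calc 2 * ∑ z, f z = ∑ z, (f z + f (flipAt v z)) := by
            rw [Finset.sum_add_distrib, h3]; ring
        _ ≤ ∑ z, 2 * (Real.exp (d v ^ 2 / 2) * r z) := Finset.sum_le_sum (fun z _ => h4 z)
        _ = _ := by rw [← Finset.mul_sum, ← Finset.mul_sum]
    rw [Finset.sum_insert hv, Real.exp_add, mul_assoc]
    have := mul_le_mul_of_nonneg_left ih' (Real.exp_pos (d v ^ 2 / 2)).le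
    linarith

/-- light edges -/
lemma light_bound {V ι : Type*} [Fintype V] (E : Finset ι) (l r : ι → V) (P : V → Prop)
    (hl : ∀ e ∈ E, P (l e)) (hr : ∀ e ∈ E, ¬ P (r e)) (σ : ι → ℝ) (hσ : ∀ e, |σ e| ≤ 1)
    (D : ℝ) (hD : ∀ e ∈ E, ((E.filter (fun e' => l e' = l e)).card : ℝ) ≤ D) (t : ℝ) :
    ∑ z : V → Bool, Real.exp (t * ∑ e ∈ E, σ e * (eps (z (l e)) * eps (z (r e))))
      ≤ Real.exp (t ^ 2 * (D * E.card) / 2) * 2 ^ (Fintype.card V) := by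
  set A := E.image l
  set X : V → (V → Bool) → ℝ := fun v z => t * ∑ e ∈ E with l e = v, σ e * eps (z (r e)) with hXd
  set d : V → ℝ := fun v => |t| * (E.filter (fun e' => l e' = v)).card with hdd
  have key := mgf_bound X d ?_ A ?_
  · refine le_trans (le_of_eq ?_) (key.trans ?_)
    · apply Finset.sum_congr rfl
      intro z _
      congr 1
      rw [← Finset.sum_fiberwise_of_maps_to (t := A) (g := l)
        (fun e he => Finset.mem_image_of_mem l he), Finset.mul_sum]
      apply Finset.sum_congr rfl
      intro v _
      simp only [hXd]
      rw [mul_left_comm, Finset.mul_sum, Finset.mul_sum, Finset.mul_sum]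
      apply Finset.sum_congr rfl
      intro e he
      rw [(Finset.mem_filter.1 he).2]; ring
    · gcongr
      have hc : (E.card : ℝ) = ∑ v ∈ A, ((E.filter (fun e' => l e' = v)).card : ℝ) := by
        exact_mod_cast Finset.card_eq_sum_card_fiberwise
          (fun e he => Finset.mem_coe.2 (Finset.mem_image_of_mem l he))
      rw [hc, Finset.mul_sum, Finset.mul_sum, Finset.sum_div]
      apply Finset.sum_le_sum
      intro v hv
      obtain ⟨e, he, rfl⟩ := Finset.mem_image.1 hv
      have := hD e he
      simp only [hdd, mul_pow, sq_abs]
      rw [sq (Finset.card _ : ℝ)]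
      gcongr
  · intro v z
    simp only [hXd, hdd, abs_mul]
    gcongr
    refine (Finset.abs_sum_le_sum_abs _ _).trans ?_
    rw [Finset.card_eq_sum_ones]
    push_cast
    apply Finset.sum_le_sum
    intro e _
    rw [abs_mul]
    have : |eps (z (r e))| = 1 := by rcases eps_cases (z (r e)) with h | h <;> simp [h]
    rw [this, mul_one]; exact hσ e
  · intro v hv u _ z
    obtain ⟨e, he, rfl⟩ := Finset.mem_image.1 hv
    simp only [hXd]
    congr 1
    apply Finset.sum_congr rfl
    intro e' he'
    have : r e' ≠ l e := fun h => hr e' (Finset.mem_filter.1 he').1 (h ▸ hl e he)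
    simp [flipAt, this]

/-- number of heavy vertices -/
lemma heavy_count {V ι : Type*} (E : Finset ι) (l : ι → V) (D : ℝ) (H : Finset ι) (hHE : H ⊆ E)
    (hH : ∀ e ∈ H, D ≤ ((E.filter (fun e' => l e' = l e)).card : ℝ)) :
    D * (H.image l).card ≤ E.card := by
  have h1 : ((∑ v ∈ H.image l, (E.filter (fun e' => l e' = v)).card : ℕ) : ℝ) ≤ E.card := by
    have : ∑ v ∈ H.image l, (E.filter (fun e' => l e' = v)).card
        ≤ ∑ v ∈ E.image l, (E.filter (fun e' => l e' = v)).card :=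
      Finset.sum_le_sum_of_subset (Finset.image_subset_image hHE)
    rw [← Finset.card_eq_sum_card_fiberwise
          (fun e he => Finset.mem_coe.2 (Finset.mem_image_of_mem l he))] at this
    exact_mod_cast this
  refine le_trans ?_ h1
  push_cast
  rw [mul_comm, ← nsmul_eq_mul]
  apply Finset.card_nsmul_le_sum
  intro v hv
  obtain ⟨e, he, rfl⟩ := Finset.mem_image.1 hv
  exact hH e he

/-- KST -/
lemma kst {V ι X : Type*} (H : Finset ι) (l r : ι → V) (x : ι → X) (φ : ι → Fin 16)
    (hinj : ∀ e e', x e = x e' → φ e = φ e' → e = e')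
    (hS : ∀ e₁ ∈ H, ∀ e₁' ∈ H, ∀ e₂ ∈ H, ∀ e₂' ∈ H, r e₁ = r e₁' → r e₂ = r e₂' →
      l e₁ = l e₂ → l e₁' = l e₂' → x e₁ ≠ x e₁' → x e₁ = x e₂ ∧ x e₁' = x e₂') :
    H.card ^ 2 ≤ (H.image r).card * (16 * H.card + 256 * (H.image l).card ^ 2) := by
  set Q := (H ×ˢ H).filter (fun p => r p.1 = r p.2) with hQ
  have h1 : H.card ^ 2 ≤ (H.image r).card * Q.card := by
    have c1 : H.card = ∑ v ∈ H.image r, (H.filter (fun e => r e = v)).card :=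
      Finset.card_eq_sum_card_fiberwise
          (fun e he => Finset.mem_coe.2 (Finset.mem_image_of_mem r he))
    have c2 : Q.card = ∑ v ∈ H.image r, (H.filter (fun e => r e = v)).card ^ 2 := by
      rw [Finset.card_eq_sum_card_fiberwise (f := fun p => r p.1) (t := H.image r)
        (fun e he => Finset.mem_coe.2 (Finset.mem_image_of_mem r
          (Finset.mem_product.1 (Finset.mem_filter.1 (Finset.mem_coe.1 he)).1).1))]
      apply Finset.sum_congr rfl
      intro v _
      rw [sq, ← Finset.card_product]
      congr 1
      ext ⟨a, b⟩
      simp only [Finset.mem_filter, Finset.mem_product]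
      constructor
      · rintro ⟨⟨⟨ha, hb⟩, hab⟩, hv⟩; exact ⟨⟨ha, hv⟩, ⟨hb, hab ▸ hv⟩⟩
      · rintro ⟨⟨ha, hv⟩, ⟨hb, hv'⟩⟩; exact ⟨⟨⟨ha, hb⟩, hv.trans hv'.symm⟩, hv⟩
    rw [c2]
    conv_lhs => rw [c1]
    exact sq_sum_le_card_mul_sum_sq
  refine h1.trans (Nat.mul_le_mul_left _ ?_)
  rw [← Finset.card_filter_add_card_filter_not (fun p : ι × ι => x p.1 = x p.2)]
  apply add_le_add
  · have : (Q.filter (fun p => x p.1 = x p.2)).card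
        ≤ ((Finset.univ : Finset (Fin 16)) ×ˢ H).card := by
      apply Finset.card_le_card_of_injOn (fun p => (φ p.2, p.1))
      · rintro ⟨a, b⟩ h
        simp [hQ] at h ⊢
        exact h.1.1.1
      · rintro ⟨a, b⟩ h ⟨a', b'⟩ h' hh
        simp [hQ] at h h' hh
        obtain ⟨h3, rfl⟩ := hh
        have := hinj b b' (h.2.symm.trans h'.2) h3
        rw [this]
    simpa [Finset.card_product] using this
  · have : (Q.filter (fun p => ¬ x p.1 = x p.2)).card
        ≤ (((Finset.univ : Finset (Fin 16)) ×ˢ (Finset.univ : Finset (Fin 16))) ×ˢ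
            (H.image l ×ˢ H.image l)).card := by
      apply Finset.card_le_card_of_injOn (fun p => ((φ p.1, φ p.2), (l p.1, l p.2)))
      · rintro ⟨a, b⟩ h
        simp [hQ] at h ⊢
        exact ⟨⟨a, h.1.1.1, rfl⟩, ⟨b, h.1.1.2, rfl⟩⟩
      · rintro ⟨a, b⟩ h ⟨a', b'⟩ h' hh
        simp [hQ] at h h' hh
        obtain ⟨⟨h3, h4⟩, h5, h6⟩ := hh
        obtain ⟨h7, h8⟩ := hS a h.1.1.1 b h.1.1.2 a' h'.1.1.1 b' h'.1.1.2 h.1.2 h'.1.2 h5 h6 h.2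
        rw [hinj _ _ h7 h3, hinj _ _ h8 h4]
    simpa [Finset.card_product, sq] using this

lemma sidon (p m a b c d : ℕ) (hp : p.Prime) (hp2 : 2 < p) (hm : 4 * p ^ 2 ≤ m)
    (ha : a < p) (hb : b < p) (hc : c < p) (hd : d < p)
    (h : (2 * p * a + a ^ 2 % p) + (2 * p * d + d ^ 2 % p) ≡
      (2 * p * b + b ^ 2 % p) + (2 * p * c + c ^ 2 % p) [MOD m]) (hab : a ≠ b) :
    a = c ∧ b = d := by
  have hlt : ∀ a < p, 2 * p * a + a ^ 2 % p < 2 * p ^ 2 := by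
    intro a ha
    have := Nat.mod_lt (a ^ 2) hp.pos
    nlinarith
  have e := Nat.ModEq.eq_of_lt_of_lt h (by linarith [hlt a ha, hlt d hd])
    (by linarith [hlt b hb, hlt c hc])
  have qa := Nat.mod_lt (a ^ 2) hp.pos
  have qb := Nat.mod_lt (b ^ 2) hp.pos
  have qc := Nat.mod_lt (c ^ 2) hp.pos
  have qd := Nat.mod_lt (d ^ 2) hp.pos
  have e1 : a + d = b + c := by
    rcases lt_trichotomy (a + d) (b + c) with h | h | h
    · have : 2 * p * (a + d + 1) ≤ 2 * p * (b + c) := Nat.mul_le_mul_left _ h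
      have t : 2 * p * (a + d + 1) = 2 * p * a + 2 * p * d + 2 * p := by ring
      have t' : 2 * p * (b + c) = 2 * p * b + 2 * p * c := by ring
      omega
    · exact h
    · have : 2 * p * (b + c + 1) ≤ 2 * p * (a + d) := Nat.mul_le_mul_left _ h
      have t : 2 * p * (b + c + 1) = 2 * p * b + 2 * p * c + 2 * p := by ring
      have t' : 2 * p * (a + d) = 2 * p * a + 2 * p * d := by ring
      omega
  have e2 : a ^ 2 % p + d ^ 2 % p = b ^ 2 % p + c ^ 2 % p := by
    have : 2 * p * (a + d) = 2 * p * (b + c) := by rw [e1]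
    nlinarith
  have e3 : a ^ 2 + d ^ 2 ≡ b ^ 2 + c ^ 2 [MOD p] := by
    have : (a ^ 2 % p + d ^ 2 % p) % p = (b ^ 2 % p + c ^ 2 % p) % p := by rw [e2]
    rwa [← Nat.add_mod, ← Nat.add_mod] at this
  have e4 := (Nat.modEq_iff_dvd.1 e3.symm)
  have e5 : (p : ℤ) ∣ 2 * ((a : ℤ) - b) * (a - c) := by
    have hd' : (d : ℤ) = b + c - a := by omega
    have : (2 * ((a : ℤ) - b) * (a - c)) = ((a ^ 2 + d ^ 2 : ℕ) : ℤ) - ((b ^ 2 + c ^ 2 : ℕ) : ℤ) := by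
      push_cast; rw [hd']; ring
    rw [this]; exact e4
  have hpi : Prime (p : ℤ) := Nat.prime_iff_prime_int.1 hp
  have small : ∀ u v : ℕ, u < p → v < p → (p : ℤ) ∣ (u : ℤ) - v → u = v := by
    intro u v hu hv h
    have : v ≡ u [MOD p] := Nat.modEq_iff_dvd.2 h
    exact (Nat.ModEq.eq_of_lt_of_lt this hv hu).symm
  rcases hpi.dvd_or_dvd e5 with h | h
  · rcases hpi.dvd_or_dvd h with h | h
    · have := Int.le_of_dvd (by norm_num) h
      omega
    · exact absurd (small a b ha hb h) hab
  · have := small a c ha hc h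
    omega

/-- exponential moment for a fixed message -/
lemma moment_bound {V ι : Type*} [Fintype V] (E : Finset ι) (l r : ι → V) (P : V → Prop)
    (hl : ∀ e ∈ E, P (l e)) (hr : ∀ e ∈ E, ¬ P (r e)) (σ : ι → ℝ) (hσ : ∀ e, |σ e| ≤ 1)
    (D N h t : ℝ) (hD : 0 ≤ D) (ht : 0 ≤ t) (hN : (E.card : ℝ) ≤ N)
    (hh : ∀ H ⊆ E, D * (H.image l).card ≤ N → D * (H.image r).card ≤ N → (H.card : ℝ) ≤ h) :
    ∑ z : V → Bool, Real.exp (t * ∑ e ∈ E, σ e * (eps (z (l e)) * eps (z (r e))))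
      ≤ Real.exp (t * h + 2 * t ^ 2 * (D * N)) * 2 ^ (Fintype.card V) := by
  set dl : ι → ℝ := fun e => ((E.filter (fun e' => l e' = l e)).card : ℝ) with hdl
  set dr : ι → ℝ := fun e => ((E.filter (fun e' => r e' = r e)).card : ℝ) with hdr
  set E1 := E.filter (fun e => dl e ≤ D) with hE1
  set E' := E.filter (fun e => ¬ dl e ≤ D) with hE'
  set E2 := E'.filter (fun e => dr e ≤ D) with hE2
  set E3 := E'.filter (fun e => ¬ dr e ≤ D) with hE3
  have s' : E' ⊆ E := Finset.filter_subset _ _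
  have s1 : E1 ⊆ E := Finset.filter_subset _ _
  have s2 : E2 ⊆ E := (Finset.filter_subset _ _).trans s'
  have s3 : E3 ⊆ E := (Finset.filter_subset _ _).trans s'
  have h3 : (E3.card : ℝ) ≤ h := by
    apply hh E3 s3
    · refine (heavy_count E l D E3 s3 ?_).trans hN
      intro e he
      exact (not_le.1 (Finset.mem_filter.1 ((Finset.filter_subset _ _) he)).2).le
    · refine (heavy_count E r D E3 s3 ?_).trans hN
      intro e he
      exact (not_le.1 (Finset.mem_filter.1 he).2).le
  have b1 := light_bound E1 l r P (fun e he => hl e (s1 he)) (fun e he => hr e (s1 he)) σ hσ D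
    (fun e he => le_trans (Nat.cast_le.2
      (Finset.card_le_card (Finset.filter_subset_filter _ s1)))
      (Finset.mem_filter.1 he).2) (2 * t)
  have b2 := light_bound E2 r l (fun v => ¬ P v) (fun e he => hr e (s2 he))
    (fun e he => not_not.2 (hl e (s2 he))) σ hσ D
    (fun e he => le_trans (Nat.cast_le.2
      (Finset.card_le_card (Finset.filter_subset_filter _ s2)))
      (Finset.mem_filter.1 he).2) (2 * t)
  have c1 : (E1.card : ℝ) ≤ N := le_trans (by exact_mod_cast Finset.card_le_card s1) hN
  have c2 : (E2.card : ℝ) ≤ N := le_trans (by exact_mod_cast Finset.card_le_card s2) hN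
  have m1 : Real.exp ((2 * t) ^ 2 * (D * E1.card) / 2) ≤ Real.exp (2 * t ^ 2 * (D * N)) := by
    apply Real.exp_le_exp.2
    have : t ^ 2 * (D * E1.card) ≤ t ^ 2 * (D * N) := by gcongr
    linarith
  have m2 : Real.exp ((2 * t) ^ 2 * (D * E2.card) / 2) ≤ Real.exp (2 * t ^ 2 * (D * N)) := by
    apply Real.exp_le_exp.2
    have : t ^ 2 * (D * E2.card) ≤ t ^ 2 * (D * N) := by gcongr
    linarith
  have pw : ∀ z : V → Bool, Real.exp (t * ∑ e ∈ E, σ e * (eps (z (l e)) * eps (z (r e))))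
      ≤ Real.exp (t * h) / 2 *
        (Real.exp (2 * t * ∑ e ∈ E1, σ e * (eps (z (l e)) * eps (z (r e))))
        + Real.exp (2 * t * ∑ e ∈ E2, σ e * (eps (z (r e)) * eps (z (l e))))) := by
    intro z
    have q : ∑ e ∈ E2, σ e * (eps (z (r e)) * eps (z (l e)))
        = ∑ e ∈ E2, σ e * (eps (z (l e)) * eps (z (r e))) :=
      Finset.sum_congr rfl (fun e _ => by ring)
    rw [q]
    rw [← Finset.sum_filter_add_sum_filter_not E (fun e => dl e ≤ D)]
    rw [← Finset.sum_filter_add_sum_filter_not (E.filter (fun e => ¬ dl e ≤ D)) (fun e => dr e ≤ D)]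
    set A := ∑ e ∈ E1, σ e * (eps (z (l e)) * eps (z (r e)))
    set B := ∑ e ∈ E2, σ e * (eps (z (l e)) * eps (z (r e)))
    set C := ∑ e ∈ E3, σ e * (eps (z (l e)) * eps (z (r e))) with hC
    have hCle : C ≤ h := by
      refine le_trans ?_ h3
      rw [Finset.card_eq_sum_ones, hC]
      push_cast
      apply Finset.sum_le_sum
      intro e _
      refine (le_abs_self _).trans ?_
      have a1 : |eps (z (r e))| = 1 := by rcases eps_cases (z (r e)) with h | h <;> simp [h]
      have a2 : |eps (z (l e))| = 1 := by rcases eps_cases (z (l e)) with h | h <;> simp [h]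
      rw [abs_mul, abs_mul, a1, a2]; simpa using hσ e
    change Real.exp (t * (A + (B + C))) ≤ _
    have e1 : Real.exp (t * (A + (B + C))) ≤ Real.exp (t * h) * (Real.exp (t * A) * Real.exp (t * B)) := by
      rw [← Real.exp_add, ← Real.exp_add]
      apply Real.exp_le_exp.2
      nlinarith
    have e2 : Real.exp (2 * t * A) = Real.exp (t * A) ^ 2 := by
      rw [← Real.exp_nat_mul]; congr 1; push_cast; ring
    have e3 : Real.exp (2 * t * B) = Real.exp (t * B) ^ 2 := by
      rw [← Real.exp_nat_mul]; congr 1; push_cast; ring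
    rw [e2, e3]
    refine e1.trans ?_
    have := mul_nonneg (Real.exp_pos (t * h)).le (sq_nonneg (Real.exp (t * A) - Real.exp (t * B)))
    nlinarith
  refine (Finset.sum_le_sum (fun z _ => pw z)).trans ?_
  rw [← Finset.mul_sum, Finset.sum_add_distrib, Real.exp_add]
  have hp : (0:ℝ) < 2 ^ Fintype.card V := by positivity
  have n1 := b1.trans (mul_le_mul_of_nonneg_right m1 hp.le)
  have n2 := b2.trans (mul_le_mul_of_nonneg_right m2 hp.le)
  have := mul_le_mul_of_nonneg_left (add_le_add n1 n2) (by positivity : 0 ≤ Real.exp (t * h) / 2)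
  refine this.trans (le_of_eq ?_)
  ring

/-- main counting bound -/
lemma core {V ι M : Type*} [Fintype V] [Fintype ι] [Fintype M] (P : V → Prop)
    (msg : (V → Bool) → M) (l r : M → ι → V) (b : M → ι → Bool)
    (valid : M → ι → Prop) (hl : ∀ μ e, valid μ e → P (l μ e)) (hr : ∀ μ e, valid μ e → ¬ P (r μ e))
    (D h t : ℝ) (hD : 0 ≤ D) (ht : 0 ≤ t)
    (hh : ∀ μ, ∀ H : Finset ι, (∀ e ∈ H, valid μ e) →
      D * (H.image (l μ)).card ≤ Fintype.card ι →
      D * (H.image (r μ)).card ≤ Fintype.card ι → (H.card : ℝ) ≤ h)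
    (hsucc : (15 / 16 : ℝ) * (Fintype.card ι * 2 ^ Fintype.card V) ≤
      ((Finset.univ : Finset (ι × (V → Bool))).filter (fun q => valid (msg q.2) q.1 ∧
        b (msg q.2) q.1 = xor (q.2 (l (msg q.2) q.1)) (q.2 (r (msg q.2) q.1)))).card) :
    Real.exp (t * (7 / 8 * Fintype.card ι)) ≤
      Fintype.card M * Real.exp (t * h + 2 * t ^ 2 * (D * Fintype.card ι)) := by
  set N : ℝ := (Fintype.card ι : ℝ) with hN
  set F : M → (V → Bool) → ℝ := fun μ z =>
    ∑ e ∈ Finset.univ.filter (valid μ), eps (b μ e) * (eps (z (l μ e)) * eps (z (r μ e))) with hF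
  have hp : (0:ℝ) < 2 ^ Fintype.card V := by positivity
  have hcardZ : ((Finset.univ : Finset (V → Bool)).card : ℝ) = 2 ^ Fintype.card V := by
    simp
  have hM : ∀ μ, ∑ z, Real.exp (t * F μ z) ≤
      Real.exp (t * h + 2 * t ^ 2 * (D * N)) * 2 ^ (Fintype.card V) := by
    intro μ
    apply moment_bound (Finset.univ.filter (valid μ)) (l μ) (r μ) P
      (fun e he => hl μ e (Finset.mem_filter.1 he).2)
      (fun e he => hr μ e (Finset.mem_filter.1 he).2) (fun e => eps (b μ e)) _ D N h t hD ht
    · rw [hN]; exact_mod_cast Finset.card_le_univ _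
    · intro H hH
      exact hh μ H (fun e he => (Finset.mem_filter.1 (hH he)).2)
    · intro e
      rcases eps_cases (b μ e) with h | h <;> simp [h]
  have hsum : 7 / 8 * N * 2 ^ Fintype.card V ≤ ∑ z, F (msg z) z := by
    have e1 : ∀ z, ∑ e : ι, ((2:ℝ) * (if (valid (msg z) e ∧
        b (msg z) e = xor (z (l (msg z) e)) (z (r (msg z) e))) then 1 else 0) - 1) ≤ F (msg z) z := by
      intro z
      simp only [hF]
      rw [Finset.sum_filter]
      apply Finset.sum_le_sum
      intro e _
      by_cases hv : valid (msg z) e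
      · simp only [hv, true_and, if_true]
        generalize b (msg z) e = b1
        generalize z (l (msg z) e) = b2
        generalize z (r (msg z) e) = b3
        cases b1 <;> cases b2 <;> cases b3 <;> norm_num [eps]
      · simp [hv]
    have e2 := Finset.sum_le_sum (fun z (_ : z ∈ (Finset.univ : Finset (V → Bool))) => e1 z)
    refine le_trans ?_ e2
    rw [Finset.card_filter, Nat.cast_sum, ← Finset.univ_product_univ, Finset.sum_product_right] at hsucc
    push_cast at hsucc
    simp only [Finset.sum_sub_distrib, ← Finset.mul_sum, Finset.sum_const, nsmul_eq_mul, mul_one,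
      hcardZ]
    rw [Finset.card_univ, ← hN]
    linarith
  have tang : ∀ z, Real.exp (t * (7 / 8 * N)) * (1 + t * F (msg z) z - t * (7 / 8 * N))
      ≤ ∑ μ, Real.exp (t * F μ z) := by
    intro z
    have h1 : Real.exp (t * F (msg z) z) ≤ ∑ μ, Real.exp (t * F μ z) :=
      Finset.single_le_sum (f := fun μ => Real.exp (t * F μ z)) (fun μ _ => (Real.exp_pos _).le)
        (Finset.mem_univ (msg z))
    refine le_trans ?_ h1
    have h2 := Real.add_one_le_exp (t * F (msg z) z - t * (7 / 8 * N))
    have h3 : Real.exp (t * F (msg z) z) = Real.exp (t * (7 / 8 * N)) *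
        Real.exp (t * F (msg z) z - t * (7 / 8 * N)) := by
      rw [← Real.exp_add]; congr 1; ring
    rw [h3]
    apply mul_le_mul_of_nonneg_left _ (Real.exp_pos _).le
    linarith
  have tot := Finset.sum_le_sum (fun z (_ : z ∈ (Finset.univ : Finset (V → Bool))) => tang z)
  rw [Finset.sum_comm, ← Finset.mul_sum] at tot
  have tot2 := tot.trans (Finset.sum_le_sum (fun μ _ => hM μ))
  simp only [Finset.sum_sub_distrib, Finset.sum_add_distrib, Finset.sum_const, nsmul_eq_mul,
    mul_one, hcardZ, ← Finset.mul_sum] at tot2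
  rw [Finset.card_univ] at tot2
  have : Real.exp (t * (7 / 8 * N)) * 2 ^ Fintype.card V ≤
      (Fintype.card M * Real.exp (t * h + 2 * t ^ 2 * (D * N))) * 2 ^ Fintype.card V := by
    refine le_trans (mul_le_mul_of_nonneg_left ?_ (Real.exp_pos _).le) (tot2.trans (le_of_eq (by ring)))
    nlinarith [mul_le_mul_of_nonneg_left hsum ht]
  exact le_of_mul_le_mul_right this hp

lemma num_hh (u h a b : ℝ) (hu : 17408 ≤ u) (hh : 0 ≤ h) (hhN : h ≤ u ^ 8) (ha0 : 0 ≤ a) (hb0 : 0 ≤ b)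
    (ha : u ^ 3 * a ≤ u ^ 8) (hb : u ^ 3 * b ≤ u ^ 8)
    (hk : h ^ 2 ≤ b * (16 * h + 256 * a ^ 2)) : h ≤ u ^ 8 / 8 := by
  have hu0 : 0 < u := by linarith
  have ha' : a ≤ u ^ 5 := by
    refine le_of_mul_le_mul_left (ha.trans (le_of_eq ?_)) (by positivity : 0 < u ^ 3); ring
  have hb' : b ≤ u ^ 5 := by
    refine le_of_mul_le_mul_left (hb.trans (le_of_eq ?_)) (by positivity : 0 < u ^ 3); ring
  by_contra hc
  push Not at hc
  have h1 : h ^ 2 ≤ u ^ 5 * (16 * u ^ 8 + 256 * (u ^ 5) ^ 2) := by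
    refine hk.trans ?_
    gcongr
  have h2 : (u ^ 8 / 8) ^ 2 < h ^ 2 := by
    apply pow_lt_pow_left₀ hc (by positivity) (by norm_num)
  have h3 : u ^ 13 ≤ u ^ 15 := pow_le_pow_right₀ (by linarith) (by norm_num)
  have h4 : 17408 * u ^ 15 ≤ u ^ 16 := by
    have : 17408 * u ^ 15 ≤ u * u ^ 15 := by gcongr
    calc _ ≤ _ := this
      _ = _ := by ring
  nlinarith

lemma num_fin (u LA LB h : ℝ) (hu : 0 < u)
    (hfin : (3 / (16 * u ^ 3)) * (7 / 8 * u ^ 8) ≤ u ^ 4 * (LA + LB) +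
      ((3 / (16 * u ^ 3)) * (u ^ 8 / 8) + 2 * (3 / (16 * u ^ 3)) ^ 2 * (u ^ 3 * u ^ 8))) :
    9 / 128 * u ≤ LA + LB := by
  have e1 : (3 / (16 * u ^ 3)) * (7 / 8 * u ^ 8) = 21 / 128 * u ^ 5 := by field_simp; norm_num
  have e2 : (3 / (16 * u ^ 3)) * (u ^ 8 / 8) = 3 / 128 * u ^ 5 := by field_simp; norm_num
  have e3 : 2 * (3 / (16 * u ^ 3)) ^ 2 * (u ^ 3 * u ^ 8) = 9 / 128 * u ^ 5 := by field_simp; norm_num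
  rw [e1, e2, e3] at hfin
  refine le_of_mul_le_mul_left ?_ (by positivity : 0 < u ^ 4)
  nlinarith

lemma exists_params (m : ℕ) (hm : 10000 ≤ m) : ∃ p : ℕ, p.Prime ∧ 2 < p ∧ 4 * p ^ 2 ≤ m ∧
    ⌈Real.sqrt (Nat.sqrt m)⌉₊ ^ 2 ≤ 16 * p ∧ m ≤ 4 * ⌈Real.sqrt (Nat.sqrt m)⌉₊ ^ 4 := by
  set α := Nat.sqrt m with hα
  have hα100 : 100 ≤ α := Nat.le_sqrt.2 (by omega)
  have hα1 : α * α ≤ m := Nat.sqrt_le m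
  have hα2 : m < (α + 1) * (α + 1) := Nat.lt_succ_sqrt m
  set s := ⌈Real.sqrt α⌉₊ with hs
  have hs1 : α ≤ s ^ 2 := by
    have : Real.sqrt α ≤ s := Nat.le_ceil _
    have := (Real.sqrt_le_left (by positivity)).1 this
    exact_mod_cast this
  have hs2 : s ^ 2 ≤ 4 * α := by
    have h1 : (s : ℝ) < Real.sqrt α + 1 := Nat.ceil_lt_add_one (Real.sqrt_nonneg _)
    have h2 : (1:ℝ) ≤ Real.sqrt α := by
      rw [Real.one_le_sqrt]; exact_mod_cast (by omega : 1 ≤ α)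
    have h3 : Real.sqrt α ^ 2 = α := Real.sq_sqrt (by positivity)
    have : (s : ℝ) ^ 2 ≤ 4 * α := by
      have : (0:ℝ) ≤ s := by positivity
      nlinarith
    exact_mod_cast this
  obtain ⟨p, hp, hp1, hp2⟩ := Nat.exists_prime_lt_and_le_two_mul (α / 4) (by omega)
  refine ⟨p, hp, by omega, ?_, by omega, ?_⟩
  · have : 2 * p ≤ α := by omega
    nlinarith
  · have : α * α ≤ s ^ 2 * s ^ 2 := Nat.mul_le_mul hs1 hs1
    nlinarith

set_option maxHeartbeats 2000000

/-- Deterministic simultaneous NOF lower bound under the hard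
distribution `μ(S,T)`: there are `c > 0` and `m₀` such that for every prime
`m ≥ m₀` (with `n = 2m`, `α = ⌊√m⌋`) there are a gadget `g` and sets
`S, T ⊆ {0,1}ⁿ` with `|S| = |T| = ⌈√α⌉` such that any deterministic simultaneous
NOF protocol solving `GHM ∘ g` with probability at least `15/16` over
`x ~ S, y ~ T, z ~ {0,1}ⁿ` has cost `log₂ C_A + log₂ C_B ≥ c · n^(1/16)`. -/
theorem deterministic_simultaneous_NOF_lower_bound_hard_distribution :
    ∃ c : ℝ, c > 0 ∧ ∃ m₀ : ℕ, ∀ m : ℕ, m.Prime → m ≥ m₀ →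
    ∃ (g : (Fin (2 * m) → Bool) → (Fin (2 * m) → Bool) → Fin m)
      (S T : Finset (Fin (2 * m) → Bool)),
      S.card = ⌈Real.sqrt (Nat.sqrt m)⌉₊ ∧ T.card = ⌈Real.sqrt (Nat.sqrt m)⌉₊ ∧
      ∀ (CA CB : ℕ), 1 ≤ CA → 1 ≤ CB →
      ∀ (PA : (Fin (2 * m) → Bool) → (Fin (2 * m) → Bool) → Fin CA)
        (PB : (Fin (2 * m) → Bool) → (Fin (2 * m) → Bool) → Fin CB)
        (PC : (Fin (2 * m) → Bool) → (Fin (2 * m) → Bool) → Fin CA → Fin CB →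
              Fin (2 * m) × Fin (2 * m) × Bool),
      (((S ×ˢ T ×ˢ (Finset.univ : Finset (Fin (2 * m) → Bool))).filter
          (fun p =>
            ((PC p.1 p.2.1 (PA p.2.1 p.2.2) (PB p.1 p.2.2)).1 : ℕ) < m ∧
            ((PC p.1 p.2.1 (PA p.2.1 p.2.2) (PB p.1 p.2.2)).2.1 : ℕ)
              = m + (((g p.1 p.2.1 : ℕ)
                  + ((PC p.1 p.2.1 (PA p.2.1 p.2.2) (PB p.1 p.2.2)).1 : ℕ)) % m) ∧
            (PC p.1 p.2.1 (PA p.2.1 p.2.2) (PB p.1 p.2.2)).2.2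
              = xor (p.2.2 (PC p.1 p.2.1 (PA p.2.1 p.2.2) (PB p.1 p.2.2)).1)
                    (p.2.2 (PC p.1 p.2.1 (PA p.2.1 p.2.2) (PB p.1 p.2.2)).2.1))).card : ℝ)
        ≥ (15 / 16 : ℝ) * (S.card * T.card * 2 ^ (2 * m)) →
      Real.logb 2 CA + Real.logb 2 CB ≥ c * ((2 * m : ℕ) : ℝ) ^ ((1 : ℝ) / 16) := by
  refine ⟨1 / 32, by norm_num, 4 * 17408 ^ 16, ?_⟩
  intro m _ hm0
  obtain ⟨p, hp, hp2, hpm, hsp, hms⟩ := exists_params m (le_trans (by norm_num) hm0)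
  set s := ⌈Real.sqrt (Nat.sqrt m)⌉₊ with hs
  have hspos : 0 < s := by
    rcases Nat.eq_zero_or_pos s with h | h
    · rw [h] at hms; norm_num at hms; omega
    · exact h
  have hppos := hp.pos
  have hp2m : 2 * p ^ 2 ≤ m := by nlinarith
  -- embedding
  have hsm : s ≤ m := by nlinarith
  have hcard : Fintype.card (Fin s) ≤ Fintype.card (Fin (2 * m) → Bool) := by
    simp only [Fintype.card_fin, Fintype.card_fun, Fintype.card_bool]
    have : 2 * m < 2 ^ (2 * m) := Nat.lt_two_pow_self
    omega
  obtain ⟨f⟩ := Function.Embedding.nonempty_of_card_le hcard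
  haveI : Nonempty (Fin s) := ⟨⟨0, hspos⟩⟩
  set K : Fin s × Fin s → ℕ := fun e => (e.1 : ℕ) + s * (e.2 : ℕ) with hK
  have hKinj : ∀ e e', K e = K e' → e = e' := by
    rintro ⟨i, j⟩ ⟨i', j'⟩ h
    simp only [hK] at h
    have h1 : (i : ℕ) = i' := by
      have := congrArg (· % s) h
      simpa [Nat.add_mul_mod_self_left, Nat.mod_eq_of_lt] using this
    have h2 : (j : ℕ) = j' := by
      rw [h1] at h
      exact Nat.eq_of_mul_eq_mul_left hspos (Nat.add_left_cancel h)
    exact Prod.ext (Fin.ext h1) (Fin.ext h2)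
  have hKlt : ∀ e, K e < 16 * p := by
    rintro ⟨i, j⟩
    refine lt_of_lt_of_le ?_ hsp
    have h1 := i.2
    have h2 : s * ((j : ℕ) + 1) ≤ s * s := Nat.mul_le_mul_left _ j.2
    simp only [hK]
    nlinarith
  set x : Fin s × Fin s → ℕ := fun e => K e % p with hx
  set φ : Fin s × Fin s → Fin 16 := fun e =>
    ⟨K e / p, Nat.div_lt_of_lt_mul (by rw [mul_comm]; exact hKlt e)⟩ with hφ
  have hxlt : ∀ e, x e < p := fun e => Nat.mod_lt _ hppos
  have hinj : ∀ e e', x e = x e' → φ e = φ e' → e = e' := by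
    intro e e' h1 h2
    apply hKinj
    have h3 : K e / p = K e' / p := by simpa [hφ] using h2
    rw [← Nat.div_add_mod (K e) p, ← Nat.div_add_mod (K e') p, h3]
    simp only [hx] at h1
    rw [h1]
  set G : Fin s × Fin s → ℕ := fun e => 2 * p * x e + x e ^ 2 % p with hG
  have hGlt : ∀ e, G e < m := by
    intro e
    have h1 := Nat.mod_lt (x e ^ 2) hppos
    have h2 := hxlt e
    refine lt_of_lt_of_le ?_ hp2m
    simp only [hG]
    nlinarith
  refine ⟨fun a b => ⟨G (Function.invFun f a, Function.invFun f b), hGlt _⟩,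
    Finset.univ.map f, Finset.univ.map f, by simp, by simp, ?_⟩
  intro CA CB hCA hCB PA PB PC hsucc
  have hinvf : ∀ i, Function.invFun f (f i) = i := Function.leftInverse_invFun f.injective
  set out : ((Fin s → Fin CA) × (Fin s → Fin CB)) → Fin s × Fin s → Fin (2 * m) × Fin (2 * m) × Bool :=
    fun μ e => PC (f e.1) (f e.2) (μ.1 e.2) (μ.2 e.1) with hout
  set msg : (Fin (2 * m) → Bool) → ((Fin s → Fin CA) × (Fin s → Fin CB)) :=
    fun z => (fun j => PA (f j) z, fun i => PB (f i) z) with hmsg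
  set valid : ((Fin s → Fin CA) × (Fin s → Fin CB)) → Fin s × Fin s → Prop := fun μ e =>
    ((out μ e).1 : ℕ) < m ∧ ((out μ e).2.1 : ℕ) = m + ((G e + ((out μ e).1 : ℕ)) % m) with hvalid
  set u : ℝ := (s : ℝ) ^ ((1:ℝ) / 4) with hu
  have hu4 : u ^ 4 = s := by
    rw [hu, ← Real.rpow_natCast, ← Real.rpow_mul (by positivity)]; norm_num
  have hu0 : 0 < u := Real.rpow_pos_of_pos (by exact_mod_cast hspos) _
  have hu16 : (m : ℝ) ≤ 4 * u ^ 16 := by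
    have : (m : ℝ) ≤ 4 * (s : ℝ) ^ 4 := by exact_mod_cast hms
    rw [← hu4] at this
    calc _ ≤ _ := this
      _ = _ := by ring
  have hubig : 17408 ≤ u := by
    have h1 : (4 * 17408 ^ 16 : ℝ) ≤ m := by exact_mod_cast hm0
    have h2 : (17408:ℝ) ^ 16 ≤ u ^ 16 := by linarith
    exact le_of_pow_le_pow_left₀ (by norm_num) hu0.le h2
  have hcι : (Fintype.card (Fin s × Fin s) : ℝ) = u ^ 8 := by
    simp only [Fintype.card_prod, Fintype.card_fin]
    push_cast
    rw [← hu4]; ring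
  have main := core (V := Fin (2 * m)) (ι := Fin s × Fin s) (fun v => (v : ℕ) < m) msg
    (fun μ e => (out μ e).1) (fun μ e => (out μ e).2.1) (fun μ e => (out μ e).2.2) valid
    (fun μ e h => h.1) (fun μ e h => by have := h.2; omega) (u ^ 3) (u ^ 8 / 8) (3 / (16 * u ^ 3))
    (by positivity) (by positivity) ?_ ?_
  · rw [hcι] at main
    have hCA' : (0:ℝ) < CA := by exact_mod_cast hCA
    have hCB' : (0:ℝ) < CB := by exact_mod_cast hCB
    have hcM : (Fintype.card ((Fin s → Fin CA) × (Fin s → Fin CB)) : ℝ)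
        = (CA : ℝ) ^ s * (CB : ℝ) ^ s := by simp
    rw [hcM] at main
    have hlog := Real.log_le_log (Real.exp_pos _) main
    rw [Real.log_exp, Real.log_mul (by positivity) (Real.exp_ne_zero _), Real.log_exp,
      Real.log_mul (by positivity) (by positivity), Real.log_pow, Real.log_pow, ← hu4,
      ← mul_add] at hlog
    have hfin := num_fin u (Real.log CA) (Real.log CB) 0 hu0 hlog
    have l2 : Real.log 2 ≤ 1 := by have := Real.log_two_lt_d9; linarith
    have l20 : 0 < Real.log 2 := Real.log_pos (by norm_num)
    have hb : Real.log CA + Real.log CB ≤ Real.logb 2 CA + Real.logb 2 CB := by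
      rw [Real.logb, Real.logb, ← add_div, le_div_iff₀ l20]
      have : 0 ≤ Real.log CA + Real.log CB := by nlinarith
      nlinarith
    have hn : (((2 * m : ℕ) : ℝ)) ^ ((1:ℝ) / 16) ≤ 2 * u := by
      have h1 : ((2 * m : ℕ) : ℝ) ≤ (2 * u) ^ (16 : ℕ) := by
        push_cast
        have : (2 * u) ^ 16 = 65536 * u ^ 16 := by ring
        rw [this]
        have : 0 < u ^ 16 := by positivity
        linarith
      calc _ ≤ ((2 * u) ^ (16 : ℕ)) ^ ((1:ℝ) / 16) :=
            Real.rpow_le_rpow (by positivity) h1 (by norm_num)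
        _ = 2 * u := by
            rw [← Real.rpow_natCast, ← Real.rpow_mul (by positivity)]; norm_num
    have : (1 / 32 : ℝ) * ((2 * m : ℕ) : ℝ) ^ ((1:ℝ) / 16) ≤ 1 / 32 * (2 * u) := by gcongr
    change (1 / 32 : ℝ) * ((2 * m : ℕ) : ℝ) ^ ((1:ℝ) / 16) ≤ _
    linarith
  · intro μ H hH hkl hkr
    rw [hcι] at hkl hkr
    have hk := kst H (fun e => (out μ e).1) (fun e => (out μ e).2.1) x φ hinj ?_
    · refine num_hh u H.card _ _ hubig (by positivity) ?_ (by positivity) (by positivity) hkl hkr ?_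
      · rw [← hcι]; exact_mod_cast Finset.card_le_univ _
      · exact_mod_cast hk
    · intro e₁ h1 e₁' h1' e₂ h2 e₂' h2' hr1 hr2 hl1 hl2 hne
      have v1 := (hH e₁ h1).2
      have v1' := (hH e₁' h1').2
      have v2 := (hH e₂ h2).2
      have v2' := (hH e₂' h2').2
      rw [hr1, v1'] at v1
      rw [hr2, v2', ← hl1, ← hl2] at v2
      have q1 : G e₁' + ((out μ e₁').1 : ℕ) ≡ G e₁ + ((out μ e₁).1 : ℕ) [MOD m] :=
        Nat.add_left_cancel v1
      have q2 : G e₂' + ((out μ e₁').1 : ℕ) ≡ G e₂ + ((out μ e₁).1 : ℕ) [MOD m] :=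
        Nat.add_left_cancel v2
      have q3 : G e₁ + G e₂' ≡ G e₁' + G e₂ [MOD m] := by
        have q4 := Nat.ModEq.add q1.symm q2
        apply Nat.ModEq.add_right_cancel' (((out μ e₁).1 : ℕ) + ((out μ e₁').1 : ℕ))
        convert q4 using 1 <;> ring
      exact sidon p m (x e₁) (x e₁') (x e₂) (x e₂') hp hp2 hpm (hxlt _) (hxlt _) (hxlt _) (hxlt _)
        q3 hne
  · have hc1 : ((Finset.univ.map f).card : ℝ) = s := by simp
    rw [hc1] at hsucc
    refine le_trans (le_of_eq ?_) (hsucc.trans ?_)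
    · simp only [Fintype.card_prod, Fintype.card_fin]; push_cast; ring
    · apply Nat.cast_le.2
      apply Finset.card_le_card_of_surjOn (fun q => (f q.1.1, f q.1.2, q.2))
      rintro ⟨a, b, z⟩ hq
      simp only [Finset.coe_filter, Set.mem_setOf_eq, Finset.mem_product, Finset.mem_map,
        Finset.mem_univ, true_and, and_true] at hq
      obtain ⟨⟨⟨i, rfl⟩, ⟨j, rfl⟩⟩, hq⟩ := hq
      rw [hinvf, hinvf] at hq
      refine ⟨((i, j), z), ?_, rfl⟩
      simp only [Finset.coe_filter, Set.mem_setOf_eq, Finset.mem_univ, true_and]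
      exact ⟨⟨hq.1, hq.2.1⟩, hq.2.2⟩
end

section
/- There exist constants c > 0 and m₀ such that the following holds for every prime m ≥ m₀. Set n = 2m and α = ⌊√m⌋. There exist a gadget g : {0,1}ⁿ × {0,1}ⁿ → {0,…,m−1} and finite sets S, T ⊆ {0,1}ⁿ with |S| = |T| = ⌈α^{1/2}⌉ such that for every K ≥ 1 and all functions f : {0,1}ⁿ → Fin K (the combined locally-independent message, depending only on z) and Π_C : S × T × Fin K → ({0,…,n−1} × {0,…,n−1} × {0,1}), if the probability, over x uniform in S, y uniform in T, and z uniform in {0,1}ⁿ, that the output (ℓ, r, b) = Π_C(x, y, f(z)) satisfies ℓ < m, r = m + ((g(x,y)+ℓ) mod m), and b = z_ℓ XOR z_r, is at least 15/16, then the mutual information between a uniform z and f(z), namely n − ∑_{τ ∈ Fin K} (|f⁻¹(τ)| / 2ⁿ) · log₂ |f⁻¹(τ)| (with the convention that empty fibers contribute 0), is at least c · m^{5/16}. -/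
open scoped Classical

lemma aux_counting {n : ℕ} (I : Finset (Fin n)) (w : Fin n → Fin n) (b : Fin n → Bool)
    (hw : ∀ i ∈ I, w i ∉ I) :
    ∑ z : Fin n → Bool, ∏ i ∈ I, (if xor (z i) (z (w i)) = b i then (1:ℝ) else 1/2)
      = 2^n * (3/4)^I.card := by
  let φ : (Fin n → Bool) → (Fin n → Bool) := fun z i =>
    if i ∈ I then xor (xor (z i) (z (w i))) (b i) else z i
  have hφ : Function.Involutive φ := by
    intro z
    funext i
    by_cases hi : i ∈ I
    · have := hw i hi
      simp only [φ, hi, this, if_true, if_false]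
      cases z i <;> cases z (w i) <;> cases b i <;> rfl
    · simp [φ, hi]
  have h1 : ∑ z : Fin n → Bool, ∏ i ∈ I, (if xor (z i) (z (w i)) = b i then (1:ℝ) else 1/2)
      = ∑ z : Fin n → Bool, ∏ i ∈ I, (if z i = false then (1:ℝ) else 1/2) := by
    refine Fintype.sum_equiv hφ.toPerm _ _ ?_
    intro z
    refine Finset.prod_congr rfl ?_
    intro i hi
    simp only [Function.Involutive.coe_toPerm, φ, hi, if_true]
    cases z i <;> cases z (w i) <;> cases b i <;> rfl
  rw [h1]
  have h2 : ∀ z : Fin n → Bool, ∏ i ∈ I, (if z i = false then (1:ℝ) else 1/2)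
      = ∏ i, (if i ∈ I then (if z i = false then (1:ℝ) else 1/2) else 1) := by
    intro z
    rw [Finset.prod_ite_mem, Finset.univ_inter]
  simp_rw [h2]
  have h3 := Finset.prod_univ_sum (fun _ : Fin n => (Finset.univ : Finset Bool))
    (fun i c => if i ∈ I then (if c = false then (1:ℝ) else 1/2) else 1)
  rw [Fintype.piFinset_univ] at h3
  rw [← h3]
  have h4 : ∀ i : Fin n, (∑ c : Bool, if i ∈ I then (if c = false then (1:ℝ) else 1/2) else 1)
      = 2 * (if i ∈ I then (3/4) else 1) := by
    intro i
    by_cases hi : i ∈ I <;> simp [hi] <;> norm_num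
  simp_rw [h4]
  rw [Finset.prod_mul_distrib, Finset.prod_ite_mem]
  simp [div_pow]

noncomputable def auxDelta : ℝ := -(Real.logb 2 (3/4) + 1/4)

lemma auxDelta_pos : 0 < auxDelta := by
  unfold auxDelta
  have h : Real.logb 2 (((3:ℝ)/4)^4 * 2) < 0 := by
    apply Real.logb_neg <;> norm_num
  rw [Real.logb_mul (by norm_num) (by norm_num), Real.logb_pow, Real.logb_self_eq_one (by norm_num)] at h
  push_cast at h
  linarith

lemma aux_entropy {n : ℕ} (I : Finset (Fin n)) (w : Fin n → Fin n) (b : Fin n → Bool)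
    (hw : ∀ i ∈ I, w i ∉ I) (A : Finset (Fin n → Bool)) (hA : A.Nonempty)
    (h : ∀ i ∈ I, 4 * ((A.filter (fun z => ¬ xor (z i) (z (w i)) = b i)).card : ℝ) ≤ A.card) :
    Real.logb 2 A.card ≤ n - auxDelta * I.card := by
  have hc := aux_counting I w b hw
  set err : (Fin n → Bool) → ℝ := fun z => ∑ i ∈ I, if xor (z i) (z (w i)) = b i then (0:ℝ) else 1
    with herr
  have hL : 0 < Real.log 2 := Real.log_pos (by norm_num)
  have he : ∀ z : Fin n → Bool, ∏ i ∈ I, (if xor (z i) (z (w i)) = b i then (1:ℝ) else 1/2)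
      = Real.exp (- err z * Real.log 2) := by
    intro z
    rw [herr]
    simp only
    rw [neg_mul, Finset.sum_mul, ← Finset.sum_neg_distrib, Real.exp_sum]
    refine Finset.prod_congr rfl fun i _ => ?_
    split_ifs
    · simp
    · rw [one_mul, Real.exp_neg, Real.exp_log (by norm_num)]; norm_num
  have hsum : ∑ z ∈ A, err z ≤ (I.card : ℝ) / 4 * A.card := by
    rw [herr]
    simp only
    rw [Finset.sum_comm]
    have : ∀ i ∈ I, ∑ z ∈ A, (if xor (z i) (z (w i)) = b i then (0:ℝ) else 1) ≤ (A.card : ℝ)/4 := by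
      intro i hi
      have := h i hi
      rw [Finset.card_filter] at this
      push_cast at this
      simp only [ite_not, Nat.cast_ite, Nat.cast_zero, Nat.cast_one] at this
      linarith
    have := Finset.sum_le_sum this
    rw [Finset.sum_const, nsmul_eq_mul] at this
    linarith
  set a : ℝ := (I.card : ℝ) / 4 with ha
  have key : (A.card : ℝ) * Real.exp (-a * Real.log 2) ≤ 2^n * (3/4)^I.card := by
    rw [← hc]
    calc (A.card : ℝ) * Real.exp (-a * Real.log 2)
        ≤ ∑ z ∈ A, (1 - (err z - a) * Real.log 2) * Real.exp (-a * Real.log 2) := by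
          rw [← Finset.sum_mul]
          refine mul_le_mul_of_nonneg_right ?_ (Real.exp_pos _).le
          rw [Finset.sum_sub_distrib, ← Finset.sum_mul, Finset.sum_sub_distrib]
          simp only [Finset.sum_const, nsmul_eq_mul, mul_one]
          nlinarith
      _ ≤ ∑ z ∈ A, Real.exp (- err z * Real.log 2) := by
          refine Finset.sum_le_sum fun z _ => ?_
          have h1 := Real.add_one_le_exp (-(err z - a) * Real.log 2)
          have h2 : Real.exp (- err z * Real.log 2)
            = Real.exp (-(err z - a) * Real.log 2) * Real.exp (-a * Real.log 2) := by
            rw [← Real.exp_add]; ring_nf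
          rw [h2]
          refine mul_le_mul_of_nonneg_right ?_ (Real.exp_pos _).le
          linarith
      _ = ∑ z ∈ A, ∏ i ∈ I, (if xor (z i) (z (w i)) = b i then (1:ℝ) else 1/2) := by
          simp_rw [he]
      _ ≤ _ := by
          refine Finset.sum_le_sum_of_subset_of_nonneg (Finset.subset_univ _) fun z _ _ => ?_
          rw [he]; exact (Real.exp_pos _).le
  have hApos : (0:ℝ) < A.card := by exact_mod_cast hA.card_pos
  have hlog := Real.log_le_log (mul_pos hApos (Real.exp_pos _)) key
  rw [Real.log_mul hApos.ne' (Real.exp_pos _).ne', Real.log_exp, Real.log_mul (by positivity) (by positivity),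
    Real.log_pow, Real.log_pow] at hlog
  unfold auxDelta Real.logb
  rw [div_le_iff₀ hL]
  have : Real.log (3/4) / Real.log 2 * Real.log 2 = Real.log (3/4) := by field_simp
  calc Real.log A.card ≤ n * Real.log 2 + I.card * Real.log (3/4) + a * Real.log 2 := by linarith
    _ = _ := by rw [ha]; nth_rewrite 1 [← this]; ring

lemma aux_c4 (m : ℕ) (G : Finset ℕ) (d l r : ℕ → ℕ)
    (hr : ∀ a ∈ G, r a ≡ d a + l a [MOD m])
    (hS : ∀ a ∈ G, ∀ b ∈ G, ∀ c ∈ G, ∀ e ∈ G, d a + d b ≡ d c + d e [MOD m] →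
      (a = c ∧ b = e) ∨ a = e) :
    G.card ^ 2 ≤ 8 * (max (G.image l).card (G.image r).card)^3 := by
  set s := max (G.image l).card (G.image r).card
  set P := (G ×ˢ G).filter (fun q => l q.1 = l q.2) with hP
  have h1 : G.card ^ 2 ≤ (G.image l).card * P.card := by
    have hP2 : P.card = ∑ x ∈ G.image l, (G.filter (fun a => l a = x)).card ^ 2 := by
      rw [Finset.card_eq_sum_card_fiberwise (f := fun q => l q.1) (t := G.image l)]
      · refine Finset.sum_congr rfl fun x _ => ?_
        rw [sq, ← Finset.card_product]
        congr 1
        ext ⟨a, b⟩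
        simp only [hP, Finset.mem_filter, Finset.mem_product]
        constructor
        · rintro ⟨⟨⟨h1, h2⟩, h3⟩, h4⟩
          exact ⟨⟨h1, h4⟩, h2, h3 ▸ h4⟩
        · rintro ⟨⟨h1, h4⟩, h2, h3⟩
          exact ⟨⟨⟨h1, h2⟩, h4.trans h3.symm⟩, h4⟩
      · intro q hq
        simp only [hP, Finset.coe_filter, Finset.mem_product, Set.mem_ofPred_eq] at hq
        exact Finset.mem_coe.2 (Finset.mem_image_of_mem _ hq.1.1)
    rw [hP2, Finset.card_eq_sum_card_image l G]
    exact sq_sum_le_card_mul_sum_sq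
  have h2 : P.card ≤ G.card + (G.image r).card ^ 2 := by
    rw [← Finset.card_filter_add_card_filter_not (s := P) (fun q => q.1 = q.2)]
    refine add_le_add ?_ ?_
    · refine Finset.card_le_card_of_injOn (fun q => q.1) ?_ ?_
      · intro q hq
        simp [hP] at hq
        simp; tauto
      · rintro ⟨a, b⟩ hq ⟨a', b'⟩ hq' h
        simp [hP] at hq hq' h
        ext <;> simp <;> omega
    · rw [sq, ← Finset.card_product]
      refine Finset.card_le_card_of_injOn (fun q => (r q.1, r q.2)) ?_ ?_
      · rintro ⟨a, b⟩ hq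
        simp only [hP, Finset.coe_filter, Finset.mem_filter, Finset.mem_product, Set.mem_ofPred_eq] at hq
        exact Finset.mem_coe.2 (Finset.mem_product.2
          ⟨Finset.mem_image_of_mem _ hq.1.1.1, Finset.mem_image_of_mem _ hq.1.1.2⟩)
      · rintro ⟨a, b⟩ hq ⟨c, e⟩ hq' h
        simp only [hP, Finset.coe_filter, Finset.mem_filter, Finset.mem_product, Set.mem_ofPred_eq] at hq hq'
        simp only [Prod.mk.injEq] at h ⊢
        obtain ⟨⟨⟨ha, hb⟩, hab⟩, hne⟩ := hq
        obtain ⟨⟨⟨hc, he⟩, hce⟩, hne'⟩ := hq'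
        have e1 : d a + l a ≡ d c + l c [MOD m] := (hr a ha).symm.trans (h.1 ▸ hr c hc)
        have e2 : d b + l b ≡ d e + l e [MOD m] := (hr b hb).symm.trans (h.2 ▸ hr e he)
        have e3 : d a + d e ≡ d c + d b [MOD m] := by
          have := e1.add e2.symm
          rw [← hab, ← hce] at this
          apply Nat.ModEq.add_right_cancel' (l a + l c)
          convert this using 1 <;> ring
        rcases hS a ha e he c hc b hb e3 with h | h
        · exact ⟨h.1, h.2.symm⟩
        · exact absurd h hne
  have hl : (G.image l).card ≤ s := le_max_left _ _
  have hrr : (G.image r).card ≤ s := le_max_right _ _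
  have h3 : G.card ^ 2 ≤ s * (G.card + s^2) := by
    calc G.card ^ 2 ≤ _ := h1
      _ ≤ s * (G.card + (G.image r).card ^ 2) := Nat.mul_le_mul hl h2
      _ ≤ _ := by gcongr
  rcases Nat.eq_zero_or_pos G.card with h0 | h0
  · simp [h0]
  rcases le_total G.card (2 * s) with h4 | h4
  · have : G.card^2 ≤ G.card^3 := Nat.pow_le_pow_right h0 (by norm_num)
    calc _ ≤ _ := this
      _ ≤ (2*s)^3 := by gcongr
      _ = _ := by ring
  · nlinarith

lemma aux_fiber (m : ℕ) (G : Finset ℕ) (d : ℕ → ℕ) (l r : ℕ → Fin (2*m)) (b : ℕ → Bool)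
    (hl : ∀ a ∈ G, (l a : ℕ) < m)
    (hr : ∀ a ∈ G, (r a : ℕ) = m + (d a + l a) % m)
    (hS : ∀ a ∈ G, ∀ b ∈ G, ∀ c ∈ G, ∀ e ∈ G, d a + d b ≡ d c + d e [MOD m] →
      (a = c ∧ b = e) ∨ a = e)
    (A : Finset (Fin (2*m) → Bool)) (hA : A.Nonempty)
    (h : ∀ a ∈ G, 4 * ((A.filter (fun z => ¬ b a = xor (z (l a)) (z (r a)))).card : ℝ) ≤ A.card) :
    ∃ s : ℕ, G.card ^ 2 ≤ 8 * s ^ 3 ∧ Real.logb 2 A.card ≤ (2*m : ℕ) - auxDelta * s := by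
  refine ⟨_, aux_c4 m G d (fun a => l a) (fun a => r a) ?_ hS, ?_⟩
  · intro a ha
    simp only [hr a ha]
    unfold Nat.ModEq
    simp
  have gen : ∀ (l r : ℕ → Fin (2*m)), (∀ a ∈ G, ∀ a' ∈ G, r a ≠ l a') →
     (∀ a ∈ G, 4 * ((A.filter (fun z => ¬ b a = xor (z (l a)) (z (r a)))).card : ℝ) ≤ A.card) →
     Real.logb 2 A.card ≤ (2*m : ℕ) - auxDelta * ((G.image (fun a => (l a : ℕ))).card : ℕ) := by
    intro l r hlr h
    have hcard : (G.image (fun a => (l a : ℕ))).card = (G.image l).card := by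
      have : (G.image (fun a => (l a : ℕ))) = Finset.image (Fin.val : Fin (2*m) → ℕ) (G.image l) := by
        rw [Finset.image_image]; rfl
      rw [this, Finset.card_image_of_injective _ Fin.val_injective]
    rw [hcard]
    have hch : ∀ i : Fin (2*m), ∃ a, i ∈ G.image l → a ∈ G ∧ l a = i := by
      intro i
      by_cases hi : i ∈ G.image l
      · obtain ⟨a, ha, hai⟩ := Finset.mem_image.1 hi
        exact ⟨a, fun _ => ⟨ha, hai⟩⟩
      · exact ⟨0, fun h => absurd h hi⟩
    choose c hc using hch
    refine aux_entropy (G.image l) (fun i => r (c i)) (fun i => b (c i)) ?_ A hA ?_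
    · intro i hi hmem
      obtain ⟨a, ha, hai⟩ := Finset.mem_image.1 hmem
      exact hlr _ (hc i hi).1 a ha hai.symm
    · intro i hi
      have := h _ (hc i hi).1
      rw [(hc i hi).2] at this
      simp only [eq_comm] at this ⊢
      convert this using 6
  rcases max_choice (G.image (fun a => (l a : ℕ))).card (G.image (fun a => (r a : ℕ))).card with h1 | h1
  · rw [h1]
    refine gen l r ?_ h
    intro a ha a' ha' heq
    have := hl a' ha'
    rw [← heq, hr a ha] at this
    omega
  · rw [h1]
    refine gen r l ?_ ?_
    · intro a ha a' ha' heq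
      have := hl a ha
      rw [heq, hr a' ha'] at this
      omega
    · intro a ha
      have := h a ha
      simp only [Bool.xor_comm] at this ⊢
      convert this using 6

lemma aux_sidon (p m : ℕ) (hp : p.Prime) (h2 : 2 < p) (hm : 4 * p^2 ≤ m) :
    ∀ a < p, ∀ b < p, ∀ c < p, ∀ e < p,
     (2*p*a + a^2 % p) + (2*p*b + b^2 % p) ≡ (2*p*c + c^2 % p) + (2*p*e + e^2 % p) [MOD m] →
      (a = c ∧ b = e) ∨ a = e := by
  intro a ha b hb c hc e he h
  have hp0 : 0 < p := by omega
  have hlt : ∀ a < p, 2*p*a + a^2 % p < 2*p^2 := by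
    intro a ha
    have := Nat.mod_lt (a^2) hp0
    nlinarith
  have h' := Nat.ModEq.eq_of_lt_of_lt h (by have := hlt a ha; have := hlt b hb; omega)
    (by have := hlt c hc; have := hlt e he; omega)
  have ra := Nat.mod_lt (a^2) hp0
  have rb := Nat.mod_lt (b^2) hp0
  have rc := Nat.mod_lt (c^2) hp0
  have re := Nat.mod_lt (e^2) hp0
  have hsum : a + b = c + e := by
    rcases lt_trichotomy (a+b) (c+e) with h | h | h
    · have := Nat.mul_le_mul_left (2*p) (Nat.succ_le_of_lt h)
      simp only [Nat.succ_eq_add_one, mul_add] at this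
      omega
    · exact h
    · have := Nat.mul_le_mul_left (2*p) (Nat.succ_le_of_lt h)
      simp only [Nat.succ_eq_add_one, mul_add] at this
      omega
  have hsq : a^2 % p + b^2 % p = c^2 % p + e^2 % p := by
    have : 2*p*(a+b) = 2*p*(c+e) := by rw [hsum]
    nlinarith
  have := Fact.mk hp
  have z1 : (a:ZMod p) + b = c + e := by exact_mod_cast congrArg (Nat.cast : ℕ → ZMod p) hsum
  have z2 : (a:ZMod p)^2 + b^2 = c^2 + e^2 := by
    have := congrArg (Nat.cast : ℕ → ZMod p) hsq
    push_cast [ZMod.natCast_mod] at this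
    exact this
  have two : (2 : ZMod p) ≠ 0 := by
    intro h
    have : ((2:ℕ) : ZMod p) = 0 := by exact_mod_cast h
    rw [ZMod.natCast_eq_zero_iff] at this
    exact absurd (Nat.le_of_dvd (by norm_num) this) (by omega)
  have z3 : (2 : ZMod p) * (((a : ZMod p) - c) * (a - e)) = 0 := by
    have hb : (b : ZMod p) = c + e - a := by rw [← z1]; ring
    rw [hb] at z2
    linear_combination z2
  have inj : ∀ x < p, ∀ y < p, (x : ZMod p) - y = 0 → x = y := by
    intro x hx y hy h
    have h := sub_eq_zero.1 h
    rw [ZMod.natCast_eq_natCast_iff] at h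
    exact Nat.ModEq.eq_of_lt_of_lt h hx hy
  rcases mul_eq_zero.1 ((mul_eq_zero.1 z3).resolve_left two) with h | h
  · left
    have := inj a ha c hc h
    omega
  · right
    exact inj a ha e he h

lemma aux_params (α : ℕ) (h : 1 ≤ α) :
    α ≤ ⌈Real.sqrt α⌉₊ ^ 2 ∧ ⌈Real.sqrt α⌉₊ ^ 2 ≤ 4 * α := by
  have h1 := Nat.le_ceil (Real.sqrt α)
  have h2 := Nat.ceil_lt_add_one (Real.sqrt_nonneg (α:ℝ))
  have h3 : Real.sqrt α ^ 2 = α := Real.sq_sqrt (by positivity)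
  have h4 : 1 ≤ Real.sqrt α := Real.one_le_sqrt.2 (by exact_mod_cast h)
  set k := ⌈Real.sqrt α⌉₊
  constructor
  · have : (α:ℝ) ≤ (k:ℝ)^2 := by rw [← h3]; gcongr
    exact_mod_cast this
  · have : (k:ℝ)^2 ≤ 4 * α := by
      have : (k:ℝ)^2 ≤ (2 * Real.sqrt α)^2 := by
        gcongr
        linarith
      nlinarith
    exact_mod_cast this

set_option maxHeartbeats 2000000 in
lemma aux_info {ι : Type*} (Q : Finset ι) (n K : ℕ) (f : (Fin n → Bool) → Fin K)
    (V : ι → (Fin n → Bool) → Prop) (D : ℝ) (hD : 0 ≤ D) (hQ : 0 < Q.card)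
    (hV : ∑ q ∈ Q, ((Finset.univ.filter (fun z => V q z)).card : ℝ) ≥ 15/16 * (Q.card * 2^n))
    (hfib : ∀ τ, (Finset.univ.filter (fun z => f z = τ)).Nonempty → ∀ Q' ⊆ Q, Q.card ≤ 2 * Q'.card →
      (∀ q ∈ Q', 4 * (((Finset.univ.filter (fun z => f z = τ)).filter (fun z => ¬ V q z)).card : ℝ)
        ≤ (Finset.univ.filter (fun z => f z = τ)).card) →
      Real.logb 2 (Finset.univ.filter (fun z => f z = τ)).card ≤ n - D) :
    (n : ℝ) - ∑ τ : Fin K, (((Finset.univ.filter (fun z => f z = τ)).card : ℝ) / 2^n)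
      * Real.logb 2 ((Finset.univ.filter (fun z => f z = τ)).card : ℝ) ≥ D / 2 := by
  set A : Fin K → Finset (Fin n → Bool) := fun τ => Finset.univ.filter (fun z => f z = τ) with hAdef
  change (n : ℝ) - ∑ τ : Fin K, (((A τ).card : ℝ) / 2^n) * Real.logb 2 ((A τ).card : ℝ) ≥ D / 2
  obtain ⟨E, hE⟩ : ∃ E : Fin K → ℝ, ∀ τ, E τ = ∑ q ∈ Q, (((A τ).filter (fun z => ¬ V q z)).card : ℝ) :=
    ⟨_, fun _ => rfl⟩
  have hQ' : (0:ℝ) < Q.card := by exact_mod_cast hQ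
  have h2n : (0:ℝ) < 2^n := by positivity
  have htot : ∑ τ, ((A τ).card : ℝ) = 2^n := by
    have := Finset.card_eq_sum_card_fiberwise (f := f) (s := Finset.univ) (t := Finset.univ)
      (by intro x _; simp)
    rw [Finset.card_univ] at this
    simp at this
    have h' := congrArg (Nat.cast : ℕ → ℝ) this
    push_cast at h'
    exact h'.symm
  have hEtot : ∑ τ, E τ ≤ 1/16 * (Q.card * 2^n) := by
    simp only [hE]
    rw [Finset.sum_comm]
    have h1 : ∀ q ∈ Q, ∑ τ, (((A τ).filter (fun z => ¬ V q z)).card : ℝ)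
        = 2^n - ((Finset.univ.filter (fun z => V q z)).card : ℝ) := by
      intro q _
      have e1 := Finset.card_eq_sum_card_fiberwise (f := f)
        (s := Finset.univ.filter (fun z => ¬ V q z)) (t := Finset.univ) (by intro x _; simp)
      have e2 := Finset.card_filter_add_card_filter_not
        (s := (Finset.univ : Finset (Fin n → Bool))) (fun z => V q z)
      rw [Finset.card_univ] at e2
      simp only [Fintype.card_pi, Fintype.card_bool, Finset.prod_const, Finset.card_univ,
        Fintype.card_fin] at e2
      have e3 : ∀ τ, (A τ).filter (fun z => ¬ V q z)
          = (Finset.univ.filter (fun z => ¬ V q z)).filter (fun z => f z = τ) := by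
        intro τ
        rw [hAdef]
        simp only
        rw [Finset.filter_comm]
      simp_rw [e3]
      have e2' : ((Finset.univ.filter (fun z => V q z)).card : ℝ)
        + (Finset.univ.filter (fun z => ¬ V q z)).card = 2^n := by exact_mod_cast e2
      have e1' := congrArg (Nat.cast : ℕ → ℝ) e1
      push_cast at e1'
      rw [← e1']
      linarith
    rw [Finset.sum_congr rfl h1, Finset.sum_sub_distrib, Finset.sum_const, nsmul_eq_mul]
    linarith
  have key : ∀ τ, ((A τ).card : ℝ) * Real.logb 2 (A τ).card
      ≤ (A τ).card * (n - D) + D * (8 * E τ / Q.card) := by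
    intro τ
    have hE0 : 0 ≤ E τ := by
      rw [hE]
      exact Finset.sum_nonneg fun q _ => Nat.cast_nonneg _
    have hDE : 0 ≤ D * (8 * E τ / Q.card) :=
      mul_nonneg hD (div_nonneg (mul_nonneg (by norm_num) hE0) hQ'.le)
    rcases Finset.eq_empty_or_nonempty (A τ) with h0 | h0
    · rw [h0, Finset.card_empty, Nat.cast_zero, zero_mul, zero_mul, zero_add]
      exact hDE
    have hApos : (0:ℝ) < (A τ).card := by exact_mod_cast h0.card_pos
    by_cases hg : 8 * E τ ≤ Q.card * (A τ).card
    · have : Real.logb 2 (A τ).card ≤ n - D := by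
        refine hfib τ h0 (Q.filter (fun q => 4 * (((A τ).filter (fun z => ¬ V q z)).card : ℝ)
          ≤ (A τ).card)) (Finset.filter_subset _ _) ?_ ?_
        · have e1 := Finset.card_filter_add_card_filter_not (s := Q)
            (fun q => 4 * (((A τ).filter (fun z => ¬ V q z)).card : ℝ) ≤ (A τ).card)
          set Q1 := (Q.filter (fun q => 4 * (((A τ).filter (fun z => ¬ V q z)).card : ℝ)
            ≤ (A τ).card))
          set Q2 := (Q.filter (fun q => ¬ 4 * (((A τ).filter (fun z => ¬ V q z)).card : ℝ)
            ≤ (A τ).card)) with hQ2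
          have e2 : (Q2.card : ℝ) * ((A τ).card / 4) ≤ E τ := by
            calc (Q2.card : ℝ) * ((A τ).card / 4) = ∑ q ∈ Q2, ((A τ).card / 4 : ℝ) := by
                  rw [Finset.sum_const, nsmul_eq_mul]
              _ ≤ ∑ q ∈ Q2, (((A τ).filter (fun z => ¬ V q z)).card : ℝ) := by
                  refine Finset.sum_le_sum fun q hq => ?_
                  have := (Finset.mem_filter.1 hq).2
                  push Not at this
                  linarith
              _ ≤ E τ := by
                  rw [hE]
                  exact Finset.sum_le_sum_of_subset_of_nonneg (Finset.filter_subset _ _)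
                    fun _ _ _ => Nat.cast_nonneg _
          have e3 : 2 * (Q2.card : ℝ) ≤ Q.card := by
            refine le_of_mul_le_mul_right ?_ hApos
            linarith
          have e4 : 2 * Q2.card ≤ Q.card := by exact_mod_cast e3
          omega
        · intro q hq
          exact (Finset.mem_filter.1 hq).2
      have h3 := mul_le_mul_of_nonneg_left this hApos.le
      linarith
    · push Not at hg
      have h1 : Real.logb 2 (A τ).card ≤ n := by
        have hle : ((A τ).card : ℝ) ≤ 2^n := by
          rw [← htot]
          exact Finset.single_le_sum (f := fun τ => ((A τ).card : ℝ))
            (fun _ _ => Nat.cast_nonneg _) (Finset.mem_univ τ)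
        have := Real.logb_le_logb_of_le (b := 2) (by norm_num) hApos hle
        rw [Real.logb_pow, Real.logb_self_eq_one (by norm_num)] at this
        simpa using this
      have h2 : ((A τ).card : ℝ) ≤ 8 * E τ / Q.card := by
        rw [le_div_iff₀ hQ']; linarith
      have h3 := mul_le_mul_of_nonneg_left h1 hApos.le
      have h4 := mul_le_mul_of_nonneg_left h2 hD
      linarith
  have hs := Finset.sum_le_sum fun τ (_ : τ ∈ Finset.univ) => key τ
  rw [Finset.sum_add_distrib, ← Finset.sum_mul, htot, ← Finset.mul_sum, ← Finset.sum_div,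
    ← Finset.mul_sum] at hs
  have h5 : 8 * (∑ τ, E τ) / Q.card ≤ 2^n / 2 := by
    rw [div_le_iff₀ hQ']; linarith
  have h6 := mul_le_mul_of_nonneg_left h5 hD
  have h7 : ∑ τ : Fin K, (((A τ).card : ℝ) / 2^n) * Real.logb 2 ((A τ).card : ℝ)
      = (∑ τ : Fin K, ((A τ).card : ℝ) * Real.logb 2 ((A τ).card : ℝ)) / 2^n := by
    rw [Finset.sum_div]
    refine Finset.sum_congr rfl fun τ _ => ?_
    ring
  have h8 : (∑ τ : Fin K, ((A τ).card : ℝ) * Real.logb 2 ((A τ).card : ℝ)) / 2^n ≤ n - D / 2 := by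
    rw [div_le_iff₀ h2n]; linarith
  rw [h7]
  linarith

set_option maxHeartbeats 2000000 in
/-- Information complexity lower bound for locally independent
protocols: there are `c > 0` and `m₀` such that for every prime `m ≥ m₀`
(with `n = 2m`, `α = ⌊√m⌋`) there are a gadget `g` and sets `S, T` with
`|S| = |T| = ⌈√α⌉` such that any locally independent protocol (with combined
message `f(z) ∈ Fin K` depending only on `z`) solving `GHM ∘ g` with probability
at least `15/16` over `μ(S,T)` satisfies
`I(Z; f(Z)) = n − ∑_τ (|f⁻¹(τ)|/2ⁿ)·log₂|f⁻¹(τ)| ≥ c · m^(5/16)`. -/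
theorem information_complexity_locally_independent_lower_bound :
    ∃ c : ℝ, c > 0 ∧ ∃ m₀ : ℕ, ∀ m : ℕ, m.Prime → m ≥ m₀ →
    ∃ (g : (Fin (2 * m) → Bool) → (Fin (2 * m) → Bool) → Fin m)
      (S T : Finset (Fin (2 * m) → Bool)),
      S.card = ⌈Real.sqrt (Nat.sqrt m)⌉₊ ∧ T.card = ⌈Real.sqrt (Nat.sqrt m)⌉₊ ∧
      ∀ (K : ℕ), 1 ≤ K →
      ∀ (f : (Fin (2 * m) → Bool) → Fin K)
        (PC : (Fin (2 * m) → Bool) → (Fin (2 * m) → Bool) → Fin K →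
              Fin (2 * m) × Fin (2 * m) × Bool),
      (((S ×ˢ T ×ˢ (Finset.univ : Finset (Fin (2 * m) → Bool))).filter
          (fun p =>
            ((PC p.1 p.2.1 (f p.2.2)).1 : ℕ) < m ∧
            ((PC p.1 p.2.1 (f p.2.2)).2.1 : ℕ)
              = m + (((g p.1 p.2.1 : ℕ) + ((PC p.1 p.2.1 (f p.2.2)).1 : ℕ)) % m) ∧
            (PC p.1 p.2.1 (f p.2.2)).2.2
              = xor (p.2.2 (PC p.1 p.2.1 (f p.2.2)).1)
                    (p.2.2 (PC p.1 p.2.1 (f p.2.2)).2.1))).card : ℝ)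
        ≥ (15 / 16 : ℝ) * (S.card * T.card * 2 ^ (2 * m)) →
      ((2 * m : ℕ) : ℝ)
        - ∑ τ : Fin K,
            (((Finset.univ.filter (fun z : Fin (2 * m) → Bool => f z = τ)).card : ℝ)
              / 2 ^ (2 * m))
            * Real.logb 2
                ((Finset.univ.filter (fun z : Fin (2 * m) → Bool => f z = τ)).card : ℝ)
        ≥ c * (m : ℝ) ^ ((5 : ℝ) / 16) := by
  refine ⟨auxDelta / 64, by have := auxDelta_pos; positivity, 1000, ?_⟩
  intro m hmp hm
  set α := Nat.sqrt m with hα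
  have hα1 : α * α ≤ m := Nat.sqrt_le m
  have hα2 : m < (α + 1) * (α + 1) := Nat.lt_succ_sqrt m
  have hα3 : 30 ≤ α := by
    by_contra h
    push Not at h
    nlinarith
  set k := ⌈Real.sqrt α⌉₊ with hk
  obtain ⟨hk1, hk2⟩ := aux_params α (by omega)
  rw [← hk] at hk1 hk2
  obtain ⟨p, hp, hpl, hpu⟩ := Nat.exists_prime_lt_and_le_two_mul (α / 4) (by omega)
  have hp2 : 2 < p := by omega
  have hp4 : α ≤ 4 * p := by omega
  have hpm : 4 * p^2 ≤ m := by
    have : 2 * p ≤ α := by omega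
    nlinarith
  have hkp : k * k ≤ 16 * p := by nlinarith
  have hkpos : 0 < k := by
    rcases Nat.eq_zero_or_pos k with h | h
    · rw [h] at hk1; omega
    · exact h
  let d : ℕ → ℕ := fun a => 2*p*a + a^2 % p
  have hd : ∀ a < p, d a < m := by
    intro a ha
    have := Nat.mod_lt (a^2) (show 0 < p by omega)
    simp only [d]
    nlinarith
  have hcard : k ≤ (Finset.univ : Finset (Fin (2*m) → Bool)).card := by
    simp only [Finset.card_univ, Fintype.card_pi, Fintype.card_bool, Finset.prod_const, Fintype.card_fin]
    have h1 : 2 * m < 2^(2*m) := Nat.lt_two_pow_self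
    nlinarith
  obtain ⟨S, -, hS⟩ := Finset.exists_subset_card_eq hcard
  have hidx : ∃ idx : (Fin (2*m) → Bool) → ℕ, (∀ x ∈ S, idx x < k) ∧
      ∀ x ∈ S, ∀ y ∈ S, idx x = idx y → x = y := by
    refine ⟨fun x => if h : x ∈ S then (S.equivFin ⟨x, h⟩ : ℕ) else 0, ?_, ?_⟩
    · intro x hx
      simp only [hx, dif_pos]
      rw [← hS]
      exact Fin.isLt _
    · intro x hx y hy h
      simp only [hx, hy, dif_pos] at h
      have := S.equivFin.injective (Fin.val_injective h)
      exact congrArg Subtype.val this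
  obtain ⟨idx, hidx1, hidx2⟩ := hidx
  let col : (Fin (2*m) → Bool) × (Fin (2*m) → Bool) → ℕ := fun q => (idx q.1 * k + idx q.2) % p
  have hcol : ∀ q, col q < p := fun q => Nat.mod_lt _ (by omega)
  have hmult : ∀ Q' ⊆ S ×ˢ S, Q'.card ≤ 16 * (Q'.image col).card := by
    intro Q' hQ'
    refine Finset.card_le_mul_card_image _ _ ?_
    intro a _
    have : (Finset.range 16).card = 16 := Finset.card_range 16
    rw [← this]
    refine Finset.card_le_card_of_injOn (fun q => (idx q.1 * k + idx q.2) / p) ?_ ?_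
    · rintro ⟨x, y⟩ hq
      have hq' := Finset.mem_product.1 (hQ' (Finset.mem_filter.1 (Finset.mem_coe.1 hq)).1)
      have h1 := hidx1 _ hq'.1
      have h2 := hidx1 _ hq'.2
      simp only at h1 h2
      refine Finset.mem_coe.2 (Finset.mem_range.2 ?_)
      rw [Nat.div_lt_iff_lt_mul (by omega)]
      simp only
      nlinarith
    · rintro ⟨x, y⟩ hq ⟨x', y'⟩ hq' h
      have hq1 := Finset.mem_product.1 (hQ' (Finset.mem_filter.1 (Finset.mem_coe.1 hq)).1)
      have hq1' := Finset.mem_product.1 (hQ' (Finset.mem_filter.1 (Finset.mem_coe.1 hq')).1)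
      have hc := (Finset.mem_filter.1 (Finset.mem_coe.1 hq)).2
      have hc' := (Finset.mem_filter.1 (Finset.mem_coe.1 hq')).2
      simp only [col] at hc hc' h hq1 hq1'
      have h2 := hidx1 _ hq1.2
      have h2' := hidx1 _ hq1'.2
      have e : idx x * k + idx y = idx x' * k + idx y' := by
        rw [← Nat.div_add_mod (idx x * k + idx y) p, ← Nat.div_add_mod (idx x' * k + idx y') p,
          h, hc, hc']
      have e1 : idx x = idx x' := by
        have : (k * idx x + idx y) / k = (k * idx x' + idx y') / k := by
          rw [mul_comm k, mul_comm k, e]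
        rw [Nat.mul_add_div hkpos, Nat.mul_add_div hkpos,
          Nat.div_eq_of_lt h2, Nat.div_eq_of_lt h2'] at this
        simpa using this
      have e2 : idx y = idx y' := by rw [e1] at e; omega
      rw [hidx2 _ hq1.1 _ hq1'.1 e1, hidx2 _ hq1.2 _ hq1'.2 e2]
  refine ⟨fun x y => ⟨d (col (x, y)), hd _ (hcol _)⟩, S, S, hS, hS, ?_⟩
  intro K _ f PC hsucc
  have hδ := auxDelta_pos
  obtain ⟨V, hVdef⟩ : ∃ V : (Fin (2*m) → Bool) × (Fin (2*m) → Bool) → (Fin (2*m) → Bool) → Prop,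
    V = fun q z =>
    ((PC q.1 q.2 (f z)).1 : ℕ) < m ∧
    ((PC q.1 q.2 (f z)).2.1 : ℕ) = m + (d (col q) + ((PC q.1 q.2 (f z)).1 : ℕ)) % m ∧
    (PC q.1 q.2 (f z)).2.2 = xor (z (PC q.1 q.2 (f z)).1) (z (PC q.1 q.2 (f z)).2.1) := ⟨_, rfl⟩
  have hmain := aux_info (S ×ˢ S) (2*m) K f V (auxDelta * ((m:ℝ)^((5:ℝ)/16) / 32))
    (by positivity) (by rw [Finset.card_product, hS]; positivity) ?_ ?_
  · refine le_trans (le_of_eq ?_) hmain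
    ring
  · have e : ∑ q ∈ S ×ˢ S, ((Finset.univ.filter (fun z => V q z)).card : ℝ)
      = (((S ×ˢ S ×ˢ (Finset.univ : Finset (Fin (2 * m) → Bool))).filter
          (fun p => V (p.1, p.2.1) p.2.2)).card : ℝ) := by
      rw [Finset.card_filter, Finset.sum_product, Finset.sum_product]
      push_cast
      refine Finset.sum_congr rfl fun x _ => ?_
      rw [Finset.sum_product]
      refine Finset.sum_congr rfl fun y _ => ?_
      rw [Finset.card_filter]
      push_cast
      rfl
    rw [e, Finset.card_product]
    push_cast
    refine le_trans hsucc (le_of_eq ?_)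
    exact congrArg _ (congrArg Finset.card (by ext x; simp only [Finset.mem_filter, hVdef]))
  · intro τ hne Q' hQ' hcard' herr
    set A := (Finset.univ.filter (fun z => f z = τ)) with hA
    have hApos : (0:ℝ) < A.card := by exact_mod_cast hne.card_pos
    have hch : ∀ a : ℕ, ∃ q, a ∈ Q'.image col → q ∈ Q' ∧ col q = a := by
      intro i
      by_cases hi : i ∈ Q'.image col
      · obtain ⟨a, ha, hai⟩ := Finset.mem_image.1 hi
        exact ⟨a, fun _ => ⟨ha, hai⟩⟩
      · exact ⟨(fun _ => false, fun _ => false), fun h => absurd h hi⟩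
    choose q hq using hch
    have hfA : ∀ z ∈ A, f z = τ := fun z hz => (Finset.mem_filter.1 hz).2
    have hval : ∀ a ∈ Q'.image col, ((PC (q a).1 (q a).2 τ).1 : ℕ) < m ∧
        ((PC (q a).1 (q a).2 τ).2.1 : ℕ) = m + (d a + ((PC (q a).1 (q a).2 τ).1 : ℕ)) % m := by
      intro a ha
      obtain ⟨h1, h2⟩ := hq a ha
      have h3 := herr _ h1
      have : ∃ z ∈ A, V (q a) z := by
        by_contra hno
        push Not at hno
        rw [Finset.filter_true_of_mem hno] at h3
        linarith
      obtain ⟨z, hz, hVz⟩ := this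
      simp only [hVdef, hfA z hz, h2] at hVz
      exact ⟨hVz.1, hVz.2.1⟩
    obtain ⟨s, hs1, hs2⟩ := aux_fiber m (Q'.image col) d
      (fun a => (PC (q a).1 (q a).2 τ).1) (fun a => (PC (q a).1 (q a).2 τ).2.1)
      (fun a => (PC (q a).1 (q a).2 τ).2.2)
      (fun a ha => (hval a ha).1) (fun a ha => (hval a ha).2)
      (by
        have hlt : ∀ a ∈ Q'.image col, a < p := by
          intro a ha
          obtain ⟨x, _, rfl⟩ := Finset.mem_image.1 ha
          exact hcol x
        intro a ha b hb c hc e he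
        exact aux_sidon p m hp hp2 hpm a (hlt a ha) b (hlt b hb) c (hlt c hc) e (hlt e he))
      A hne
      (by
        intro a ha
        refine le_trans ?_ (herr _ (hq a ha).1)
        have : (A.filter (fun z => ¬ (PC (q a).1 (q a).2 τ).2.2 =
            xor (z (PC (q a).1 (q a).2 τ).1) (z (PC (q a).1 (q a).2 τ).2.1))).card
            ≤ (A.filter (fun z => ¬ V (q a) z)).card := by
          refine Finset.card_le_card ?_
          intro z hz
          rw [Finset.mem_filter] at hz ⊢
          refine ⟨hz.1, fun hVz => hz.2 ?_⟩
          simp only [hVdef, hfA z hz.1] at hVz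
          exact hVz.2.2
        have : ((A.filter (fun z => ¬ (PC (q a).1 (q a).2 τ).2.2 =
            xor (z (PC (q a).1 (q a).2 τ).1) (z (PC (q a).1 (q a).2 τ).2.1))).card : ℝ)
            ≤ (A.filter (fun z => ¬ V (q a) z)).card := by exact_mod_cast this
        linarith)
    refine hs2.trans ?_
    have hG := hmult Q' hQ'
    rw [Finset.card_product, hS] at hcard'
    have hG2 : α ≤ 32 * (Q'.image col).card := by nlinarith
    have hms : m ≤ (32 * s)^3 := by
      have h1 : α^2 ≤ (32 * (Q'.image col).card)^2 := Nat.pow_le_pow_left hG2 2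
      have h2 : m ≤ 4 * α^2 := by nlinarith
      rw [mul_pow] at h1 ⊢
      omega
    have hms' : (m:ℝ)^((5:ℝ)/16) ≤ 32 * s := by
      have h1 : (m:ℝ) ≤ (32 * s : ℝ)^3 := by exact_mod_cast hms
      calc (m:ℝ)^((5:ℝ)/16) ≤ (m:ℝ)^((1:ℝ)/3) :=
            Real.rpow_le_rpow_of_exponent_le (by exact_mod_cast (by omega : 1 ≤ m)) (by norm_num)
        _ ≤ ((32 * s : ℝ)^3)^((1:ℝ)/3) := Real.rpow_le_rpow (by positivity) h1 (by norm_num)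
        _ = 32 * s := by
            rw [← Real.rpow_natCast, ← Real.rpow_mul (by positivity)]
            norm_num
    have : auxDelta * ((m:ℝ)^((5:ℝ)/16) / 32) ≤ auxDelta * s :=
      mul_le_mul_of_nonneg_left (by linarith) hδ.le
    linarith
end

section
/- There exist constants c > 0 and m₀ such that for every prime m ≥ m₀ the following holds. Let Q' ⊆ ZMod m be (8·log₂ m)-periodic-free with |Q'| ≥ ⌊√m⌋ / 2. For each q ∈ Q', let ℓ_q ∈ {0,…,m−1} and b_q ∈ {0,1} be arbitrary, and set r_q = m + ((ℓ_q + q) mod m). Let Z' ⊆ {0,1}^{2m} be a nonempty set such that for every q ∈ Q', the fraction of z ∈ Z' with z_{ℓ_q} XOR z_{r_q} ≠ b_q is at most 1/4. Then |Z'| ≤ 2^{2m − c·m^{5/16}}. -/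
open scoped Classical

/-- A subset `A ⊆ Q` of `ZMod m` is *periodic* if some nonzero shift `b` maps it
back into `Q`; the set `Q` is `β`-periodic-free if every periodic subset of `Q`
has size less than `β`. -/
def PeriodicFree (m : ℕ) (β : ℝ) (Q : Finset (ZMod m)) : Prop :=
  ∀ A : Finset (ZMod m), A ⊆ Q → ∀ b : ZMod m, b ≠ 0 →
    A.image (fun a => a + b) ⊆ Q → (A.card : ℝ) < β


lemma aux_sum {ι σ : Type*} [Fintype ι] [DecidableEq ι] (a c : σ → ι) (b : σ → Bool) (S : Finset σ)
    (hinj : Set.InjOn a S) (hne : ∀ q ∈ S, ∀ q' ∈ S, a q ≠ c q') :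
    ∑ z : ι → Bool, ∏ q ∈ S, (if xor (z (a q)) (z (c q)) ≠ b q then (1/2 : ℝ) else 1)
      = (3/4 : ℝ) ^ S.card * 2 ^ (Fintype.card ι) := by
  induction S using Finset.induction_on with
  | empty => simp
  | insert q0 S hq ih =>
    have ih' := ih (hinj.mono (by simp)) (fun q h q' h' => hne q (by simp [h]) q' (by simp [h']))
    rw [Finset.card_insert_of_notMem hq]
    let e : (ι → Bool) → (ι → Bool) := fun z => Function.update z (a q0) (!z (a q0))
    have he : Function.Involutive e := by
      intro z
      funext i
      by_cases h : i = a q0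
      · subst h; simp [e]
      · simp [e, h]
    have h1 : ∀ z : ι → Bool, ∏ q ∈ S, (if xor (e z (a q)) (e z (c q)) ≠ b q then (1/2 : ℝ) else 1)
        = ∏ q ∈ S, (if xor (z (a q)) (z (c q)) ≠ b q then (1/2 : ℝ) else 1) := by
      intro z
      refine Finset.prod_congr rfl fun q h => ?_
      have n1 : a q ≠ a q0 := fun hh => by
        have := hinj (by simp [h]) (by simp) hh
        exact hq (this ▸ h)
      have n2 : c q ≠ a q0 := (hne q0 (by simp) q (by simp [h])).symm
      simp only [e, Function.update_of_ne n1, Function.update_of_ne n2]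
    have h2 : ∀ z : ι → Bool, (if xor (e z (a q0)) (e z (c q0)) ≠ b q0 then (1/2 : ℝ) else 1)
        + (if xor (z (a q0)) (z (c q0)) ≠ b q0 then (1/2 : ℝ) else 1) = 3/2 := by
      intro z
      have n2 : c q0 ≠ a q0 := (hne q0 (by simp) q0 (by simp)).symm
      simp only [e, Function.update_of_ne n2, Function.update_self]
      cases z (a q0) <;> cases z (c q0) <;> cases b q0 <;> norm_num
    have h3 := Equiv.sum_comp he.toPerm (fun z : ι → Bool => ∏ q ∈ insert q0 S, (if xor (z (a q)) (z (c q)) ≠ b q then (1/2 : ℝ) else 1))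
    have h4 : ∑ z : ι → Bool, (∏ q ∈ insert q0 S, (if xor (e z (a q)) (e z (c q)) ≠ b q then (1/2 : ℝ) else 1)
        + ∏ q ∈ insert q0 S, (if xor (z (a q)) (z (c q)) ≠ b q then (1/2 : ℝ) else 1))
        = 3/2 * ∑ z : ι → Bool, ∏ q ∈ S, (if xor (z (a q)) (z (c q)) ≠ b q then (1/2 : ℝ) else 1) := by
      rw [Finset.mul_sum]
      refine Finset.sum_congr rfl fun z _ => ?_
      rw [Finset.prod_insert hq, Finset.prod_insert hq, h1, ← add_mul, h2]
    rw [Finset.sum_add_distrib, ih'] at h4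
    simp only [Function.Involutive.coe_toPerm] at h3
    rw [pow_succ]
    linarith

lemma aux_bound {ι σ : Type*} [Fintype ι] [DecidableEq ι] (a c : σ → ι) (b : σ → Bool) (S : Finset σ)
    (hinj : Set.InjOn a S) (hne : ∀ q ∈ S, ∀ q' ∈ S, a q ≠ c q')
    (Z : Finset (ι → Bool))
    (hZ : ∀ q ∈ S, ((Z.filter (fun z => xor (z (a q)) (z (c q)) ≠ b q)).card : ℝ) ≤ (Z.card : ℝ) / 4) :
    (Z.card : ℝ) ≤ 2 ^ ((Fintype.card ι : ℝ) - (S.card : ℝ) / 8) := by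
  have h0 := aux_sum a c b S hinj hne
  set k : ℝ := (S.card : ℝ) with hk
  let err : (ι → Bool) → ℕ := fun z => (S.filter (fun q => xor (z (a q)) (z (c q)) ≠ b q)).card
  have hprod : ∀ z : ι → Bool, ∏ q ∈ S, (if xor (z (a q)) (z (c q)) ≠ b q then (1/2 : ℝ) else 1)
      = Real.exp (- (err z : ℝ) * Real.log 2) := by
    intro z
    rw [Finset.prod_ite]
    simp only [Finset.prod_const, one_pow, mul_one, err]
    rw [neg_mul, Real.exp_neg, Real.exp_nat_mul, Real.exp_log (by norm_num)]
    simp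
  have herr : ∑ z ∈ Z, (err z : ℝ) ≤ (Z.card : ℝ) * (k / 4) := by
    have : ∑ z ∈ Z, (err z : ℝ) = ∑ q ∈ S, ((Z.filter (fun z => xor (z (a q)) (z (c q)) ≠ b q)).card : ℝ) := by
      have := Finset.sum_card_bipartiteAbove_eq_sum_card_bipartiteBelow (s := Z) (t := S)
        (fun z q => xor (z (a q)) (z (c q)) ≠ b q)
      exact_mod_cast this
    rw [this]
    refine (Finset.sum_le_sum hZ).trans ?_
    rw [Finset.sum_const, nsmul_eq_mul]
    apply le_of_eq; rw [hk]; ring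
  have hlog : 0 < Real.log 2 := Real.log_pos (by norm_num)
  have hlow : (Z.card : ℝ) * Real.exp (-(k/4) * Real.log 2) ≤ ∑ z ∈ Z, Real.exp (- (err z : ℝ) * Real.log 2) := by
    have hp : ∀ z ∈ Z, Real.exp (-(k/4) * Real.log 2) * (1 + (k/4 - err z) * Real.log 2)
        ≤ Real.exp (- (err z : ℝ) * Real.log 2) := by
      intro z _
      have h := Real.add_one_le_exp ((k/4 - err z) * Real.log 2)
      have : Real.exp (- (err z : ℝ) * Real.log 2) = Real.exp (-(k/4) * Real.log 2) * Real.exp ((k/4 - err z) * Real.log 2) := by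
        rw [← Real.exp_add]; congr 1; ring
      rw [this]
      exact mul_le_mul_of_nonneg_left (by linarith) (Real.exp_pos _).le
    refine le_trans ?_ (Finset.sum_le_sum hp)
    rw [← Finset.mul_sum, mul_comm]
    refine mul_le_mul_of_nonneg_left ?_ (Real.exp_pos _).le
    rw [Finset.sum_add_distrib, ← Finset.sum_mul, Finset.sum_sub_distrib]
    simp only [Finset.sum_const, nsmul_eq_mul, mul_one]
    have : 0 ≤ ((Z.card : ℝ) * (k / 4) - ∑ z ∈ Z, (err z : ℝ)) * Real.log 2 :=
      mul_nonneg (by linarith) hlog.le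
    linarith
  have hup : ∑ z ∈ Z, Real.exp (- (err z : ℝ) * Real.log 2) ≤ (3/4 : ℝ) ^ S.card * 2 ^ (Fintype.card ι) := by
    rw [← h0]
    simp only [hprod]
    exact Finset.sum_le_sum_of_subset_of_nonneg (Finset.subset_univ _) (fun _ _ _ => (Real.exp_pos _).le)
  have h34 : (3/4 : ℝ) ^ S.card ≤ Real.exp (-(3/8 * k) * Real.log 2) := by
    have h : (3/4 : ℝ) ≤ Real.exp (-(3/8) * Real.log 2) := by
      refine le_of_pow_le_pow_left₀ (n := 8) (by norm_num) (Real.exp_pos _).le ?_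
      rw [← Real.exp_nat_mul]
      have : ((8:ℕ):ℝ) * (-(3/8) * Real.log 2) = -((3:ℕ) * Real.log 2) := by push_cast; ring
      rw [this, Real.exp_neg, Real.exp_nat_mul, Real.exp_log (by norm_num)]
      norm_num
    refine (pow_le_pow_left₀ (by norm_num) h _).trans ?_
    rw [← Real.exp_nat_mul]
    apply le_of_eq; congr 1; rw [hk]; ring
  have hfin : (Z.card : ℝ) * Real.exp (-(k/4) * Real.log 2) ≤ Real.exp (-(3/8 * k) * Real.log 2) * 2 ^ (Fintype.card ι) :=
    (hlow.trans hup).trans (mul_le_mul_of_nonneg_right h34 (by positivity))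
  have hE : (2:ℝ) ^ ((Fintype.card ι : ℝ) - k / 8) * Real.exp (-(k/4) * Real.log 2) = Real.exp (-(3/8 * k) * Real.log 2) * 2 ^ (Fintype.card ι) := by
    rw [← Real.rpow_natCast 2 (Fintype.card ι), Real.rpow_def_of_pos (by norm_num), Real.rpow_def_of_pos (by norm_num), ← Real.exp_add, ← Real.exp_add]
    congr 1; ring
  rw [← hE] at hfin
  exact le_of_mul_le_mul_right hfin (Real.exp_pos _)

lemma aux_image {α β : Type*} [DecidableEq β] (f : α → β) (s : Finset α) :
    ∃ S ⊆ s, Set.InjOn f S ∧ S.card = (s.image f).card := by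
  obtain ⟨S, h1, h2, h3⟩ := Finset.exists_subset_injOn_image_eq_of_surjOn (f := f) s (s.image f)
    (by intro x hx; simpa using hx)
  refine ⟨S, by exact_mod_cast h1, h2, ?_⟩
  rw [← h3, Finset.card_image_of_injOn h2]

lemma aux_kst (m : ℕ) (hm : 0 < m) (β : ℝ) (hβ : 0 ≤ β) (Q : Finset (ZMod m)) (hQ : PeriodicFree m β Q)
    (l r : ZMod m → Fin (2 * m)) (hl : ∀ q, (l q : ℕ) < m)
    (hr : ∀ q, (r q : ℕ) = m + (((l q : ℕ) + (q : ZMod m).val) % m)) :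
    (Q.card : ℝ) ^ 2 ≤ (Q.image r).card * (Q.card + β * (Q.image l).card ^ 2) := by
  have : NeZero m := ⟨hm.ne'⟩
  have key : ∀ q q', r q = r q' → q' = q + ((l q : ℕ) - (l q' : ℕ) : ZMod m) := by
    intro q q' h
    have h1 := hr q
    have h2 := hr q'
    rw [h] at h1
    have h3 : ((l q : ℕ) + q.val) ≡ ((l q' : ℕ) + q'.val) [MOD m] := by
      unfold Nat.ModEq; omega
    have h4 := (ZMod.natCast_eq_natCast_iff _ _ _).2 h3
    push_cast at h4
    rw [ZMod.natCast_zmod_val, ZMod.natCast_zmod_val] at h4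
    linear_combination -h4
  set P : Finset (ZMod m × ZMod m) := (Q ×ˢ Q).filter (fun p => r p.1 = r p.2) with hP
  have hsum : (P.card : ℝ) = ∑ w ∈ Q.image r, ((Q.filter (fun q => r q = w)).card : ℝ) ^ 2 := by
    have h1 : P.card = ∑ w ∈ Q.image r, (P.filter (fun p => r p.1 = w)).card :=
      Finset.card_eq_sum_card_fiberwise (by
        intro p hp
        simp [hP] at hp
        simp only [Finset.coe_image, Set.mem_image, Finset.mem_coe]
        exact ⟨p.1, hp.1.1, rfl⟩)
    rw [h1]
    push_cast
    refine Finset.sum_congr rfl fun w _ => ?_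
    have : P.filter (fun p => r p.1 = w) = (Q.filter (fun q => r q = w)) ×ˢ (Q.filter (fun q => r q = w)) := by
      ext p
      simp only [hP, Finset.mem_filter, Finset.mem_product]
      constructor
      · rintro ⟨⟨⟨h1, h2⟩, h3⟩, h4⟩
        exact ⟨⟨h1, h4⟩, h2, h3 ▸ h4⟩
      · rintro ⟨⟨h1, h4⟩, h2, h3⟩
        exact ⟨⟨⟨h1, h2⟩, h4.trans h3.symm⟩, h4⟩
    rw [this, Finset.card_product]; push_cast; ring
  have hN : (Q.card : ℝ) = ∑ w ∈ Q.image r, ((Q.filter (fun q => r q = w)).card : ℝ) := by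
    exact_mod_cast Finset.card_eq_sum_card_image r Q
  have hcs : (Q.card : ℝ) ^ 2 ≤ (Q.image r).card * P.card := by
    rw [hN, hsum]; exact sq_sum_le_card_mul_sum_sq
  refine hcs.trans (mul_le_mul_of_nonneg_left ?_ (by positivity))
  have hsplit := Finset.card_filter_add_card_filter_not (s := P) (fun p => p.1 = p.2)
  have hd : (P.filter (fun p => p.1 = p.2)).card ≤ Q.card := by
    refine Finset.card_le_card_of_injOn Prod.fst ?_ ?_
    · intro p hp
      simp [hP] at hp
      exact hp.1.1.1
    · rintro ⟨x, y⟩ hp ⟨x', y'⟩ hp' h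
      simp at hp hp' h
      simp [← hp.2, ← hp'.2, h]
  have ho : (P.filter (fun p => ¬ p.1 = p.2)).card ≤ ⌊β⌋₊ * (Q.image l ×ˢ Q.image l).card := by
    refine Finset.card_le_mul_card_image_of_maps_to (f := fun p => (l p.1, l p.2)) ?_ _ ?_
    · intro p hp
      simp [hP] at hp
      simp only [Finset.mem_product, Finset.mem_image]
      exact ⟨⟨p.1, hp.1.1.1, rfl⟩, ⟨p.2, hp.1.1.2, rfl⟩⟩
    · rintro ⟨u, u'⟩ _
      apply Nat.le_floor
      set F := (P.filter (fun p => ¬ p.1 = p.2)).filter (fun p => (l p.1, l p.2) = (u, u')) with hF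
      have hmem : ∀ p ∈ F, p.1 ∈ Q ∧ p.2 ∈ Q ∧ p.1 ≠ p.2 ∧ p.2 = p.1 + ((u : ℕ) - (u' : ℕ) : ZMod m) := by
        intro p hp
        simp only [hF, hP, Finset.mem_filter, Finset.mem_product, Prod.mk.injEq] at hp
        obtain ⟨⟨⟨⟨h1, h2⟩, h3⟩, h4⟩, h5, h6⟩ := hp
        refine ⟨h1, h2, h4, ?_⟩
        rw [← h5, ← h6]
        exact key _ _ h3
      rcases F.eq_empty_or_nonempty with h | ⟨p0, hp0⟩
      · rw [h]; simpa using hβ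
      · have hb : ((u : ℕ) - (u' : ℕ) : ZMod m) ≠ 0 := by
          intro h
          have := hmem p0 hp0
          rw [h, add_zero] at this
          exact this.2.2.1 this.2.2.2.symm
        have hA := hQ (F.image Prod.fst) (by
          intro x hx
          obtain ⟨p, hp, rfl⟩ := Finset.mem_image.1 hx
          exact (hmem p hp).1) _ hb (by
          intro x hx
          obtain ⟨y, hy, rfl⟩ := Finset.mem_image.1 hx
          obtain ⟨p, hp, rfl⟩ := Finset.mem_image.1 hy
          have := hmem p hp
          simp only [← this.2.2.2]
          exact this.2.1)
        rw [Finset.card_image_of_injOn] at hA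
        · exact hA.le
        · intro p hp p' hp' h
          have h1 := (hmem p hp).2.2.2
          have h2 := (hmem p' hp').2.2.2
          refine Prod.ext h ?_
          rw [h1, h2, h]
  rw [Finset.card_product] at ho
  have hc : (P.card : ℝ) ≤ Q.card + (⌊β⌋₊ : ℝ) * ((Q.image l).card * (Q.image l).card) := by
    exact_mod_cast (by omega : P.card ≤ Q.card + ⌊β⌋₊ * ((Q.image l).card * (Q.image l).card))
  refine hc.trans ?_
  have := mul_le_mul_of_nonneg_right (Nat.floor_le hβ) (by positivity : (0:ℝ) ≤ (Q.image l).card * (Q.image l).card)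
  linarith [this, sq ((Q.image l).card : ℝ)]

lemma aux_asymp : ∃ m₀ : ℕ, ∀ m : ℕ, m ≥ m₀ →
    4 ≤ m ∧ 8 * (m:ℝ) ^ ((5:ℝ)/16) ≤ (m:ℝ) ^ ((1:ℝ)/2) ∧
    256 * Real.logb 2 m < (m:ℝ) ^ ((1:ℝ)/16) := by
  have h1 : ∀ᶠ x : ℝ in Filter.atTop, 8 * x ^ ((5:ℝ)/16) ≤ x ^ ((1:ℝ)/2) := by
    have := (tendsto_rpow_atTop (by norm_num : (0:ℝ) < 3/16)).eventually_ge_atTop 8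
    filter_upwards [this, Filter.eventually_gt_atTop 0] with x hx h0
    have : x ^ ((1:ℝ)/2) = x ^ ((3:ℝ)/16) * x ^ ((5:ℝ)/16) := by
      rw [← Real.rpow_add h0]; norm_num
    rw [this]
    exact mul_le_mul_of_nonneg_right hx (by positivity)
  have h2 : ∀ᶠ x : ℝ in Filter.atTop, 256 * Real.logb 2 x < x ^ ((1:ℝ)/16) := by
    have hlog : 0 < Real.log 2 := Real.log_pos (by norm_num)
    have := (isLittleO_log_rpow_atTop (by norm_num : (0:ℝ) < 1/16)).bound (by positivity : 0 < Real.log 2 / 512)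
    filter_upwards [this, Filter.eventually_gt_atTop 1] with x hx h0
    have hp : 0 < x ^ ((1:ℝ)/16) := by positivity
    rw [Real.norm_of_nonneg (Real.log_pos h0).le, Real.norm_of_nonneg hp.le] at hx
    have : Real.logb 2 x ≤ x ^ ((1:ℝ)/16) / 512 := by
      rw [Real.logb, div_le_iff₀ hlog]; linarith
    linarith
  have h := (tendsto_natCast_atTop_atTop (R := ℝ)).eventually (h1.and h2)
  obtain ⟨n, hn⟩ := Filter.eventually_atTop.1 (h.and (Filter.eventually_ge_atTop 4))
  exact ⟨n, fun m hm => ⟨(hn m hm).2, (hn m hm).1⟩⟩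

lemma aux_size (m : ℕ) (h4 : 4 ≤ m) (h5 : 8 * (m:ℝ) ^ ((5:ℝ)/16) ≤ (m:ℝ) ^ ((1:ℝ)/2))
    (h6 : 256 * Real.logb 2 m < (m:ℝ) ^ ((1:ℝ)/16)) (N L R : ℝ) (hN : N ≥ (Nat.sqrt m : ℝ) / 2)
    (hL : 0 ≤ L) (hR : 0 ≤ R)
    (h : N ^ 2 ≤ R * (N + (8 * Real.logb 2 m) * L ^ 2)) :
    (m:ℝ) ^ ((5:ℝ)/16) ≤ L ∨ (m:ℝ) ^ ((5:ℝ)/16) ≤ R := by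
  by_contra! hc
  obtain ⟨c1, c2⟩ := hc
  have hm : (0:ℝ) < m := by positivity
  set x := (m:ℝ) ^ ((5:ℝ)/16) with hx
  set y := (m:ℝ) ^ ((1:ℝ)/16) with hy
  set s := (m:ℝ) ^ ((1:ℝ)/2) with hs
  have hy0 : 0 < y := by positivity
  have hx0 : 0 < x := by positivity
  have hs2 : s ^ 2 = m := by
    rw [hs, ← Real.rpow_natCast, ← Real.rpow_mul hm.le]; norm_num
  have hxy : x ^ 3 * y = m := by
    rw [hx, hy, ← Real.rpow_natCast, ← Real.rpow_mul hm.le, ← Real.rpow_add hm]; norm_num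
  have hs0 : 0 < s := by positivity
  have hsm : s / 4 ≤ N := by
    have h1 : (m:ℝ) < (Nat.sqrt m + 1) ^ 2 := by
      have := Nat.lt_succ_sqrt' m
      exact_mod_cast this
    have h2 : (2:ℝ) ≤ Nat.sqrt m := by
      exact_mod_cast Nat.le_sqrt'.2 (by omega)
    have h3 : s < Nat.sqrt m + 1 := by
      rw [← hs2] at h1
      exact lt_of_pow_lt_pow_left₀ 2 (by positivity) h1
    linarith
  set t := Real.logb 2 m with ht
  have ht0 : 0 ≤ t := Real.logb_nonneg (by norm_num) (by exact_mod_cast (by omega : 1 ≤ m))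
  have hL2 : L ^ 2 ≤ x ^ 2 := pow_le_pow_left₀ hL c1.le 2
  have hN0 : 0 < N := by linarith
  have e1 : N ^ 2 ≤ x * (N + 8 * t * x ^ 2) := by
    refine h.trans ?_
    apply mul_le_mul c2.le _ (by positivity) hx0.le
    nlinarith [mul_le_mul_of_nonneg_left hL2 ht0]
  have e2 : x ≤ N / 2 := by linarith
  have e3 : x * N ≤ N ^ 2 / 2 := by nlinarith
  have e4 : N ^ 2 ≤ 16 * t * x ^ 3 := by nlinarith
  have e5 : s ^ 2 ≤ 16 * N ^ 2 := by nlinarith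
  have e6 : x ^ 3 * (256 * t) < x ^ 3 * y := mul_lt_mul_of_pos_left h6 (by positivity)
  nlinarith

/-- if `Q' ⊆ ZMod m` is `(8 log₂ m)`-periodic-free of size at least
`⌊√m⌋/2`, and for each `q ∈ Q'` Charlie's answer `(ℓ_q, r_q, b_q)` (with
`r_q = m + ((ℓ_q + q) mod m)`) errs on at most a `1/4` fraction of a nonempty
set `Z' ⊆ {0,1}^{2m}`, then `|Z'| ≤ 2^{2m − c·m^{5/16}}`. -/
theorem few_strings_consistent_with_low_error_answers :
    ∃ c : ℝ, c > 0 ∧ ∃ m₀ : ℕ, ∀ m : ℕ, m.Prime → m ≥ m₀ →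
    ∀ Q' : Finset (ZMod m), PeriodicFree m (8 * Real.logb 2 m) Q' →
    (Q'.card : ℝ) ≥ (Nat.sqrt m : ℝ) / 2 →
    ∀ (l r : ZMod m → Fin (2 * m)) (b : ZMod m → Bool),
    (∀ q, (l q : ℕ) < m) →
    (∀ q, (r q : ℕ) = m + (((l q : ℕ) + (q : ZMod m).val) % m)) →
    ∀ Z' : Finset (Fin (2 * m) → Bool), Z'.Nonempty →
    (∀ q ∈ Q',
      ((Z'.filter (fun z => xor (z (l q)) (z (r q)) ≠ b q)).card : ℝ)
        ≤ (Z'.card : ℝ) / 4) →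
    (Z'.card : ℝ) ≤ 2 ^ ((2 * m : ℝ) - c * (m : ℝ) ^ ((5 : ℝ) / 16)) := by
  obtain ⟨m₀, hm₀⟩ := aux_asymp
  refine ⟨1/8, by norm_num, m₀, ?_⟩
  intro m hp hm Q hQ hcard l r b hl hr Z hZ herr
  obtain ⟨h4, h5, h6⟩ := hm₀ m hm
  have ht0 : 0 ≤ Real.logb 2 m := Real.logb_nonneg (by norm_num) (by exact_mod_cast (by omega : 1 ≤ m))
  have hk := aux_kst m (by omega) _ (by linarith) Q hQ l r hl hr
  have hlr : ∀ q q', l q ≠ r q' := by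
    intro q q' h
    have h1 := hl q
    have h2 := hr q'
    rw [h] at h1
    omega
  have hmain : ∀ S : Finset (ZMod m), (m:ℝ) ^ ((5:ℝ)/16) ≤ S.card →
      (Z.card : ℝ) ≤ 2 ^ ((Fintype.card (Fin (2 * m)) : ℝ) - (S.card : ℝ) / 8) →
      (Z.card : ℝ) ≤ 2 ^ ((2 * m : ℝ) - 1/8 * (m : ℝ) ^ ((5 : ℝ) / 16)) := by
    intro S h1 h2
    refine h2.trans (Real.rpow_le_rpow_of_exponent_le (by norm_num) ?_)
    rw [Fintype.card_fin]; push_cast; linarith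
  rcases aux_size m h4 h5 h6 _ _ _ hcard (by positivity) (by positivity) hk with h | h
  · obtain ⟨S, hS, hinj, hc⟩ := aux_image l Q
    rw [← hc] at h
    exact hmain S h (aux_bound l r b S hinj (fun q _ q' _ => hlr q q') Z (fun q hq => by
      convert herr q (hS hq)))
  · obtain ⟨S, hS, hinj, hc⟩ := aux_image r Q
    rw [← hc] at h
    refine hmain S h (aux_bound r l b S hinj (fun q _ q' _ => (hlr q' q).symm) Z (fun q hq => ?_))
    have := herr q (hS hq)
    have e : ∀ z : Fin (2*m) → Bool, xor (z (r q)) (z (l q)) = xor (z (l q)) (z (r q)) := fun z => Bool.xor_comm _ _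
    simp only [e]
    convert this
end

section
/- There exist constants c > 0 and m₀ such that for every prime m ≥ m₀ the following holds. There exists a set Q ⊆ {0,…,m−1} with |Q| = ⌊√m⌋ such that for every subset Q' ⊆ Q with |Q'| ≥ ⌊√m⌋ / 2 and every function ℓ : Q' → {0,…,m−1}, either the image {ℓ(q) : q ∈ Q'} has at least c·m^{5/16} elements, or the set {(ℓ(q) + q) mod m : q ∈ Q'} has at least c·m^{5/16} elements. -/
lemma aux_cover (m k : ℕ) (hm : 0 < m) (A : Finset ℕ) (hA : ∀ a ∈ A, a < m) (hk : A.card ≤ k) :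
    ∃ f : Fin k → Fin m, ∀ a ∈ A, ∃ i, (f i : ℕ) = a := by
  have : Nonempty (A ↪ Fin k) := by
    apply Function.Embedding.nonempty_of_card_le
    simpa using hk
  obtain ⟨e⟩ := this
  refine ⟨Function.extend e (fun a => (⟨a.1, hA a.1 a.2⟩ : Fin m)) (fun _ => ⟨0, hm⟩), ?_⟩
  intro a ha
  refine ⟨e ⟨a, ha⟩, ?_⟩
  rw [e.injective.extend_apply]

/-- difference set -/
def dset (m k : ℕ) (f g : Fin k → Fin m) : Finset ℕ :=
  (Finset.univ : Finset (Fin k × Fin k)).image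
    (fun p => ((g p.2 : ℕ) + m - (f p.1 : ℕ)) % m)

lemma dset_card (m k : ℕ) (f g : Fin k → Fin m) : (dset m k f g).card ≤ k ^ 2 := by
  refine Finset.card_image_le.trans ?_
  simp [sq]

/-- bad sets -/
def badS (m k s h : ℕ) : Finset (Finset ℕ) :=
  (Finset.univ : Finset ((Fin k → Fin m) × (Fin k → Fin m))).biUnion fun p =>
    ((dset m k p.1 p.2).powersetCard h ×ˢ (Finset.range m).powersetCard (s - h)).image
      (fun x => x.1 ∪ x.2)

lemma badS_card (m k s h : ℕ) :
    (badS m k s h).card ≤ m ^ (2 * k) * ((k ^ 2).choose h * m.choose (s - h)) := by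
  unfold badS
  refine (Finset.card_biUnion_le_card_mul _ _ ((k ^ 2).choose h * m.choose (s - h)) ?_).trans ?_
  · intro p _
    refine Finset.card_image_le.trans ?_
    rw [Finset.card_product, Finset.card_powersetCard, Finset.card_powersetCard,
      Finset.card_range]
    exact Nat.mul_le_mul_right _ (Nat.choose_le_choose _ (dset_card m k _ _))
  · apply le_of_eq
    simp [two_mul, pow_add]

lemma arith1 (m k s h : ℕ) (hm : 2 ^ 32 ≤ m) (hk : k ^ 16 ≤ m ^ 5) (hs : s = Nat.sqrt m)
    (hh : h = (s + 1) / 2) : m ^ (2 * k) * 4 ^ s * k ^ (2 * h) < m ^ h := by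
  have h1 : 64 * k ≤ s := by
    rw [hs, Nat.le_sqrt, ← sq]
    have : ((64 * k) ^ 2) ^ 8 ≤ m ^ 8 := by
      calc ((64 * k) ^ 2) ^ 8 = (2 ^ 32) ^ 3 * k ^ 16 := by ring
        _ ≤ m ^ 3 * m ^ 5 := by gcongr
        _ = m ^ 8 := by ring
    exact (Nat.pow_le_pow_iff_left (by norm_num)).1 this
  have hs1 : 1 ≤ s := by
    rw [hs, Nat.le_sqrt]; omega
  have hlt : (m ^ (2 * k) * 4 ^ s * k ^ (2 * h)) ^ 8 < (m ^ h) ^ 8 := by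
    calc (m ^ (2 * k) * 4 ^ s * k ^ (2 * h)) ^ 8
        = m ^ (16 * k) * 4 ^ (8 * s) * (k ^ 16) ^ h := by
          simp only [mul_pow, ← pow_mul]
          rw [show 2 * k * 8 = 16 * k by ring, show s * 8 = 8 * s by ring,
            show 2 * h * 8 = 16 * h by ring]
      _ ≤ m ^ (16 * k) * 4 ^ (16 * h) * (m ^ 5) ^ h := by
          have h4 : 4 ^ (8 * s) ≤ 4 ^ (16 * h) := Nat.pow_le_pow_right (by norm_num) (by omega)
          gcongr
      _ = m ^ (16 * k) * (2 ^ 32) ^ h * (m ^ 5) ^ h := by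
          rw [pow_mul 4 16 h]; norm_num
      _ ≤ m ^ (16 * k) * m ^ h * (m ^ 5) ^ h := by gcongr
      _ = m ^ (16 * k + h + 5 * h) := by rw [pow_add, pow_add, pow_mul m 5 h]
      _ < m ^ (h * 8) := by
          apply Nat.pow_lt_pow_right
          · omega
          · omega
      _ = (m ^ h) ^ 8 := by rw [pow_mul]
  exact lt_of_pow_lt_pow_left₀ 8 (Nat.zero_le _) hlt

lemma arith2 (m k s h : ℕ) (hm : 2 ^ 32 ≤ m) (hk : k ^ 16 ≤ m ^ 5) (hs : s = Nat.sqrt m)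
    (hh : h = (s + 1) / 2) :
    m ^ (2 * k) * ((k ^ 2).choose h * m.choose (s - h)) < m.choose s := by
  have key := arith1 m k s h hm hk hs hh
  have hsm : s * s ≤ m := by rw [hs]; exact Nat.sqrt_le m
  have hs1 : 2 ≤ s := by
    rw [hs, Nat.le_sqrt]; omega
  have hhs : h ≤ s := by omega
  have h2s : 2 * s ≤ m := by nlinarith
  have e1 : s.choose h * h.factorial * (s - h).factorial = s.factorial :=
    Nat.choose_mul_factorial_mul_factorial hhs
  have e2 : h.factorial * (k ^ 2).choose h ≤ k ^ (2 * h) := by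
    rw [← Nat.descFactorial_eq_factorial_mul_choose, pow_mul]
    exact Nat.descFactorial_le_pow _ _
  have e3 : (s - h).factorial * m.choose (s - h) ≤ m ^ (s - h) := by
    rw [← Nat.descFactorial_eq_factorial_mul_choose]
    exact Nat.descFactorial_le_pow _ _
  have e4 : (m + 1 - s) ^ s ≤ s.factorial * m.choose s := by
    rw [← Nat.descFactorial_eq_factorial_mul_choose]
    exact Nat.pow_sub_le_descFactorial _ _
  have e5 : s.choose h ≤ 2 ^ s := Nat.choose_le_two_pow s h
  have hpos : 0 < 2 ^ s * s.factorial := by positivity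
  refine lt_of_mul_lt_mul_left (a := 2 ^ s * s.factorial) ?_ hpos.le
  calc 2 ^ s * s.factorial * (m ^ (2 * k) * ((k ^ 2).choose h * m.choose (s - h)))
      = 2 ^ s * s.choose h * m ^ (2 * k) * (h.factorial * (k ^ 2).choose h) *
          ((s - h).factorial * m.choose (s - h)) := by rw [← e1]; ring
    _ ≤ 2 ^ s * 2 ^ s * m ^ (2 * k) * k ^ (2 * h) * m ^ (s - h) := by gcongr
    _ = (m ^ (2 * k) * 4 ^ s * k ^ (2 * h)) * m ^ (s - h) := by
        rw [← mul_pow, show 2 * 2 = 4 from rfl]; ring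
    _ < m ^ h * m ^ (s - h) := Nat.mul_lt_mul_of_pos_right key (by apply Nat.pow_pos; omega)
    _ = m ^ s := by rw [← pow_add]; congr 1; omega
    _ ≤ (2 * (m + 1 - s)) ^ s := by gcongr; omega
    _ = 2 ^ s * (m + 1 - s) ^ s := by rw [mul_pow]
    _ ≤ 2 ^ s * (s.factorial * m.choose s) := by gcongr
    _ = 2 ^ s * s.factorial * m.choose s := by ring


/-- there are `c > 0` and `m₀` such that for every prime `m ≥ m₀`
there is a set `Q ⊆ {0,…,m−1}` with `|Q| = ⌊√m⌋` such that for every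
`Q' ⊆ Q` with `|Q'| ≥ ⌊√m⌋/2` and every `ℓ : Q' → {0,…,m−1}`, either the image
of `ℓ` or the set of shifted values `(ℓ(q)+q) mod m` has at least `c·m^{5/16}`
elements. -/
theorem exists_good_sequence_bipartite :
    ∃ c : ℝ, c > 0 ∧ ∃ m₀ : ℕ, ∀ m : ℕ, m.Prime → m ≥ m₀ →
    ∃ Q : Finset ℕ, Q ⊆ Finset.range m ∧ Q.card = Nat.sqrt m ∧
      ∀ Q' ⊆ Q, (Q'.card : ℝ) ≥ (Nat.sqrt m : ℝ) / 2 →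
      ∀ l : ℕ → ℕ, (∀ q ∈ Q', l q < m) →
      ((Q'.image l).card : ℝ) ≥ c * (m : ℝ) ^ ((5 : ℝ) / 16) ∨
      ((Q'.image (fun q => (l q + q) % m)).card : ℝ) ≥ c * (m : ℝ) ^ ((5 : ℝ) / 16) := by
  refine ⟨1, one_pos, 2 ^ 32, ?_⟩
  intro m _ hm
  have hm0 : 0 < m := by omega
  obtain ⟨s, hs⟩ : ∃ s, s = Nat.sqrt m := ⟨_, rfl⟩
  obtain ⟨h, hh⟩ : ∃ h, h = (s + 1) / 2 := ⟨_, rfl⟩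
  obtain ⟨k, hk⟩ : ∃ k, k = ⌊(m : ℝ) ^ ((5 : ℝ) / 16)⌋₊ := ⟨_, rfl⟩
  have hk16 : k ^ 16 ≤ m ^ 5 := by
    have h1 : (k : ℝ) ≤ (m : ℝ) ^ ((5 : ℝ) / 16) := by
      rw [hk]; exact Nat.floor_le (by positivity)
    have h2 : (k : ℝ) ^ 16 ≤ ((m : ℝ) ^ ((5 : ℝ) / 16)) ^ 16 := by gcongr
    have h3 : ((m : ℝ) ^ ((5 : ℝ) / 16)) ^ 16 = (m : ℝ) ^ 5 := by
      rw [← Real.rpow_natCast, ← Real.rpow_mul (by positivity), ← Real.rpow_natCast]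
      norm_num
    rw [h3] at h2
    exact_mod_cast h2
  have hcard : (badS m k s h).card < ((Finset.range m).powersetCard s).card := by
    rw [Finset.card_powersetCard, Finset.card_range]
    exact (badS_card m k s h).trans_lt (arith2 m k s h hm hk16 hs hh)
  obtain ⟨Q, hQ, hQb⟩ := Finset.exists_mem_notMem_of_card_lt_card hcard
  rw [Finset.mem_powersetCard] at hQ
  rw [← hs]
  refine ⟨Q, hQ.1, hQ.2, ?_⟩
  intro Q' hQ' hc l hl
  by_contra hcon
  push Not at hcon
  obtain ⟨c1, c2⟩ := hcon
  rw [one_mul] at c1 c2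
  have c1' : (Q'.image l).card ≤ k := by rw [hk]; exact Nat.le_floor c1.le
  have c2' : (Q'.image (fun q => (l q + q) % m)).card ≤ k := by rw [hk]; exact Nat.le_floor c2.le
  obtain ⟨f, hf⟩ := aux_cover m k hm0 (Q'.image l) (by
    intro a ha
    obtain ⟨q, hq, rfl⟩ := Finset.mem_image.1 ha
    exact hl q hq) c1'
  obtain ⟨g, hg⟩ := aux_cover m k hm0 (Q'.image (fun q => (l q + q) % m)) (by
    intro a ha
    obtain ⟨q, hq, rfl⟩ := Finset.mem_image.1 ha
    exact Nat.mod_lt _ hm0) c2'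
  have hhc : h ≤ Q'.card := by
    have : s ≤ 2 * Q'.card := by
      have : (s : ℝ) ≤ 2 * (Q'.card : ℝ) := by linarith
      exact_mod_cast this
    omega
  obtain ⟨P, hP, hPc⟩ := Finset.exists_subset_card_eq hhc
  apply hQb
  unfold badS
  rw [Finset.mem_biUnion]
  refine ⟨(f, g), Finset.mem_univ _, ?_⟩
  rw [Finset.mem_image]
  refine ⟨(P, Q \ P), ?_, Finset.union_sdiff_of_subset (hP.trans hQ')⟩
  rw [Finset.mem_product, Finset.mem_powersetCard, Finset.mem_powersetCard]
  refine ⟨⟨?_, hPc⟩, Finset.sdiff_subset.trans hQ.1, ?_⟩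
  · intro q hq
    have hq' := hP hq
    obtain ⟨i, hi⟩ := hf (l q) (Finset.mem_image_of_mem _ hq')
    obtain ⟨j, hj⟩ := hg ((l q + q) % m) (Finset.mem_image.2 ⟨q, hq', rfl⟩)
    unfold dset
    rw [Finset.mem_image]
    refine ⟨(i, j), Finset.mem_univ _, ?_⟩
    simp only [hi, hj]
    have hqm : q < m := Finset.mem_range.1 (hQ.1 (hQ' hq'))
    have hlm := hl q hq'
    rcases lt_or_ge (l q + q) m with hlt | hge
    · rw [Nat.mod_eq_of_lt hlt, show l q + q + m - l q = q + m by omega, Nat.add_mod_right,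
        Nat.mod_eq_of_lt hqm]
    · rw [Nat.mod_eq_sub_mod hge, Nat.mod_eq_of_lt (by omega : l q + q - m < m),
        show l q + q - m + m - l q = q by omega, Nat.mod_eq_of_lt hqm]
  · rw [Finset.card_sdiff_of_subset (hP.trans hQ'), hQ.2, hPc]
end

section
/- There exists m₀ such that for every prime m ≥ m₀ there exists a subset Q ⊆ ZMod m with |Q| = ⌊√m⌋ such that for every nonzero b ∈ ZMod m, the number of a ∈ Q with a + b ∈ Q is less than 8·log₂ m. Equivalently, Q is (8·log₂ m)-periodic-free. -/
lemma pf_key {p m : ℕ} [NeZero p] [NeZero m] (hpm : p * p ≤ m) (b : ZMod m)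
    (u v u' v' : ZMod p)
    (h : ((u'.val + p * v'.val : ℕ) : ZMod m) = ((u.val + p * v.val : ℕ) : ZMod m) + b) :
    ∃ i j : Bool,
      u' = u + ((if i then (b.val : ℤ) else (b.val : ℤ) - m : ℤ) : ZMod p) ∧
      v' = v + (((if i then (b.val : ℤ) else (b.val : ℤ) - m) / (p : ℤ)
        + (if j then 1 else 0) : ℤ) : ZMod p) := by
  have hu := ZMod.val_lt u
  have hv := ZMod.val_lt v
  have hu' := ZMod.val_lt u'
  have hv' := ZMod.val_lt v'
  have hb := ZMod.val_lt b
  have hA : u.val + p * v.val < m := by nlinarith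
  have hA' : u'.val + p * v'.val < m := by nlinarith
  have h1 : u'.val + p * v'.val = (u.val + p * v.val + b.val) % m := by
    have h2 : ((u'.val + p * v'.val : ℕ) : ZMod m) = ((u.val + p * v.val + b.val : ℕ) : ZMod m) := by
      rw [h, Nat.cast_add (u.val + p * v.val) b.val, ZMod.natCast_zmod_val b]
    rw [ZMod.natCast_eq_natCast_iff'] at h2
    rwa [Nat.mod_eq_of_lt hA'] at h2
  have h3 : ∃ i : Bool, (u'.val : ℤ) + p * v'.val = u.val + p * v.val +
      (if i then (b.val : ℤ) else (b.val : ℤ) - m) := by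
    by_cases hc : u.val + p * v.val + b.val < m
    · rw [Nat.mod_eq_of_lt hc] at h1
      refine ⟨true, ?_⟩
      simp only [if_true]
      exact_mod_cast h1
    · rw [Nat.mod_eq_sub_mod (by omega), Nat.mod_eq_of_lt (by omega)] at h1
      refine ⟨false, ?_⟩
      have : u'.val + p * v'.val + m = u.val + p * v.val + b.val := by omega
      have : (u'.val : ℤ) + p * v'.val + m = u.val + p * v.val + b.val := by exact_mod_cast this
      simp only [Bool.false_eq_true, if_false]
      linarith
  obtain ⟨i, hi⟩ := h3
  refine ⟨i, ?_⟩
  generalize (if i then (b.val : ℤ) else (b.val : ℤ) - m) = N at hi ⊢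
  have hp : (0 : ℤ) < p := by exact_mod_cast Nat.pos_of_ne_zero (NeZero.ne p)
  have e1 : u' = u + (N : ZMod p) := by
    have := congrArg (fun z : ℤ => (z : ZMod p)) hi
    simpa using this
  have hvv : v' = v + (((v'.val : ℤ) - v.val : ℤ) : ZMod p) := by simp
  by_cases hc : u.val ≤ u'.val
  · refine ⟨false, e1, ?_⟩
    have : N / (p : ℤ) = (v'.val : ℤ) - v.val := by
      have hN : N = ((u'.val : ℤ) - u.val) + p * ((v'.val : ℤ) - v.val) := by linarith
      rw [hN, Int.add_mul_ediv_left _ _ hp.ne', Int.ediv_eq_zero_of_lt (by omega) (by omega)]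
      ring
    rw [this]
    simp
  · refine ⟨true, e1, ?_⟩
    have : N / (p : ℤ) = (v'.val : ℤ) - v.val - 1 := by
      have hN : N = ((u'.val : ℤ) - u.val + p) + p * ((v'.val : ℤ) - v.val - 1) := by linarith
      rw [hN, Int.add_mul_ediv_left _ _ hp.ne', Int.ediv_eq_zero_of_lt (by omega) (by omega)]
      ring
    rw [this]
    simp

open Polynomial in
lemma pf_quad {p : ℕ} [Fact p.Prime] (hp : 3 < p) (c c' d e : ZMod p) (hc' : c' ≠ 0)
    (h : ¬ (c = c' ∧ d = 0)) :
    (Finset.univ.filter (fun x : ZMod p => c' * (x + d) ^ 2 = c * x ^ 2 + e)).card ≤ 2 := by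
  have h2 : (2 : ZMod p) ≠ 0 := by
    have : ((2 : ℕ) : ZMod p) ≠ 0 := by
      rw [Ne, ZMod.natCast_eq_zero_iff]
      intro hd
      have := Nat.le_of_dvd (by norm_num) hd
      omega
    exact_mod_cast this
  let P : (ZMod p)[X] := C (c' - c) * X ^ 2 + C (2 * c' * d) * X + C (c' * d ^ 2 - e)
  have hP : P ≠ 0 := by
    intro h0
    have a2 : P.coeff 2 = 0 := by rw [h0]; simp
    have a1 : P.coeff 1 = 0 := by rw [h0]; simp
    simp only [P] at a1 a2
    rw [coeff_add, coeff_add, coeff_C_mul, coeff_C_mul, coeff_X_pow, coeff_X, coeff_C] at a1 a2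
    simp at a1 a2
    apply h
    refine ⟨(sub_eq_zero.mp a2).symm, ?_⟩
    tauto
  have hdeg : P.natDegree ≤ 2 := natDegree_quadratic_le
  have hsub : (Finset.univ.filter (fun x : ZMod p => c' * (x + d) ^ 2 = c * x ^ 2 + e)) ⊆
      P.roots.toFinset := by
    intro x hx
    simp only [Finset.mem_filter, Finset.mem_univ, true_and] at hx
    rw [Multiset.mem_toFinset, mem_roots hP, IsRoot.def]
    simp only [P, eval_add, eval_mul, eval_C, eval_pow, eval_X]
    linear_combination hx
  calc _ ≤ P.roots.toFinset.card := Finset.card_le_card hsub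
    _ ≤ Multiset.card P.roots := Multiset.toFinset_card_le _
    _ ≤ P.natDegree := card_roots' P
    _ ≤ 2 := hdeg

lemma pf_inj {p m : ℕ} [NeZero p] (hpm : p * p ≤ m) (u v u' v' : ZMod p)
    (h : ((u'.val + p * v'.val : ℕ) : ZMod m) = ((u.val + p * v.val : ℕ) : ZMod m)) :
    u' = u ∧ v' = v := by
  have hu := ZMod.val_lt u
  have hv := ZMod.val_lt v
  have hu' := ZMod.val_lt u'
  have hv' := ZMod.val_lt v'
  have hA : u.val + p * v.val < m := by nlinarith
  have hA' : u'.val + p * v'.val < m := by nlinarith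
  rw [ZMod.natCast_eq_natCast_iff', Nat.mod_eq_of_lt hA, Nat.mod_eq_of_lt hA'] at h
  have h1 : u'.val = u.val := by
    have := congrArg (· % p) h
    simpa [Nat.add_mul_mod_self_left, Nat.mod_eq_of_lt hu, Nat.mod_eq_of_lt hu'] using this
  have h2 : v'.val = v.val := by
    rw [h1] at h
    exact Nat.eq_of_mul_eq_mul_left (Nat.pos_of_ne_zero (NeZero.ne p)) (by omega)
  exact ⟨ZMod.val_injective p h1, ZMod.val_injective p h2⟩

/-- for every large enough prime `m` there is a set `Q ⊆ ZMod m`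
of size `⌊√m⌋` such that for every nonzero shift `b`, fewer than `8·log₂ m`
elements `a ∈ Q` satisfy `a + b ∈ Q`; i.e. `Q` is `(8 log₂ m)`-periodic-free. -/
theorem exists_periodic_free_set :
    ∃ m₀ : ℕ, ∀ m : ℕ, m.Prime → m ≥ m₀ →
    ∃ Q : Finset (ZMod m), Q.card = Nat.sqrt m ∧
      ∀ b : ZMod m, b ≠ 0 →
        ((Q.filter (fun a => a + b ∈ Q)).card : ℝ) < 8 * Real.logb 2 m := by
  refine ⟨1024, fun m hm hm0 => ?_⟩
  have : NeZero m := ⟨hm.ne_zero⟩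
  have hs : 32 ≤ Nat.sqrt m := by rw [Nat.le_sqrt]; omega
  obtain ⟨p, hp, hp1, hp2⟩ := Nat.exists_prime_lt_and_le_two_mul (Nat.sqrt m / 2) (by omega)
  have : Fact p.Prime := ⟨hp⟩
  have : NeZero p := ⟨hp.ne_zero⟩
  have hps : p ≤ Nat.sqrt m := by omega
  have hpm : p * p ≤ m := Nat.le_sqrt.mp hps
  have hp3 : 3 < p := by omega
  let k : Fin 3 → ZMod p := fun c => ((c.val + 1 : ℕ) : ZMod p)
  have hk0 : ∀ c, k c ≠ 0 := by
    intro c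
    simp only [k]
    rw [Ne, ZMod.natCast_eq_zero_iff]
    intro hd
    have := Nat.le_of_dvd (by omega) hd
    omega
  have hkinj : ∀ c c', k c = k c' → c = c' := by
    intro c c' h
    simp only [k] at h
    rw [ZMod.natCast_eq_natCast_iff', Nat.mod_eq_of_lt (by omega), Nat.mod_eq_of_lt (by omega)] at h
    ext
    omega
  let f : Fin 3 → ZMod p → ZMod m := fun c x => ((x.val + p * (k c * x ^ 2).val : ℕ) : ZMod m)
  let D : Finset (Fin 3 × ZMod p) := Finset.univ ×ˢ (Finset.univ.erase 0)
  let Q0 : Finset (ZMod m) := D.image (fun t => f t.1 t.2)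
  have hD : D.card = 3 * (p - 1) := by
    simp only [D]
    rw [Finset.card_product, Finset.card_erase_of_mem (Finset.mem_univ _), Finset.card_univ,
      Finset.card_univ, ZMod.card, Fintype.card_fin]
  have hQ0 : Q0.card = D.card := by
    apply Finset.card_image_of_injOn
    rintro ⟨c, x⟩ hx ⟨c', x'⟩ hx' h
    obtain ⟨h1, h2⟩ := pf_inj hpm _ _ _ _ h
    subst h1
    have hx0 : x ≠ 0 := by simpa [D] using hx
    have := hkinj _ _ (mul_right_cancel₀ (pow_ne_zero 2 hx0) h2)
    exact Prod.ext this rfl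
  obtain ⟨Q, hQ, hQc⟩ := Finset.exists_subset_card_eq (s := Q0) (n := Nat.sqrt m)
    (by rw [hQ0, hD]; omega)
  refine ⟨Q, hQc, fun b hb => ?_⟩
  let N : Bool → ℤ := fun i => if i then (b.val : ℤ) else (b.val : ℤ) - m
  let d : Bool → ZMod p := fun i => (N i : ZMod p)
  let e : Bool → Bool → ZMod p := fun i j => ((N i / (p : ℤ) + (if j then 1 else 0) : ℤ) : ZMod p)
  let S : Fin 3 × Fin 3 × Bool × Bool → Finset (ZMod p) := fun t =>
    if t.1 = t.2.1 ∧ d t.2.2.1 = 0 then ∅ else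
    Finset.univ.filter (fun x : ZMod p => k t.2.1 * (x + d t.2.2.1) ^ 2
      = k t.1 * x ^ 2 + e t.2.2.1 t.2.2.2)
  have hS : ∀ t, (S t).card ≤ 2 := by
    intro t
    simp only [S]
    split_ifs with h
    · simp
    · apply pf_quad hp3 _ _ _ _ (hk0 _)
      rintro ⟨h1, h2⟩
      exact h ⟨hkinj _ _ h1, h2⟩
  have hsub : Q.filter (fun a => a + b ∈ Q) ⊆
      (Finset.univ : Finset (Fin 3 × Fin 3 × Bool × Bool)).biUnion
        (fun t => (S t).image (f t.1)) := by
    intro a ha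
    rw [Finset.mem_filter] at ha
    obtain ⟨⟨c, x⟩, -, h1⟩ := Finset.mem_image.mp (hQ ha.1)
    obtain ⟨⟨c', x'⟩, -, h2⟩ := Finset.mem_image.mp (hQ ha.2)
    rw [← h1] at h2
    obtain ⟨i, j, e1, e2⟩ := pf_key hpm b _ _ _ _ h2
    change x' = x + d i at e1
    change k c' * x' ^ 2 = k c * x ^ 2 + e i j at e2
    rw [Finset.mem_biUnion]
    refine ⟨(c, c', i, j), Finset.mem_univ _, Finset.mem_image.mpr ⟨x, ?_, h1⟩⟩
    simp only [S]
    split_ifs with h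
    · exfalso
      obtain ⟨hcc, hd⟩ := h
      rw [hd, add_zero] at e1
      subst e1
      subst hcc
      exact hb (left_eq_add.mp h2)
    · rw [e1] at e2
      simp [e2]
  have hcard : (Q.filter (fun a => a + b ∈ Q)).card ≤ 72 := by
    refine (Finset.card_le_card hsub).trans ?_
    refine (Finset.card_biUnion_le_card_mul _ _ 2 ?_).trans ?_
    · intro t _
      exact Finset.card_image_le.trans (hS t)
    · simp
  have hlog : (10 : ℝ) ≤ Real.logb 2 m := by
    rw [Real.le_logb_iff_rpow_le (by norm_num) (by exact_mod_cast hm.pos)]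
    norm_num
    exact hm0
  have : ((Q.filter (fun a => a + b ∈ Q)).card : ℝ) ≤ 72 := by exact_mod_cast hcard
  linarith
end

section
/- Let m be a prime, β > 0, and let Q' ⊆ ZMod m be β-periodic-free with |Q'| = r. Let ℓ : Q' → ZMod m be a function whose image has exactly t ≥ 1 distinct values. Then for every integer j with 1 ≤ j ≤ t, the set {ℓ(q) + q : q ∈ Q'} ⊆ ZMod m has size greater than j·r/t − β·j². -/
theorem aux_top {α : Type*} [DecidableEq α] (f : α → ℝ) (j : ℕ) (hj : 1 ≤ j) :
    ∀ n : ℕ, ∀ T : Finset α, T.card = n → j ≤ n →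
      ∃ S ⊆ T, S.card = j ∧ (j : ℝ) * ∑ x ∈ T, f x ≤ n * ∑ x ∈ S, f x := by
  intro n
  induction n with
  | zero => intro T _ h; omega
  | succ n ih =>
    intro T hT hjn
    rcases Nat.eq_or_lt_of_le hjn with h | h
    · exact ⟨T, Finset.Subset.refl _, by omega, by rw [h]⟩
    · have hne : T.Nonempty := Finset.card_pos.mp (by omega)
      obtain ⟨a, ha, hmin⟩ := Finset.exists_min_image T f hne
      obtain ⟨S, hS, hc, hle⟩ := ih (T.erase a)
        (by rw [Finset.card_erase_of_mem ha]; omega) (by omega)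
      refine ⟨S, hS.trans (Finset.erase_subset _ _), hc, ?_⟩
      have h1 : ∑ x ∈ T.erase a, f x + f a = ∑ x ∈ T, f x := Finset.sum_erase_add T f ha
      have h2 : ((n + 1 : ℕ) : ℝ) * f a ≤ ∑ x ∈ T, f x := by
        have := Finset.card_nsmul_le_sum T f (f a) hmin
        rwa [hT, nsmul_eq_mul] at this
      have hn : (0 : ℝ) < n := by
        have : 0 < n := by omega
        exact_mod_cast this
      have hj0 : (0 : ℝ) ≤ j := Nat.cast_nonneg j
      push_cast at h2 ⊢
      have h3 : (n : ℝ) * ∑ x ∈ T, f x ≤ (n + 1) * ∑ x ∈ T.erase a, f x := by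
        rw [← h1] at h2 ⊢
        linarith
      have h4 := mul_le_mul_of_nonneg_left h3 hj0
      have h5 := mul_le_mul_of_nonneg_left hle (by positivity : (0 : ℝ) ≤ n + 1)
      refine le_of_mul_le_mul_left ?_ hn
      linarith

theorem aux_union {α γ : Type*} [DecidableEq α] [DecidableEq γ] (R : γ → Finset α) (β : ℝ)
    (hβ : 0 < β) (hR : ∀ a c, a ≠ c → ((R a ∩ R c).card : ℝ) < β) (S : Finset γ) :
    ∑ c ∈ S, ((R c).card : ℝ) - β * ((S.card : ℝ) ^ 2 - S.card) ≤ ((S.biUnion R).card : ℝ) := by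
  induction S using Finset.induction_on with
  | empty => simp
  | insert a S ha ih =>
    rw [Finset.sum_insert ha, Finset.biUnion_insert, Finset.card_insert_of_notMem ha]
    have h1 : ((R a ∪ S.biUnion R).card : ℝ) + ((R a ∩ S.biUnion R).card : ℝ)
        = (R a).card + (S.biUnion R).card := by
      exact_mod_cast Finset.card_union_add_card_inter _ _
    have h2 : ((R a ∩ S.biUnion R).card : ℝ) ≤ S.card * β := by
      rw [Finset.inter_biUnion]
      calc (((S.biUnion fun c => R a ∩ R c).card : ℕ) : ℝ)
          ≤ ((∑ c ∈ S, (R a ∩ R c).card : ℕ) : ℝ) := by exact_mod_cast Finset.card_biUnion_le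
        _ = ∑ c ∈ S, ((R a ∩ R c).card : ℝ) := by push_cast; rfl
        _ ≤ S.card • β := Finset.sum_le_card_nsmul _ _ _ (fun c hc =>
            (hR a c (fun h => ha (h ▸ hc))).le)
        _ = S.card * β := nsmul_eq_mul _ _
    have h3 : 0 ≤ (S.card : ℝ) * β := by positivity
    push_cast
    nlinarith

/-- if `Q' ⊆ ZMod m` is `β`-periodic-free with `|Q'| = r` and
`ℓ : Q' → ZMod m` takes exactly `t ≥ 1` values, then for every `1 ≤ j ≤ t` the
set `{ℓ(q) + q : q ∈ Q'}` has size greater than `j·r/t − β·j²`. -/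
theorem shifted_image_lower_bound
    (m : ℕ) (hm : m.Prime) (β : ℝ) (hβ : 0 < β)
    (Q' : Finset (ZMod m)) (hQ' : PeriodicFree m β Q')
    (r : ℕ) (hr : Q'.card = r)
    (l : ZMod m → ZMod m) (t : ℕ) (ht : (Q'.image l).card = t) (ht1 : 1 ≤ t) :
    ∀ j : ℕ, 1 ≤ j → j ≤ t →
      ((Q'.image (fun q => l q + q)).card : ℝ)
        > (j : ℝ) * r / t - β * (j : ℝ) ^ 2 := by
  intro j hj hjt
  set R : ZMod m → Finset (ZMod m) :=
    fun c => (Q'.filter (fun q => l q = c)).image (fun q => c + q) with hRdef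
  have hcard : ∀ c, (R c).card = (Q'.filter (fun q => l q = c)).card := fun c =>
    Finset.card_image_of_injective _ (add_right_injective c)
  have hR : ∀ a c, a ≠ c → ((R a ∩ R c).card : ℝ) < β := by
    intro a c hac
    have hmem : ∀ d x, x ∈ R d → x - d ∈ Q' := by
      intro d x hx
      simp only [hRdef, Finset.mem_image, Finset.mem_filter] at hx
      obtain ⟨q, ⟨hq, _⟩, rfl⟩ := hx
      simpa using hq
    have := hQ' ((R a ∩ R c).image (fun x => x - a)) ?_ (a - c) (sub_ne_zero.mpr hac) ?_
    · rwa [Finset.card_image_of_injective _ (sub_left_injective)] at this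
    · intro y hy
      obtain ⟨x, hx, rfl⟩ := Finset.mem_image.mp hy
      exact hmem a x (Finset.mem_inter.mp hx).1
    · intro y hy
      obtain ⟨z, hz, rfl⟩ := Finset.mem_image.mp hy
      obtain ⟨x, hx, rfl⟩ := Finset.mem_image.mp hz
      have := hmem c x (Finset.mem_inter.mp hx).2
      simpa using this
  obtain ⟨S, hS, hSc, hle⟩ := aux_top (fun c => ((R c).card : ℝ)) j hj t (Q'.image l) ht hjt
  have hsum : ∑ c ∈ Q'.image l, ((R c).card : ℝ) = r := by
    have h := Finset.card_eq_sum_card_image l Q'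
    rw [← hr, h]
    push_cast
    exact Finset.sum_congr rfl (fun c _ => by rw [hcard])
  have hU := aux_union R β hβ hR S
  have hsub : S.biUnion R ⊆ Q'.image (fun q => l q + q) := by
    intro x hx
    obtain ⟨c, _, hx⟩ := Finset.mem_biUnion.mp hx
    simp only [hRdef, Finset.mem_image, Finset.mem_filter] at hx
    obtain ⟨q, ⟨hq, rfl⟩, rfl⟩ := hx
    exact Finset.mem_image_of_mem _ hq
  have hsub' : ((S.biUnion R).card : ℝ) ≤ ((Q'.image (fun q => l q + q)).card : ℝ) := by
    exact_mod_cast Finset.card_le_card hsub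
  have ht0 : (0 : ℝ) < t := by exact_mod_cast ht1
  have hj0 : (0 : ℝ) < j := by exact_mod_cast hj
  rw [hsum] at hle
  have hdiv : (j : ℝ) * r / t ≤ ∑ c ∈ S, ((R c).card : ℝ) := by
    rw [div_le_iff₀ ht0]; linarith
  rw [hSc] at hU
  have := mul_pos hβ hj0
  linarith
end

section
/- Let k ≥ 1 and 0 ≤ ε ≤ 1/2. Let p be a probability mass function on {0,1}^k (i.e., p : ({0,1}^k) → ℝ≥0 with ∑_w p(w) = 1), and suppose there is a fixed vector v ∈ {0,1}^k such that the expected Hamming distance ∑_w p(w) · d_H(w, v) is at most ε·k. Then the Shannon entropy H(p) := ∑_{w : p(w) > 0} p(w) · log₂(1/p(w)) satisfies H(p) ≤ k · H₂(ε), where H₂(ε) = −ε·log₂ ε − (1−ε)·log₂(1−ε) is the binary entropy function (with H₂(0) = H₂(1) = 0). -/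
/-- generalized Fano inequality of Bar-Yossef–Jayram–Kerenidis:
if a probability mass function `p` on `{0,1}^k` has expected Hamming distance at
most `ε·k` from a fixed vector `v` (for `0 ≤ ε ≤ 1/2`), then its Shannon entropy
is at most `k · H₂(ε)`, where `H₂` is the binary entropy function. -/
theorem entropy_le_of_expected_hamming_distance_le
    (k : ℕ) (hk : 1 ≤ k) (ε : ℝ) (hε0 : 0 ≤ ε) (hε2 : ε ≤ 1 / 2)
    (p : (Fin k → Bool) → ℝ) (hp0 : ∀ w, 0 ≤ p w) (hp1 : ∑ w, p w = 1)
    (v : Fin k → Bool)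
    (hdist : ∑ w, p w * ((Finset.univ.filter (fun i => w i ≠ v i)).card : ℝ)
      ≤ ε * k) :
    ∑ w, -(p w * Real.logb 2 (p w))
      ≤ k * (-(ε * Real.logb 2 ε) - (1 - ε) * Real.logb 2 (1 - ε)) := by
  have hl2 : 0 < Real.log 2 := Real.log_pos (by norm_num)
  have key : ∑ w, -(p w * Real.log (p w))
      ≤ k * (-(ε * Real.log ε) - (1 - ε) * Real.log (1 - ε)) := by
    rcases hε0.eq_or_lt with h0 | hpos
    · subst h0
      simp only [zero_mul, sub_zero, Real.log_one, mul_zero, neg_zero] at hdist ⊢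
      have hnn : ∀ w ∈ Finset.univ,
          0 ≤ p w * ((Finset.univ.filter (fun i => w i ≠ v i)).card : ℝ) :=
        fun w _ => mul_nonneg (hp0 w) (Nat.cast_nonneg _)
      have hz := (Finset.sum_eq_zero_iff_of_nonneg hnn).1
        (le_antisymm hdist (Finset.sum_nonneg hnn))
      have hw : ∀ w, w ≠ v → p w = 0 := by
        intro w hne
        rcases mul_eq_zero.1 (hz w (Finset.mem_univ _)) with h | h
        · exact h
        · exfalso
          apply hne
          funext i
          have h' : (Finset.univ.filter (fun i => w i ≠ v i)) = ∅ := by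
            exact Finset.card_eq_zero.1 (by exact_mod_cast h)
          by_contra hi
          have : i ∈ (Finset.univ.filter (fun i => w i ≠ v i)) := by simp [hi]
          rw [h'] at this
          simp at this
      have hv : p v = 1 := by
        rw [← hp1]
        exact (Finset.sum_eq_single v (fun w _ h => hw w h) (by simp)).symm
      apply le_of_eq
      apply Finset.sum_eq_zero
      intro w _
      by_cases h : w = v
      · subst h; simp [hv]
      · simp [hw w h]
    · have h1 : 0 < 1 - ε := by linarith
      let q : (Fin k → Bool) → ℝ := fun w => ∏ i, (if w i ≠ v i then ε else 1 - ε)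
      have hf : ∀ w : Fin k → Bool, ∀ i, 0 < (if w i ≠ v i then ε else 1 - ε) := by
        intro w i; split_ifs <;> assumption
      have hq : ∀ w, 0 < q w := fun w => Finset.prod_pos fun i _ => hf w i
      have hqs : ∑ w, q w = 1 := by
        have := Finset.prod_univ_sum (fun _ : Fin k => (Finset.univ : Finset Bool))
          (fun i b => if b ≠ v i then ε else 1 - ε)
        rw [Fintype.piFinset_univ] at this
        rw [← this]
        apply Finset.prod_eq_one
        intro i _
        cases v i <;> simp
      have hlq : ∀ w, Real.log (q w) = k * Real.log (1 - ε) +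
          ((Finset.univ.filter (fun i => w i ≠ v i)).card : ℝ)
            * (Real.log ε - Real.log (1 - ε)) := by
        intro w
        have e : ∀ i, Real.log (if w i ≠ v i then ε else 1 - ε) =
            Real.log (1 - ε) + (if w i ≠ v i then (Real.log ε - Real.log (1 - ε)) else 0) := by
          intro i; split_ifs <;> ring
        rw [Real.log_prod (fun i _ => (hf w i).ne')]
        simp only [e, Finset.sum_add_distrib]
        rw [← Finset.sum_filter]
        simp
        ring
      have hg : ∀ w, -(p w * Real.log (p w)) ≤ -(p w * Real.log (q w)) + (q w - p w) := by
        intro w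
        rcases (hp0 w).eq_or_lt with h | h
        · rw [← h]; simpa using (hq w).le
        · have h2 := Real.log_le_sub_one_of_pos (div_pos (hq w) h)
          rw [Real.log_div (hq w).ne' h.ne'] at h2
          have h3 := mul_le_mul_of_nonneg_left h2 h.le
          have h4 : p w * (q w / p w - 1) = q w - p w := by field_simp
          linarith
      refine (Finset.sum_le_sum fun w _ => hg w).trans ?_
      have hs : ∑ w, (-(p w * Real.log (q w)) + (q w - p w)) =
          -(k * Real.log (1 - ε)) + (∑ w, p w *
            ((Finset.univ.filter (fun i => w i ≠ v i)).card : ℝ))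
              * (Real.log (1 - ε) - Real.log ε) := by
        rw [Finset.sum_add_distrib, Finset.sum_sub_distrib, hqs, hp1, sub_self, add_zero,
          Finset.sum_mul]
        have : -(k * Real.log (1 - ε)) = ∑ w, p w * (-(k * Real.log (1 - ε))) := by
          rw [← Finset.sum_mul, hp1, one_mul]
        rw [this, ← Finset.sum_add_distrib]
        apply Finset.sum_congr rfl
        intro w _
        rw [hlq]; ring
      rw [hs]
      have hlog : 0 ≤ Real.log (1 - ε) - Real.log ε :=
        sub_nonneg.2 (Real.log_le_log hpos (by linarith))
      have := mul_le_mul_of_nonneg_right hdist hlog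
      linarith
  have e1 : ∑ w, -(p w * Real.logb 2 (p w)) = (∑ w, -(p w * Real.log (p w))) / Real.log 2 := by
    rw [Finset.sum_div]
    apply Finset.sum_congr rfl
    intro w _
    rw [Real.logb]; ring
  have e2 : k * (-(ε * Real.logb 2 ε) - (1 - ε) * Real.logb 2 (1 - ε)) =
      (k * (-(ε * Real.log ε) - (1 - ε) * Real.log (1 - ε))) / Real.log 2 := by
    rw [Real.logb, Real.logb]; ring
  rw [e1, e2]
  exact div_le_div_of_nonneg_right key hl2.le
end

section
/- Let m, α, k, N be positive integers with 1 ≤ α ≤ k² and k · C(m, α) ≤ N, where C(m, α) is the binomial coefficient. Then there exists a function g : Fin N × Fin N → Fin m such that for every subset Q ⊆ Fin m with |Q| = α, there exist subsets S, T ⊆ Fin N with |S| = |T| = k and {g(x, y) : x ∈ S, y ∈ T} = Q. -/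
/-- existence of rich gadgets. If `1 ≤ α ≤ k²` and
`k · C(m, α) ≤ N`, then there is a function `g : Fin N × Fin N → Fin m` such
that every subset `Q ⊆ Fin m` of size `α` is exactly the image under `g` of some
product `S × T` with `|S| = |T| = k`. -/
theorem exists_rich_gadget
    (m α k N : ℕ) (hm : 0 < m) (hk : 0 < k) (hN : 0 < N)
    (hα1 : 1 ≤ α) (hαk : α ≤ k ^ 2) (hkN : k * Nat.choose m α ≤ N) :
    ∃ g : Fin N × Fin N → Fin m,
      ∀ Q : Finset (Fin m), Q.card = α →
      ∃ S T : Finset (Fin N), S.card = k ∧ T.card = k ∧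
        (S ×ˢ T).image g = Q := by
  classical
  let P := {Q : Finset (Fin m) // Q.card = α}
  have hP : Fintype.card P = Nat.choose m α := by
    simp [P]
  obtain ⟨e⟩ : Nonempty (P × Fin k ↪ Fin N) := by
    apply Function.Embedding.nonempty_of_card_le
    rw [Fintype.card_prod, hP, Fintype.card_fin, Fintype.card_fin, mul_comm]
    exact hkN
  have hf : ∀ Q : P, ∃ f : Fin k × Fin k → Fin m, Finset.univ.image f = Q.1 := by
    rintro ⟨Q, hQ⟩
    have hne : Nonempty Q := by
      have : 0 < Q.card := by omega
      exact (Finset.card_pos.mp this).to_subtype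
    obtain ⟨i⟩ : Nonempty (Q ↪ Fin k × Fin k) := by
      apply Function.Embedding.nonempty_of_card_le
      rw [Fintype.card_prod, Fintype.card_fin, Fintype.card_coe, hQ, ← sq]
      exact hαk
    refine ⟨fun p => (Function.invFun i p : Q).1, ?_⟩
    ext a
    simp only [Finset.mem_image, Finset.mem_univ, true_and]
    constructor
    · rintro ⟨p, rfl⟩
      exact (Function.invFun i p).2
    · intro ha
      exact ⟨i ⟨a, ha⟩, by rw [Function.leftInverse_invFun i.injective]⟩
  choose f hf using hf
  let h : (P × Fin k) × (P × Fin k) → Fin m := fun p => f p.1.1 (p.1.2, p.2.2)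
  have hinj : Function.Injective (Prod.map e e) := e.injective.prodMap e.injective
  refine ⟨Function.extend (Prod.map e e) h (fun _ => ⟨0, hm⟩), fun Q hQ => ?_⟩
  have hg : ∀ a b, Function.extend (Prod.map e e) h (fun _ => ⟨0, hm⟩) (e a, e b) = h (a, b) :=
    fun a b => hinj.extend_apply h _ (a, b)
  let q : P := ⟨Q, hQ⟩
  have hc : (Finset.univ.image (fun i : Fin k => e (q, i))).card = k := by
    rw [Finset.card_image_of_injective, Finset.card_univ, Fintype.card_fin]
    intro i j hij
    exact (Prod.mk.inj (e.injective hij)).2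
  refine ⟨_, _, hc, hc, ?_⟩
  refine Eq.trans ?_ (hf q)
  ext a
  simp only [Finset.mem_image, Finset.mem_product, Finset.mem_univ, true_and]
  constructor
  · rintro ⟨⟨x, y⟩, ⟨⟨i, rfl⟩, ⟨j, rfl⟩⟩, rfl⟩
    exact ⟨(i, j), (hg (q, i) (q, j)).symm⟩
  · rintro ⟨⟨i, j⟩, rfl⟩
    exact ⟨(e (q, i), e (q, j)), ⟨⟨i, rfl⟩, ⟨j, rfl⟩⟩, hg (q, i) (q, j)⟩
end
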